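/- Let 1/2 ≤ α < β < 1. Let f : I × I → ℝ be Hölder continuous with ∫ f dν = 0 and c := ∫₀¹ f(0,ω) dω = 0, and suppose there exist γ > (β/α)(α − 1/2) and a constant C_f with |f(x,ω) − f(0,ω)| ≤ C_f x^γ for all (x,ω) ∈ I × I. Then there exists σ² ≥ 0 such that the distributions of (1/√n) S_n f under ν converge weakly, as n → ∞, to the Gaussian law N(0,σ²) (the Dirac mass at 0 if σ² = 0). -/

import Mathlib

open MeasureTheory Filter Set Topology

noncomputable section

/-- The Liverani–Saussol–Vaienti map `T_a` on `[0,1]`. -/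
def lsv (a x : ℝ) : ℝ := if x ≤ 1 / 2 then x * (1 + (2 : ℝ) ^ a * x ^ a) else 2 * x - 1

/-- Random parameter selection: `α` on `[0,p₁)`, `β` on `[p₁,1]`. -/
def alphaOf (α β p₁ ω : ℝ) : ℝ := if ω < p₁ then α else β

/-- The noise dynamics `φ` on `[0,1]`. -/
def phiMap (p₁ ω : ℝ) : ℝ := if ω < p₁ then ω / p₁ else (ω - p₁) / (1 - p₁)

/-- The skew product `S(x,ω) = (T_{α(ω)} x, φ ω)`. -/
def skewLSV (α β p₁ : ℝ) (p : ℝ × ℝ) : ℝ × ℝ :=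
  (lsv (alphaOf α β p₁ p.2) p.1, phiMap p₁ p.2)

/-- The base of inducing, `Δ₀ = (1/2,1] × [0,1]`. -/
def Δ0 : Set (ℝ × ℝ) := Ioc (1 / 2 : ℝ) 1 ×ˢ Icc (0 : ℝ) 1

/-- Birkhoff sums `S_n f` of the skew product. -/
def birkhoff (α β p₁ : ℝ) (f : ℝ × ℝ → ℝ) (n : ℕ) (p : ℝ × ℝ) : ℝ :=
  ∑ k ∈ Finset.range n, f ((skewLSV α β p₁)^[k] p)

theorem integral_comp_of_measurePreserving {X Y E : Type*} [MeasurableSpace X] [MeasurableSpace Y]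
    [NormedAddCommGroup E] [NormedSpace ℝ E] {μ : Measure X} {ν : Measure Y} {S : X → Y}
    (hS : MeasurePreserving S μ ν) {g : Y → E} (hg : AEStronglyMeasurable g ν) :
    ∫ x, g (S x) ∂μ = ∫ x, g x ∂ν := by
  rw [← hS.map_eq] at hg ⊢
  exact (integral_map hS.measurable.aemeasurable hg).symm

/-- Mean ergodic theorem: Birkhoff averages of a square integrable function converge in mean. -/
theorem tendsto_integral_abs_birkhoffAverage {X : Type*} [MeasurableSpace X] {ν : Measure X}
    [IsProbabilityMeasure ν] {S : X → X} (hS : Ergodic S ν) {g : X → ℝ} (hg : MemLp g 2 ν) :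
    Tendsto (fun n : ℕ => ∫ x, |birkhoffSum S g n x / n - ∫ y, g y ∂ν| ∂ν) atTop (𝓝 0) := by
  set U := Lp.compMeasurePreservingₗᵢ (E := ℝ) (p := 2) ℝ S hS.toMeasurePreserving with hU
  set G := hg.toLp g with hG
  set P := (((U.toContinuousLinearMap : Lp ℝ 2 ν →L[ℝ] Lp ℝ 2 ν).eqLocus
    (1 : Lp ℝ 2 ν →L[ℝ] Lp ℝ 2 ν)).orthogonalProjectionOnto G) with hP
  have hlim := ContinuousLinearMap.tendsto_birkhoffAverage_orthogonalProjection
    U.toContinuousLinearMap U.norm_toContinuousLinearMap_le G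
  have hfix : U (P : Lp ℝ 2 ν) = P := P.2
  have hUae : ∀ F : Lp ℝ 2 ν, U F =ᵐ[ν] F ∘ S := fun F =>
    Lp.coeFn_compMeasurePreserving F hS.toMeasurePreserving
  have hiter : ∀ k : ℕ, (U^[k] G : Lp ℝ 2 ν) =ᵐ[ν] g ∘ S^[k] := by
    intro k
    induction k with
    | zero => simpa using hg.coeFn_toLp
    | succ k ih =>
      rw [Function.iterate_succ_apply']
      refine (hUae _).trans ?_
      rw [Function.iterate_succ, ← Function.comp_assoc]
      exact hS.quasiMeasurePreserving.ae_eq_comp ih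
  have havg : ∀ n : ℕ, (birkhoffAverage ℝ U.toContinuousLinearMap _root_.id n G : Lp ℝ 2 ν)
      =ᵐ[ν] fun x => birkhoffSum S g n x / n := by
    intro n
    have h1 : (birkhoffAverage ℝ U.toContinuousLinearMap _root_.id n G : Lp ℝ 2 ν)
        = (n : ℝ)⁻¹ • ∑ k ∈ Finset.range n, U^[k] G := by
      simp [birkhoffAverage, birkhoffSum]
    rw [h1]
    refine (Lp.coeFn_smul _ _).trans ?_
    have h2 : ∀ m : ℕ, ((∑ k ∈ Finset.range m, U^[k] G : Lp ℝ 2 ν) : X → ℝ) =ᵐ[ν]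
        birkhoffSum S g m := by
      intro m
      induction m with
      | zero => simpa using Lp.coeFn_zero ℝ 2 ν
      | succ m ih =>
        rw [Finset.sum_range_succ]
        filter_upwards [Lp.coeFn_add (∑ k ∈ Finset.range m, U^[k] G) (U^[m] G), ih, hiter m]
          with x h1 h2 h3
        rw [h1, Pi.add_apply, h2, h3, birkhoffSum_succ]
        rfl
    filter_upwards [h2 n] with x hx
    simp only [Pi.smul_apply, hx, smul_eq_mul]
    ring
  obtain ⟨c, hc⟩ := hS.ae_eq_const_of_ae_eq_comp_ae (Lp.aestronglyMeasurable (P : Lp ℝ 2 ν))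
    ((hUae P).symm.trans (by rw [hfix]))
  have hmeas : ∀ n : ℕ, MemLp (fun x => birkhoffSum S g n x / n) 2 ν := fun n =>
    (memLp_congr_ae (havg n)).1 (Lp.memLp _)
  have key : Tendsto (fun n : ℕ => ∫ x, |birkhoffSum S g n x / n - c| ∂ν) atTop (𝓝 0) := by
    have h0 := (tendsto_iff_norm_sub_tendsto_zero.1 hlim)
    refine squeeze_zero (fun n => integral_nonneg fun x => abs_nonneg _) (fun n => ?_) h0
    rw [Lp.norm_def]
    have e1 : ((birkhoffAverage ℝ U.toContinuousLinearMap _root_.id n G - P : Lp ℝ 2 ν) : X → ℝ)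
        =ᵐ[ν] fun x => birkhoffSum S g n x / n - c := by
      filter_upwards [Lp.coeFn_sub (birkhoffAverage ℝ U.toContinuousLinearMap _root_.id n G)
        (P : Lp ℝ 2 ν), havg n, hc] with x h1 h2 h3
      rw [h1, Pi.sub_apply, h2, h3]; rfl
    have hm : MemLp (fun x => birkhoffSum S g n x / n - c) 2 ν := (hmeas n).sub (memLp_const c)
    rw [eLpNorm_congr_ae e1]
    have h2 := eLpNorm_le_eLpNorm_of_exponent_le (μ := ν) (p := 1) (q := 2) (by norm_num) hm.1
    have h3 : ∫ x, |birkhoffSum S g n x / n - c| ∂ν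
        = (eLpNorm (fun x => birkhoffSum S g n x / n - c) 1 ν).toReal := by
      rw [eLpNorm_one_eq_lintegral_enorm, integral_eq_lintegral_of_nonneg_ae
        (ae_of_all _ fun _ => abs_nonneg _) hm.1.norm]
      congr 1
      refine lintegral_congr fun x => ?_
      rw [← ofReal_norm, Real.norm_eq_abs]
    rw [h3]
    exact ENNReal.toReal_mono hm.2.ne h2
  have hi0 : ∀ n : ℕ, 0 < n → ∫ x, birkhoffSum S g n x / n ∂ν = ∫ x, g x ∂ν := by
    intro n hn
    have h1 : ∀ k : ℕ, ∫ x, g (S^[k] x) ∂ν = ∫ x, g x ∂ν := fun k =>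
      integral_comp_of_measurePreserving (hS.toMeasurePreserving.iterate k) hg.1
    have h1' : ∀ k : ℕ, Integrable (fun x => g (S^[k] x)) ν := fun k =>
      (hS.toMeasurePreserving.iterate k).integrable_comp_of_integrable
        (hg.integrable (by norm_num))
    rw [integral_div]
    simp only [birkhoffSum]
    rw [integral_finsetSum _ fun k _ => h1' k]
    simp only [h1, Finset.sum_const, Finset.card_range, nsmul_eq_mul]
    have : (n : ℝ) ≠ 0 := by positivity
    field_simp
  have hcc : ∫ y, g y ∂ν = c := by
    have h1 : ∀ᶠ n : ℕ in atTop, |(∫ y, g y ∂ν) - c| ≤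
        ∫ x, |birkhoffSum S g n x / n - c| ∂ν := by
      filter_upwards [eventually_gt_atTop 0] with n hn
      have h2 : (∫ y, g y ∂ν) - c = ∫ x, (birkhoffSum S g n x / n - c) ∂ν := by
        rw [integral_sub ((hmeas n).integrable (by norm_num)) (integrable_const _), hi0 n hn]
        simp
      rw [h2]
      exact abs_integral_le_integral_abs
    have h3 := ge_of_tendsto key h1
    exact sub_eq_zero.1 (abs_nonpos_iff.1 h3)
  rw [hcc]
  exact key

theorem norm_cexp_sub_cexp_le {a b : ℂ} {c : ℝ} (ha : a.re ≤ c) (hb : b.re ≤ c) :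
    ‖Complex.exp a - Complex.exp b‖ ≤ Real.exp c * ‖a - b‖ := by
  refine (convex_halfSpace_re_le c).norm_image_sub_le_of_norm_deriv_le (𝕜 := ℂ)
    (fun x _ => Complex.differentiableAt_exp) (fun x hx => ?_) hb ha
  rw [Complex.deriv_exp, Complex.norm_exp]
  exact Real.exp_le_exp.2 hx

/-- The third order remainder in `exp (i x) = (1 + i x) exp (- x ^ 2 / 2 + r x)`. -/
def expRemainder (x : ℝ) : ℂ := x * Complex.I - Complex.log (1 + x * Complex.I) + x ^ 2 / 2

theorem norm_expRemainder_le {x : ℝ} (hx : |x| ≤ 1 / 2) : ‖expRemainder x‖ ≤ |x| ^ 3 := by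
  have hz : ‖(x : ℂ) * Complex.I‖ = |x| := by simp
  have h := Complex.norm_log_sub_logTaylor_le 2 (z := x * Complex.I) (by rw [hz]; linarith)
  have e : expRemainder x
      = -(Complex.log (1 + x * Complex.I) - Complex.logTaylor (2 + 1) (x * Complex.I)) := by
    simp only [expRemainder, Complex.logTaylor, Finset.sum_range_succ, Finset.sum_range_zero]
    simp only [mul_pow, Complex.I_sq]
    push_cast
    ring
  rw [e, norm_neg]
  refine h.trans ?_
  rw [hz]
  have h2 : (1 - |x|)⁻¹ ≤ 2 := by
    rw [inv_le_comm₀ (by linarith) (by norm_num)]; linarith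
  have h3 : 0 ≤ |x| ^ 3 := by positivity
  norm_num
  nlinarith

theorem cexp_mul_I_eq (x : ℝ) : Complex.exp (x * Complex.I)
    = (1 + x * Complex.I) * Complex.exp (expRemainder x - x ^ 2 / 2) := by
  have h0 : (1 + x * Complex.I : ℂ) ≠ 0 := by
    intro h
    have := congrArg Complex.re h
    simp at this
  conv_rhs => rw [← Complex.exp_log h0, ← Complex.exp_add]
  congr 1
  simp only [expRemainder]
  ring

theorem measurable_expRemainder : Measurable expRemainder := by
  unfold expRemainder
  fun_prop

section BoundedMartingale

variable {X : Type*} [MeasurableSpace X] {ν : Measure X} [IsProbabilityMeasure ν] {S : X → X}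

/-- The complex martingale `∏ (1 + i τ m ∘ S^k)` attached to a martingale difference. -/
theorem integral_prod_one_add_mul_I (hS : MeasurePreserving S ν ν) {m : X → ℝ} (hm : Measurable m)
    {K : ℝ} (hK : ∀ x, |m x| ≤ K)
    (hmart : ∀ k : X → ℝ, Measurable k → (∃ C, ∀ x, |k x| ≤ C) → ∫ x, m x * k (S x) ∂ν = 0)
    (τ : ℝ) (n : ℕ) :
    ∫ x, ∏ k ∈ Finset.range n, (1 + ((τ * m (S^[k] x) : ℝ) : ℂ) * Complex.I) ∂ν = 1 := by
  have hSm := hS.measurable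
  have hmeas : ∀ n : ℕ, Measurable fun x => ∏ k ∈ Finset.range n,
      (1 + ((τ * m (S^[k] x) : ℝ) : ℂ) * Complex.I) := by
    intro n
    refine Finset.measurable_fun_prod _ fun k _ => ?_
    have := hm.comp (hSm.iterate k)
    simp only [Function.comp_def] at this
    fun_prop
  have hb : ∀ n : ℕ, ∃ C, ∀ x, ‖∏ k ∈ Finset.range n,
      (1 + ((τ * m (S^[k] x) : ℝ) : ℂ) * Complex.I)‖ ≤ C := by
    intro n
    refine ⟨(1 + |τ| * K) ^ n, fun x => ?_⟩
    rw [norm_prod]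
    calc _ ≤ ∏ k ∈ Finset.range n, (1 + |τ| * K) := by
          refine Finset.prod_le_prod (fun _ _ => norm_nonneg _) fun k _ => ?_
          refine (norm_add_le _ _).trans ?_
          simp only [norm_one, norm_mul, Complex.norm_I, mul_one, Complex.norm_real,
            Real.norm_eq_abs]
          have := hK (S^[k] x)
          gcongr
      _ = _ := by simp
  have hi0 : ∀ n : ℕ, Integrable (fun x => ∏ k ∈ Finset.range n,
      (1 + ((τ * m (S^[k] x) : ℝ) : ℂ) * Complex.I)) ν := fun n => by
    obtain ⟨C, hC⟩ := hb n
    exact Integrable.of_bound (hmeas n).aestronglyMeasurable C (ae_of_all _ hC)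
  have hmz : ∀ F : X → ℂ, Measurable F → (∃ C, ∀ x, ‖F x‖ ≤ C) →
      ∫ x, (m x : ℂ) * F (S x) ∂ν = 0 := by
    rintro F hF ⟨C, hC⟩
    have hmi : Integrable (fun x => (m x : ℂ) * F (S x)) ν := by
      refine Integrable.of_bound (Measurable.aestronglyMeasurable (by fun_prop)) (K * C)
        (ae_of_all _ fun x => ?_)
      rw [norm_mul, Complex.norm_real, Real.norm_eq_abs]
      exact mul_le_mul (hK x) (hC _) (norm_nonneg _) ((abs_nonneg _).trans (hK x))
    have h1 := hmart (fun x => (F x).re) (by fun_prop)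
      ⟨C, fun x => (Complex.abs_re_le_norm _).trans (hC x)⟩
    have h2 := hmart (fun x => (F x).im) (by fun_prop)
      ⟨C, fun x => (Complex.abs_im_le_norm _).trans (hC x)⟩
    have e1 := integral_re hmi
    have e2 := integral_im hmi
    simp only [RCLike.re_to_complex, RCLike.im_to_complex, Complex.re_ofReal_mul,
      Complex.im_ofReal_mul] at e1 e2
    rw [h1] at e1
    rw [h2] at e2
    exact Complex.ext e1.symm e2.symm
  induction n with
  | zero => simp
  | succ n ih =>
    have e : ∀ x, ∏ k ∈ Finset.range (n + 1), (1 + ((τ * m (S^[k] x) : ℝ) : ℂ) * Complex.I)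
        = (fun y => ∏ k ∈ Finset.range n, (1 + ((τ * m (S^[k] y) : ℝ) : ℂ) * Complex.I)) (S x)
          + (τ * Complex.I) * ((m x : ℂ) * (fun y => ∏ k ∈ Finset.range n,
            (1 + ((τ * m (S^[k] y) : ℝ) : ℂ) * Complex.I)) (S x)) := by
      intro x
      rw [Finset.prod_range_succ']
      simp only [Function.iterate_succ_apply, Function.iterate_zero_apply]
      push_cast
      ring
    simp only [e]
    obtain ⟨C, hC⟩ := hb n
    rw [integral_add, integral_const_mul, hmz _ (hmeas n) (hb n),
      integral_comp_of_measurePreserving hS (hmeas n).aestronglyMeasurable, ih]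
    · simp
    · exact hS.integrable_comp_of_integrable (hi0 n)
    · refine Integrable.const_mul ?_ _
      refine Integrable.of_bound (Measurable.aestronglyMeasurable ?_) (K * C)
        (ae_of_all _ fun x => ?_)
      · have := (hmeas n).comp hSm
        simp only [Function.comp_def] at this
        fun_prop
      rw [norm_mul, Complex.norm_real, Real.norm_eq_abs]
      exact mul_le_mul (hK x) (hC _) (norm_nonneg _) ((abs_nonneg _).trans (hK x))

/-- Central limit theorem for bounded stationary ergodic reverse martingale differences. -/
theorem tendsto_integral_cexp_of_bounded_martingale (hS : Ergodic S ν) {m : X → ℝ}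
    (hm : Measurable m) {K : ℝ} (hK : ∀ x, |m x| ≤ K)
    (hmart : ∀ k : X → ℝ, Measurable k → (∃ C, ∀ x, |k x| ≤ C) → ∫ x, m x * k (S x) ∂ν = 0)
    (t : ℝ) :
    Tendsto (fun n : ℕ => ∫ x, Complex.exp ((t * (birkhoffSum S m n x / √n) : ℝ) * Complex.I) ∂ν)
      atTop (𝓝 (Complex.exp ((-((∫ x, m x ^ 2 ∂ν) * t ^ 2 / 2) : ℝ) : ℂ))) := by
  set σ := ∫ x, m x ^ 2 ∂ν with hσ
  have hSm := hS.measurable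
  have hσ0 : 0 ≤ σ := integral_nonneg fun x => sq_nonneg _
  obtain ⟨x0⟩ : Nonempty X := nonempty_of_isProbabilityMeasure ν
  have hK0 : 0 ≤ K := (abs_nonneg _).trans (hK x0)
  have hm2 : MemLp (fun x => m x ^ 2) 2 ν := by
    refine MemLp.of_bound (Measurable.aestronglyMeasurable (by fun_prop)) (K ^ 2)
      (ae_of_all _ fun x => ?_)
    rw [Real.norm_eq_abs, abs_pow]
    exact pow_le_pow_left₀ (abs_nonneg _) (hK x) 2
  have herg := tendsto_integral_abs_birkhoffAverage hS hm2
  set ε : ℕ → ℝ := fun n => (|t| * K) ^ 3 / √n with hε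
  have hsq : Tendsto (fun n : ℕ => √(n : ℝ)) atTop atTop :=
    Real.tendsto_sqrt_atTop.comp tendsto_natCast_atTop_atTop
  have hε0 : Tendsto ε atTop (𝓝 0) := hsq.const_div_atTop _
  have hτ0 : Tendsto (fun n : ℕ => |t| * K / √n) atTop (𝓝 0) := hsq.const_div_atTop _
  have hbound : Tendsto (fun n : ℕ => Real.exp ((|t| * K) ^ 2 / 2) * (Real.exp 1 *
      (t ^ 2 / 2 * (∫ x, |birkhoffSum S (fun x => m x ^ 2) n x / n - σ| ∂ν) + ε n)))
      atTop (𝓝 0) := by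
    have := ((herg.const_mul (t ^ 2 / 2)).add hε0).const_mul (Real.exp 1)
      |>.const_mul (Real.exp ((|t| * K) ^ 2 / 2))
    simpa using this
  rw [tendsto_iff_norm_sub_tendsto_zero]
  refine squeeze_zero' (Eventually.of_forall fun n => norm_nonneg _) ?_ hbound
  filter_upwards [eventually_gt_atTop 0, hε0.eventually_le_const zero_lt_one,
    hτ0.eventually_le_const (show (0 : ℝ) < 1 / 2 by norm_num)] with n hn hεn hτn
  have hn' : (0 : ℝ) < n := by exact_mod_cast hn
  have hsn : 0 < √(n : ℝ) := Real.sqrt_pos.2 hn'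
  have hsn2 : √(n : ℝ) ^ 2 = n := Real.sq_sqrt hn'.le
  set τ : ℝ := t / √n with hτ
  have hXb : ∀ x, |τ * m x| ≤ |t| * K / √n := by
    intro x
    rw [abs_mul, hτ, abs_div, abs_of_pos hsn, div_mul_eq_mul_div]
    have := hK x
    gcongr
  set T : X → ℂ := fun x => ∏ k ∈ Finset.range n,
    (1 + ((τ * m (S^[k] x) : ℝ) : ℂ) * Complex.I) with hT
  set A : X → ℂ := fun x => ∑ k ∈ Finset.range n, (expRemainder (τ * m (S^[k] x))
    - ((τ * m (S^[k] x) : ℝ) : ℂ) ^ 2 / 2) with hA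
  have hmk : ∀ k : ℕ, Measurable fun x => m (S^[k] x) := fun k => hm.comp (hSm.iterate k)
  have hTm : Measurable T := by
    refine Finset.measurable_fun_prod _ fun k _ => ?_
    have := hmk k
    fun_prop
  have hAm : Measurable A := by
    refine Finset.measurable_fun_sum _ fun k _ => ?_
    have := hmk k
    have h2 := measurable_expRemainder.comp (this.const_mul τ)
    simp only [Function.comp_def] at h2
    fun_prop
  have hexp : ∀ x, Complex.exp ((t * (birkhoffSum S m n x / √n) : ℝ) * Complex.I)
      = T x * Complex.exp (A x) := by
    intro x
    rw [hT, hA]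
    simp only
    rw [Complex.exp_sum, ← Finset.prod_mul_distrib]
    simp only [← cexp_mul_I_eq]
    rw [← Complex.exp_sum, ← Finset.sum_mul]
    congr 2
    rw [← Complex.ofReal_sum, ← Finset.mul_sum, hτ]
    simp only [birkhoffSum]
    congr 1
    ring
  have hTb : ∀ x, ‖T x‖ ≤ Real.exp ((|t| * K) ^ 2 / 2) := by
    intro x
    rw [hT]
    simp only
    rw [norm_prod]
    calc _ ≤ ∏ k ∈ Finset.range n, Real.exp ((|t| * K) ^ 2 / 2 / n) := by
          refine Finset.prod_le_prod (fun _ _ => norm_nonneg _) fun k _ => ?_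
          have h1 : ‖(1 + ((τ * m (S^[k] x) : ℝ) : ℂ) * Complex.I)‖
              = √(1 + (τ * m (S^[k] x)) ^ 2) := by
            rw [show (1 : ℂ) = ((1 : ℝ) : ℂ) by simp, Complex.norm_add_mul_I]
            simp
          rw [h1]
          have h2 : (τ * m (S^[k] x)) ^ 2 ≤ (|t| * K) ^ 2 / n := by
            have := pow_le_pow_left₀ (abs_nonneg _) (hXb (S^[k] x)) 2
            rwa [sq_abs, div_pow, hsn2] at this
          rw [show (|t| * K) ^ 2 / 2 / n = ((|t| * K) ^ 2 / n) / 2 by ring, Real.exp_half]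
          refine Real.sqrt_le_sqrt ?_
          have := Real.add_one_le_exp ((|t| * K) ^ 2 / (n : ℝ))
          linarith
      _ = _ := by
          rw [← Real.exp_sum, Finset.sum_const, Finset.card_range, nsmul_eq_mul]
          congr 1
          field_simp
  have hrem : ∀ x, ‖∑ k ∈ Finset.range n, expRemainder (τ * m (S^[k] x))‖ ≤ ε n := by
    intro x
    refine (norm_sum_le _ _).trans ?_
    calc _ ≤ ∑ k ∈ Finset.range n, (|t| * K / √n) ^ 3 := by
          refine Finset.sum_le_sum fun k _ => ?_
          refine (norm_expRemainder_le ((hXb _).trans hτn)).trans ?_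
          exact pow_le_pow_left₀ (abs_nonneg _) (hXb _) 3
      _ = ε n := by
          simp only [Finset.sum_const, Finset.card_range, nsmul_eq_mul, hε, div_pow]
          rw [show √(n : ℝ) ^ 3 = n * √n by rw [pow_succ, hsn2]]
          field_simp
  have hAeq : ∀ x, A x = (∑ k ∈ Finset.range n, expRemainder (τ * m (S^[k] x)))
      - ((t ^ 2 / 2 * (birkhoffSum S (fun x => m x ^ 2) n x / n) : ℝ) : ℂ) := by
    intro x
    rw [hA]
    simp only
    rw [Finset.sum_sub_distrib]
    congr 1
    rw [← Finset.sum_div]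
    simp only [← Complex.ofReal_pow]
    rw [← Complex.ofReal_sum]
    simp only [mul_pow]
    rw [← Finset.mul_sum, hτ, div_pow, hsn2]
    simp only [birkhoffSum]
    push_cast
    ring
  have hAre : ∀ x, (A x).re ≤ 1 := by
    intro x
    rw [hAeq, Complex.sub_re, Complex.ofReal_re]
    have h1 := (Complex.re_le_norm _).trans (hrem x)
    have h2 : 0 ≤ birkhoffSum S (fun x => m x ^ 2) n x :=
      Finset.sum_nonneg fun k _ => sq_nonneg _
    have h3 : 0 ≤ t ^ 2 / 2 * (birkhoffSum S (fun x => m x ^ 2) n x / n) := by positivity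
    linarith
  set a : ℂ := ((-(σ * t ^ 2 / 2) : ℝ) : ℂ) with ha
  have hare : a.re ≤ 1 := by
    rw [ha, Complex.ofReal_re]
    have : 0 ≤ σ * t ^ 2 / 2 := by positivity
    linarith
  have hAa : ∀ x, ‖A x - a‖ ≤
      t ^ 2 / 2 * |birkhoffSum S (fun x => m x ^ 2) n x / n - σ| + ε n := by
    intro x
    have : A x - a = (∑ k ∈ Finset.range n, expRemainder (τ * m (S^[k] x)))
      - ((t ^ 2 / 2 * (birkhoffSum S (fun x => m x ^ 2) n x / n - σ) : ℝ) : ℂ) := by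
      rw [hAeq, ha]
      push_cast
      ring
    rw [this]
    refine (norm_sub_le _ _).trans ?_
    rw [Complex.norm_real, Real.norm_eq_abs, abs_mul, abs_of_nonneg (by positivity : 0 ≤ t ^ 2 / 2)]
    linarith [hrem x]
  have hTi : Integrable T ν := Integrable.of_bound hTm.aestronglyMeasurable _ (ae_of_all _ hTb)
  have hTE : Integrable (fun x => T x * Complex.exp (A x)) ν := by
    refine Integrable.of_bound (Measurable.aestronglyMeasurable (by fun_prop))
      (Real.exp ((|t| * K) ^ 2 / 2) * Real.exp 1) (ae_of_all _ fun x => ?_)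
    rw [norm_mul, Complex.norm_exp]
    exact mul_le_mul (hTb x) (Real.exp_le_exp.2 (hAre x)) (Real.exp_pos _).le (Real.exp_pos _).le
  have hdiff : (∫ x, Complex.exp ((t * (birkhoffSum S m n x / √n) : ℝ) * Complex.I) ∂ν)
      - Complex.exp a = ∫ x, T x * (Complex.exp (A x) - Complex.exp a) ∂ν := by
    simp only [hexp, mul_sub]
    rw [integral_sub hTE (hTi.mul_const _), integral_mul_const,
      integral_prod_one_add_mul_I hS.toMeasurePreserving hm hK hmart τ n, one_mul]
  rw [hdiff]
  have hgi : Integrable (fun x => |birkhoffSum S (fun x => m x ^ 2) n x / n - σ|) ν := by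
    have h1 : MemLp (fun x => birkhoffSum S (fun x => m x ^ 2) n x) 2 ν :=
      memLp_finsetSum _ fun k _ => hm2.comp_measurePreserving (hS.toMeasurePreserving.iterate k)
    refine Integrable.abs ?_
    exact ((h1.integrable (by norm_num)).div_const _).sub (integrable_const _)
  calc _ ≤ ∫ x, Real.exp ((|t| * K) ^ 2 / 2) * (Real.exp 1 *
      (t ^ 2 / 2 * |birkhoffSum S (fun x => m x ^ 2) n x / n - σ| + ε n)) ∂ν := by
        refine norm_integral_le_of_norm_le ?_ (ae_of_all _ fun x => ?_)
        · exact (((hgi.const_mul _).add (integrable_const _)).const_mul _).const_mul _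
        rw [norm_mul]
        refine mul_le_mul (hTb x) ?_ (norm_nonneg _) (Real.exp_pos _).le
        refine (norm_cexp_sub_cexp_le (hAre x) hare).trans ?_
        exact mul_le_mul_of_nonneg_left (hAa x) (Real.exp_pos _).le
    _ = _ := by
        rw [integral_const_mul, integral_const_mul, integral_add (hgi.const_mul _)
          (integrable_const _), integral_const_mul]
        simp

end BoundedMartingale

section MartingaleApproximation

variable {X : Type*} [MeasurableSpace X] {ν : Measure X} [IsProbabilityMeasure ν] {S : X → X}

/-- A reverse martingale difference: `m` is orthogonal to all bounded functions of `S`. -/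
def IsReverseMartingaleDiff (ν : Measure X) (S : X → X) (m : X → ℝ) : Prop :=
  ∀ k : X → ℝ, Measurable k → (∃ C, ∀ x, |k x| ≤ C) → ∫ x, m x * k (S x) ∂ν = 0

theorem measurable_birkhoffSum {S : X → X} (hS : Measurable S) {m : X → ℝ} (hm : Measurable m)
    (n : ℕ) : Measurable (birkhoffSum S m n) := by
  unfold birkhoffSum
  exact Finset.measurable_fun_sum _ fun k _ => hm.comp (hS.iterate k)

omit [MeasurableSpace X] in
theorem abs_birkhoffSum_le {S : X → X} {m : X → ℝ} {K : ℝ} (hK : ∀ x, |m x| ≤ K) (n : ℕ) (x : X) :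
    |birkhoffSum S m n x| ≤ n * K := by
  unfold birkhoffSum
  refine (Finset.abs_sum_le_sum_abs _ _).trans ((Finset.sum_le_sum fun k _ => hK _).trans ?_)
  simp

theorem integrable_of_abs_le {f : X → ℝ} (hf : Measurable f) {C : ℝ} (hC : ∀ x, |f x| ≤ C) :
    Integrable f ν :=
  Integrable.of_bound hf.aestronglyMeasurable C (ae_of_all _ hC)

/-- Orthogonality of the increments of a stationary martingale. -/
theorem integral_birkhoffSum_sq (hS : MeasurePreserving S ν ν) {m : X → ℝ} (hm : Measurable m)
    {K : ℝ} (hK : ∀ x, |m x| ≤ K) (hmart : IsReverseMartingaleDiff ν S m) (n : ℕ) :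
    ∫ x, birkhoffSum S m n x ^ 2 ∂ν = n * ∫ x, m x ^ 2 ∂ν := by
  induction n with
  | zero => simp
  | succ n ih =>
    have hbm := measurable_birkhoffSum hS.measurable hm n
    have hbb := abs_birkhoffSum_le (S := S) hK n
    have hsq : ∀ (g : X → ℝ) (C : ℝ), Measurable g → (∀ x, |g x| ≤ C) →
        Integrable (fun x => g x ^ 2) ν := fun g C hg hC => by
      refine integrable_of_abs_le (hg.pow_const 2) (C := C ^ 2) fun x => ?_
      rw [abs_pow]
      exact pow_le_pow_left₀ (abs_nonneg _) (hC x) 2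
    have e : ∀ x, birkhoffSum S m (n + 1) x ^ 2 = m x ^ 2 + 2 * (m x * birkhoffSum S m n (S x))
        + birkhoffSum S m n (S x) ^ 2 := by
      intro x
      rw [birkhoffSum_succ']
      ring
    simp only [e]
    have i1 := hsq m K hm hK
    have i3 : Integrable (fun x => birkhoffSum S m n (S x) ^ 2) ν :=
      hsq (fun x => birkhoffSum S m n (S x)) _ (hbm.comp hS.measurable) fun x => hbb (S x)
    have i2 : Integrable (fun x => 2 * (m x * birkhoffSum S m n (S x))) ν := by
      refine Integrable.const_mul ?_ _
      refine integrable_of_abs_le (hm.mul (hbm.comp hS.measurable)) (C := K * (n * K)) fun x => ?_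
      rw [abs_mul]
      exact mul_le_mul (hK x) (hbb _) (abs_nonneg _) ((abs_nonneg _).trans (hK x))
    rw [integral_add (by exact i1.add i2) i3, integral_add i1 i2, integral_const_mul,
      hmart _ hbm ⟨_, hbb⟩, integral_comp_of_measurePreserving hS
        (g := fun x => birkhoffSum S m n x ^ 2) (hbm.pow_const 2).aestronglyMeasurable, ih]
    push_cast
    ring

theorem norm_cexp_mul_I_sub_le (a b : ℝ) :
    ‖Complex.exp (a * Complex.I) - Complex.exp (b * Complex.I)‖ ≤ |a - b| := by
  have := norm_cexp_sub_cexp_le (a := a * Complex.I) (b := b * Complex.I) (c := 0)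
    (by simp) (by simp)
  rwa [← sub_mul, ← Complex.ofReal_sub, norm_mul, Complex.norm_real, Complex.norm_I, mul_one,
    Real.exp_zero, one_mul, Real.norm_eq_abs] at this

theorem norm_integral_cexp_sub_le {F G : X → ℝ} (hF : Measurable F) (hG : Measurable G)
    {e δ : ℝ} (hδ : 0 < δ) (he : 0 ≤ e)
    (h : ∫⁻ x, ENNReal.ofReal ((F x - G x) ^ 2) ∂ν ≤ ENNReal.ofReal e) (t : ℝ) :
    ‖(∫ x, Complex.exp ((t * F x : ℝ) * Complex.I) ∂ν)
      - ∫ x, Complex.exp ((t * G x : ℝ) * Complex.I) ∂ν‖ ≤ |t| * ((e / δ + δ) / 2) := by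
  have hi : ∀ H : X → ℝ, Measurable H →
      Integrable (fun x => Complex.exp ((t * H x : ℝ) * Complex.I)) ν := fun H hH =>
    Integrable.of_bound (Measurable.aestronglyMeasurable (by fun_prop)) 1
      (ae_of_all _ fun x => by rw [Complex.norm_exp_ofReal_mul_I])
  have hm2 : Measurable fun x => (F x - G x) ^ 2 := by fun_prop
  have hsq : Integrable (fun x => (F x - G x) ^ 2) ν :=
    ⟨hm2.aestronglyMeasurable, by
      rw [hasFiniteIntegral_iff_ofReal (ae_of_all _ fun x => sq_nonneg _)]
      exact h.trans_lt ENNReal.ofReal_lt_top⟩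
  have hsq' : ∫ x, (F x - G x) ^ 2 ∂ν ≤ e := by
    rw [integral_eq_lintegral_of_nonneg_ae (ae_of_all _ fun x => sq_nonneg _)
      hm2.aestronglyMeasurable]
    exact ENNReal.toReal_le_of_le_ofReal he h
  rw [← integral_sub (hi F hF) (hi G hG)]
  calc _ ≤ ∫ x, |t| * (((F x - G x) ^ 2 / δ + δ) / 2) ∂ν := by
        refine norm_integral_le_of_norm_le ?_ (ae_of_all _ fun x => ?_)
        · exact (((hsq.div_const _).add (integrable_const _)).div_const _).const_mul _
        refine (norm_cexp_mul_I_sub_le _ _).trans ?_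
        rw [← mul_sub, abs_mul]
        refine mul_le_mul_of_nonneg_left ?_ (abs_nonneg _)
        have h1 : (F x - G x) ^ 2 / δ * δ = |F x - G x| ^ 2 := by
          rw [sq_abs]; field_simp
        have h2 : 0 ≤ (F x - G x) ^ 2 / δ := by positivity
        nlinarith [sq_nonneg ((F x - G x) ^ 2 / δ - δ), abs_nonneg (F x - G x)]
    _ = |t| * (((∫ x, (F x - G x) ^ 2 ∂ν) / δ + δ) / 2) := by
        rw [integral_const_mul, integral_div, integral_add (hsq.div_const _) (integrable_const _),
          integral_div]
        simp
    _ ≤ _ := by gcongr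

theorem tendsto_integral_cexp_coboundary (hS : MeasurePreserving S ν ν) {g f u : X → ℝ}
    (hg : Measurable g) (hf : Measurable f)
    (hu : Measurable u) (hfg : ∀ x, f x = g x + (u (S x) - u x)) (t : ℝ) :
    Tendsto (fun n : ℕ => (∫ x, Complex.exp ((t * (birkhoffSum S f n x / √n) : ℝ) * Complex.I) ∂ν)
      - ∫ x, Complex.exp ((t * (birkhoffSum S g n x / √n) : ℝ) * Complex.I) ∂ν) atTop (𝓝 0) := by
  have hSm := hS.measurable
  have hi : ∀ H : X → ℝ, Measurable H →
      Integrable (fun x => Complex.exp ((H x : ℝ) * Complex.I)) ν := fun H hH =>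
    Integrable.of_bound (Measurable.aestronglyMeasurable (by fun_prop)) 1
      (ae_of_all _ fun x => by rw [Complex.norm_exp_ofReal_mul_I])
  have hcob : ∀ (n : ℕ) x, birkhoffSum S f n x = birkhoffSum S g n x + (u (S^[n] x) - u x) := by
    intro n x
    induction n with
    | zero => simp
    | succ n ih =>
      rw [birkhoffSum_succ, birkhoffSum_succ, ih, hfg, Function.iterate_succ_apply']
      ring
  have hlim : Tendsto (fun n : ℕ => ∫ x, ‖Complex.exp ((t * (u x / √n) : ℝ) * Complex.I) - 1‖ ∂ν)
      atTop (𝓝 (∫ _, (0 : ℝ) ∂ν)) := by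
    refine tendsto_integral_of_dominated_convergence (fun _ => 2)
      (fun n => Measurable.aestronglyMeasurable (by fun_prop)) (integrable_const _)
      (fun n => ae_of_all _ fun x => ?_) (ae_of_all _ fun x => ?_)
    · rw [norm_norm]
      refine (norm_sub_le _ _).trans ?_
      rw [Complex.norm_exp_ofReal_mul_I]
      norm_num
    · have h1 : Tendsto (fun n : ℕ => t * (u x / √(n : ℝ))) atTop (𝓝 (t * 0)) :=
        ((Real.tendsto_sqrt_atTop.comp tendsto_natCast_atTop_atTop).const_div_atTop _).const_mul _
      have h2 : Continuous fun y : ℝ => ‖Complex.exp ((y : ℝ) * Complex.I) - 1‖ := by fun_prop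
      have := (h2.tendsto _).comp h1
      simpa [Function.comp_def] using this
  rw [integral_zero] at hlim
  refine squeeze_zero_norm (a := fun n : ℕ =>
    (∫ x, ‖Complex.exp ((t * (u x / √n) : ℝ) * Complex.I) - 1‖ ∂ν) +
    ∫ x, ‖Complex.exp ((t * (u x / √n) : ℝ) * Complex.I) - 1‖ ∂ν) (fun n => ?_)
    (by simpa using hlim.add hlim)
  have hbf := measurable_birkhoffSum hSm hf n
  have hbg := measurable_birkhoffSum hSm hg n
  have hun : Integrable (fun x => ‖Complex.exp ((t * (u x / √n) : ℝ) * Complex.I) - 1‖) ν :=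
    ((hi _ (by fun_prop)).sub (integrable_const _)).norm
  have hpres := hS.iterate n
  rw [← integral_sub (hi _ (by fun_prop)) (hi _ (by fun_prop))]
  have e1 := integral_comp_of_measurePreserving hpres
    (g := fun x => ‖Complex.exp ((t * (u x / √n) : ℝ) * Complex.I) - 1‖)
    (Measurable.aestronglyMeasurable (by fun_prop))
  have hun' := hpres.integrable_comp_of_integrable hun
  nth_rewrite 1 [← e1]
  rw [← integral_add (by exact hun') hun]
  refine norm_integral_le_of_norm_le (hun'.add hun) (ae_of_all _ fun x => ?_)
  set a : ℂ := ((t * (birkhoffSum S g n x / √n) : ℝ) : ℂ) * Complex.I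
  set b : ℂ := ((t * (u (S^[n] x) / √n) : ℝ) : ℂ) * Complex.I with hb
  set c : ℂ := ((t * (u x / √n) : ℝ) : ℂ) * Complex.I with hc
  have e2 : (((t * (birkhoffSum S f n x / √n) : ℝ) : ℂ) * Complex.I) = a + (b - c) := by
    rw [hcob]; simp only [a, b, c]; push_cast; ring
  rw [e2, Complex.exp_add, Complex.exp_sub]
  have nc : ‖Complex.exp c‖ = 1 := by rw [hc, Complex.norm_exp_ofReal_mul_I]
  have nc0 : Complex.exp c ≠ 0 := Complex.exp_ne_zero _
  have na : ‖Complex.exp a‖ = 1 := by rw [Complex.norm_exp_ofReal_mul_I]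
  rw [show Complex.exp a * (Complex.exp b / Complex.exp c) - Complex.exp a
    = Complex.exp a * (((Complex.exp b - 1) - (Complex.exp c - 1)) / Complex.exp c) by
      field_simp; ring, norm_mul, norm_div, nc, na, one_mul, div_one]
  exact norm_sub_le _ _

omit [IsProbabilityMeasure ν] in
theorem exists_tendsto_integral_sq {m : ℕ → X → ℝ} (hm : ∀ j, MemLp (m j) 2 ν) {ε : ℕ → ℝ}
    (hε : Tendsto ε atTop (𝓝 0))
    (hc : ∀ k j, k ≤ j → ∫ x, (m j x - m k x) ^ 2 ∂ν ≤ ε k) :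
    ∃ s : ℝ, Tendsto (fun k => ∫ x, m k x ^ 2 ∂ν) atTop (𝓝 s) := by
  have hn : ∀ F : X → ℝ, ∀ hF : MemLp F 2 ν, ‖hF.toLp F‖ ^ 2 = ∫ x, F x ^ 2 ∂ν := by
    intro F hF
    rw [← real_inner_self_eq_norm_sq, L2.inner_def]
    refine integral_congr_ae ?_
    filter_upwards [hF.coeFn_toLp] with x hx
    rw [hx]
    simp [sq]
  have hC : CauchySeq fun k => (hm k).toLp (m k) := by
    rw [Metric.cauchySeq_iff']
    intro e he
    obtain ⟨N, hN⟩ := (hε.eventually_lt_const (show 0 < e ^ 2 by positivity)).exists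
    refine ⟨N, fun n hnN => ?_⟩
    rw [dist_eq_norm, ← MemLp.toLp_sub]
    refine lt_of_pow_lt_pow_left₀ 2 he.le ?_
    rw [hn]
    exact (hc N n hnN).trans_lt hN
  obtain ⟨F, hF⟩ := cauchySeq_tendsto_of_complete hC
  refine ⟨‖F‖ ^ 2, ?_⟩
  simp only [← fun k => hn (m k) (hm k)]
  exact (hF.norm).pow 2

/-- Martingale approximation implies the central limit theorem. -/
theorem clt_of_martingale_approximation (hS : Ergodic S ν) {f g u : X → ℝ} {m : ℕ → X → ℝ}
    (hf : Measurable f) (hg : Measurable g) (hu : Measurable u)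
    (hfg : ∀ x, f x = g x + (u (S x) - u x))
    (hm : ∀ j, Measurable (m j)) (hb : ∀ j, ∃ K, ∀ x, |m j x| ≤ K)
    (hmart : ∀ j, IsReverseMartingaleDiff ν S (m j))
    {ε : ℕ → ℝ} (hε : Tendsto ε atTop (𝓝 0))
    (hc : ∀ k j, k ≤ j → ∫ x, (m j x - m k x) ^ 2 ∂ν ≤ ε k)
    (hlim : ∀ x, Tendsto (fun j => m j x) atTop (𝓝 (g x))) :
    ∃ σ2 : NNReal, ∀ φ : BoundedContinuousFunction ℝ ℝ,
      Tendsto (fun n : ℕ => ∫ x, φ (birkhoffSum S f n x / √n) ∂ν) atTop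
        (𝓝 (∫ x, φ x ∂(ProbabilityTheory.gaussianReal 0 σ2))) := by
  have hSm := hS.measurable
  have hL2 : ∀ j, MemLp (m j) 2 ν := fun j => by
    obtain ⟨K, hK⟩ := hb j
    exact MemLp.of_bound (hm j).aestronglyMeasurable K (ae_of_all _ hK)
  have hε0 : ∀ k, 0 ≤ ε k := fun k => by simpa using hc k k le_rfl
  obtain ⟨s, hs⟩ := exists_tendsto_integral_sq hL2 hε hc
  have hs0 : 0 ≤ s := ge_of_tendsto' hs fun k => integral_nonneg fun x => sq_nonneg _
  have hgood : ∀ (n k : ℕ), 0 < n → ∫⁻ x, ENNReal.ofReal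
      ((birkhoffSum S g n x / √n - birkhoffSum S (m k) n x / √n) ^ 2) ∂ν
        ≤ ENNReal.ofReal (ε k) := by
    intro n k hn
    have hn' : (0 : ℝ) < n := by exact_mod_cast hn
    have hpt : ∀ x, Tendsto (fun j => ENNReal.ofReal
        ((birkhoffSum S (m j) n x / √n - birkhoffSum S (m k) n x / √n) ^ 2)) atTop
        (𝓝 (ENNReal.ofReal
        ((birkhoffSum S g n x / √n - birkhoffSum S (m k) n x / √n) ^ 2))) := by
      intro x
      refine ENNReal.tendsto_ofReal ?_
      refine Tendsto.pow (Tendsto.sub_const (Tendsto.div_const ?_ _) _) 2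
      exact tendsto_finsetSum _ fun i _ => hlim _
    calc _ = ∫⁻ x, liminf (fun j => ENNReal.ofReal
          ((birkhoffSum S (m j) n x / √n - birkhoffSum S (m k) n x / √n) ^ 2)) atTop ∂ν := by
          refine lintegral_congr fun x => ?_
          rw [(hpt x).liminf_eq]
      _ ≤ liminf (fun j => ∫⁻ x, ENNReal.ofReal
          ((birkhoffSum S (m j) n x / √n - birkhoffSum S (m k) n x / √n) ^ 2) ∂ν) atTop := by
          refine lintegral_liminf_le fun j => ?_
          have := measurable_birkhoffSum hSm (hm j) n
          have := measurable_birkhoffSum hSm (hm k) n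
          fun_prop
      _ ≤ _ := by
          refine liminf_le_of_frequently_le' (Eventually.frequently ?_)
          filter_upwards [eventually_ge_atTop k] with j hj
          obtain ⟨K1, hK1⟩ := hb j
          obtain ⟨K2, hK2⟩ := hb k
          have hDb : ∀ x, |m j x - m k x| ≤ K1 + K2 := fun x =>
            (abs_sub _ _).trans (add_le_add (hK1 x) (hK2 x))
          have hDm : Measurable fun x => m j x - m k x := (hm j).sub (hm k)
          have hD : IsReverseMartingaleDiff ν S fun x => m j x - m k x := by
            rintro q hq ⟨C, hC⟩
            have hi : ∀ i, Integrable (fun x => m i x * q (S x)) ν := fun i => by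
              obtain ⟨K, hK⟩ := hb i
              refine integrable_of_abs_le ((hm i).mul (hq.comp hSm)) (C := K * C) fun x => ?_
              rw [abs_mul]
              exact mul_le_mul (hK x) (hC _) (abs_nonneg _) ((abs_nonneg _).trans (hK x))
            simp only [sub_mul]
            rw [integral_sub (hi j) (hi k), hmart j q hq ⟨C, hC⟩, hmart k q hq ⟨C, hC⟩, sub_zero]
          have h1 := integral_birkhoffSum_sq hS.toMeasurePreserving hDm hDb hD n
          have e : ∀ x, (birkhoffSum S (m j) n x / √n - birkhoffSum S (m k) n x / √n) ^ 2
              = birkhoffSum S (fun x => m j x - m k x) n x ^ 2 / n := by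
            intro x
            rw [← sub_div, div_pow, Real.sq_sqrt hn'.le]
            simp [birkhoffSum, Finset.sum_sub_distrib]
          simp only [e]
          have hbm := measurable_birkhoffSum hSm hDm n
          have hbb := abs_birkhoffSum_le (S := S) hDb n
          have hi0 : Integrable (fun x => birkhoffSum S (fun x => m j x - m k x) n x ^ 2 / n) ν := by
            refine Integrable.div_const (integrable_of_abs_le (hbm.pow_const 2)
              (C := (n * (K1 + K2)) ^ 2) fun x => ?_) _
            rw [abs_pow]
            exact pow_le_pow_left₀ (abs_nonneg _) (hbb x) 2
          rw [← ofReal_integral_eq_lintegral_ofReal hi0 (ae_of_all _ fun x => by positivity),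
            integral_div, h1, mul_div_cancel_left₀ _ hn'.ne']
          exact ENNReal.ofReal_le_ofReal (hc k j hj)
  have hchar : ∀ t : ℝ, Tendsto (fun n : ℕ =>
      ∫ x, Complex.exp ((t * (birkhoffSum S f n x / √n) : ℝ) * Complex.I) ∂ν) atTop
      (𝓝 (Complex.exp ((-(s * t ^ 2 / 2) : ℝ) : ℂ))) := by
    intro t
    have h1 := tendsto_integral_cexp_coboundary hS.toMeasurePreserving hg hf hu hfg t
    suffices h2 : Tendsto (fun n : ℕ =>
        ∫ x, Complex.exp ((t * (birkhoffSum S g n x / √n) : ℝ) * Complex.I) ∂ν) atTop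
        (𝓝 (Complex.exp ((-(s * t ^ 2 / 2) : ℝ) : ℂ))) by
      simpa using h1.add h2
    rw [Metric.tendsto_atTop']
    intro η hη
    have hsK : Tendsto (fun k => Complex.exp ((-((∫ x, m k x ^ 2 ∂ν) * t ^ 2 / 2) : ℝ) : ℂ)) atTop
        (𝓝 (Complex.exp ((-(s * t ^ 2 / 2) : ℝ) : ℂ))) := by
      have hcont : Continuous fun y : ℝ => Complex.exp ((-(y * t ^ 2 / 2) : ℝ) : ℂ) := by fun_prop
      exact (hcont.tendsto s).comp hs
    set δ : ℝ := η / 3 / (|t| + 1) with hδ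
    have hδ0 : 0 < δ := by positivity
    obtain ⟨k, hk1, hk2⟩ := ((hε.eventually_le_const (show 0 < δ ^ 2 by positivity)).and
      (Metric.tendsto_nhds.1 hsK (η / 3) (by positivity))).exists
    obtain ⟨K, hK⟩ := hb k
    have h3 := tendsto_integral_cexp_of_bounded_martingale hS (hm k) hK (hmart k) t
    obtain ⟨N, hN⟩ := Metric.tendsto_atTop'.1 h3 (η / 3) (by positivity)
    refine ⟨N, fun n hn => ?_⟩
    have h4 := norm_integral_cexp_sub_le (ν := ν)
      (F := fun x => birkhoffSum S g n x / √n) (G := fun x => birkhoffSum S (m k) n x / √n)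
      ((measurable_birkhoffSum hSm hg n).div_const _)
      ((measurable_birkhoffSum hSm (hm k) n).div_const _) hδ0 (hε0 k)
      (hgood n k (Nat.zero_lt_of_lt hn)) t
    have h5 : |t| * ((ε k / δ + δ) / 2) ≤ η / 3 := by
      have : ε k / δ ≤ δ := by rw [div_le_iff₀ hδ0]; nlinarith
      calc |t| * ((ε k / δ + δ) / 2) ≤ (|t| + 1) * δ := by
            have h0 : 0 ≤ ε k / δ := div_nonneg (hε0 k) hδ0.le
            exact mul_le_mul (by linarith) (by linarith) (by linarith) (by positivity)
        _ = η / 3 := by rw [hδ]; field_simp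
    have h6 := hN n hn
    rw [← dist_eq_norm] at h4
    calc _ ≤ _ := dist_triangle4 _ _ _ _
      _ < η / 3 + η / 3 + η / 3 := add_lt_add (add_lt_add_of_le_of_lt (h4.trans h5) h6) hk2
      _ = η := by ring
  refine ⟨s.toNNReal, fun φ => ?_⟩
  have hmeas : ∀ n : ℕ, Measurable fun x => birkhoffSum S f n x / √n := fun n =>
    (measurable_birkhoffSum hSm hf n).div_const _
  set P : ℕ → ProbabilityMeasure ℝ := fun n => ⟨ν.map fun x => birkhoffSum S f n x / √n,
    Measure.isProbabilityMeasure_map (hmeas n).aemeasurable⟩ with hP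
  set Q : ProbabilityMeasure ℝ := ⟨ProbabilityTheory.gaussianReal 0 s.toNNReal, inferInstance⟩
  have hPQ : Tendsto P atTop (𝓝 Q) := by
    rw [ProbabilityMeasure.tendsto_iff_tendsto_charFun]
    intro t
    have e1 : charFun (Q : Measure ℝ) t = Complex.exp ((-(s * t ^ 2 / 2) : ℝ) : ℂ) := by
      change charFun (ProbabilityTheory.gaussianReal 0 s.toNNReal) t = _
      rw [ProbabilityTheory.charFun_gaussianReal]
      congr 1
      push_cast
      simp [hs0]
    rw [e1]
    refine (hchar t).congr fun n => ?_
    change _ = charFun (ν.map fun x => birkhoffSum S f n x / √n) t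
    rw [charFun_apply_real, integral_map (hmeas n).aemeasurable
      (Measurable.aestronglyMeasurable (by fun_prop))]
    refine integral_congr_ae (ae_of_all _ fun x => ?_)
    simp only
    push_cast
    rfl
  refine (ProbabilityMeasure.tendsto_iff_forall_integral_tendsto.1 hPQ φ).congr fun n => ?_
  change ∫ y, φ y ∂(ν.map fun x => birkhoffSum S f n x / √n) = _
  rw [integral_map (hmeas n).aemeasurable φ.continuous.measurable.aestronglyMeasurable]

end MartingaleApproximation

/-- A full family of inverse branches, onto `E`, of the restriction to `E` of a transformation `S`.
The weights `a i` are the Jacobians of the branches `θ i`. -/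
structure InverseBranches {X : Type*} [MeasurableSpace X] (lam : Measure X) (S : X → X)
    (E : Set X) where
  θ : Bool → X → X
  a : Bool → X → ℝ
  measurable_θ : ∀ i, Measurable (θ i)
  measurable_a : ∀ i, Measurable (a i)
  a_nonneg : ∀ i q, 0 ≤ a i q
  θ_mem : ∀ i q, θ i q ∈ E
  S_θ : ∀ i q, S (θ i q) = q
  restrict_eq : lam.restrict E =
    ∑ i, (lam.withDensity fun q => ENNReal.ofReal (a i q)).map (θ i)

namespace InverseBranches

variable {X : Type*} [MeasurableSpace X] {lam : Measure X} {S : X → X} {E : Set X}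
  (T : InverseBranches lam S E)

/-- The transfer operator of a family of inverse branches. -/
def op (g : X → ℝ) (q : X) : ℝ := ∑ i, T.a i q * g (T.θ i q)

theorem op_add (g k : X → ℝ) (q : X) : T.op (fun x => g x + k x) q = T.op g q + T.op k q := by
  simp only [op, ← Finset.sum_add_distrib, mul_add]

theorem op_sub (g k : X → ℝ) (q : X) : T.op (fun x => g x - k x) q = T.op g q - T.op k q := by
  simp only [op, ← Finset.sum_sub_distrib, mul_sub]

theorem op_const_mul (c : ℝ) (g : X → ℝ) (q : X) : T.op (fun x => c * g x) q = c * T.op g q := by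
  simp only [op, Finset.mul_sum]
  exact Finset.sum_congr rfl fun i _ => by ring

theorem op_mul_comp (g k : X → ℝ) (q : X) : T.op (fun x => g x * k (S x)) q = T.op g q * k q := by
  simp only [op, Finset.sum_mul, T.S_θ, mul_assoc]

theorem op_congr {g k : X → ℝ} (h : ∀ x ∈ E, g x = k x) : T.op g = T.op k := by
  funext q
  exact Finset.sum_congr rfl fun i _ => by rw [h _ (T.θ_mem i q)]

theorem op_mono {g k : X → ℝ} (h : ∀ x ∈ E, g x ≤ k x) (q : X) : T.op g q ≤ T.op k q :=
  Finset.sum_le_sum fun i _ => mul_le_mul_of_nonneg_left (h _ (T.θ_mem i q)) (T.a_nonneg i q)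

theorem op_nonneg {g : X → ℝ} (h : ∀ x ∈ E, 0 ≤ g x) (q : X) : 0 ≤ T.op g q :=
  Finset.sum_nonneg fun i _ => mul_nonneg (T.a_nonneg i q) (h _ (T.θ_mem i q))

theorem abs_op_le {g k : X → ℝ} (h : ∀ x ∈ E, |g x| ≤ k x) (q : X) : |T.op g q| ≤ T.op k q := by
  refine (Finset.abs_sum_le_sum_abs _ _).trans (Finset.sum_le_sum fun i _ => ?_)
  rw [abs_mul, abs_of_nonneg (T.a_nonneg i q)]
  exact mul_le_mul_of_nonneg_left (h _ (T.θ_mem i q)) (T.a_nonneg i q)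

theorem measurable_op {g : X → ℝ} (hg : Measurable g) : Measurable (T.op g) :=
  Finset.measurable_fun_sum _ fun i _ => (T.measurable_a i).mul (hg.comp (T.measurable_θ i))

theorem lintegral_op {g : X → ℝ} (hg : Measurable g) (h0 : ∀ x, 0 ≤ g x) :
    ∫⁻ q, ENNReal.ofReal (T.op g q) ∂lam = ∫⁻ q in E, ENNReal.ofReal (g q) ∂lam := by
  rw [T.restrict_eq, lintegral_finsetSum_measure]
  have hm := fun i => T.measurable_θ i
  have ha := fun i => T.measurable_a i
  have e : ∀ q, ENNReal.ofReal (T.op g q)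
      = ∑ i, ENNReal.ofReal (T.a i q) * ENNReal.ofReal (g (T.θ i q)) := by
    intro q
    rw [op, ENNReal.ofReal_sum_of_nonneg fun i _ => mul_nonneg (T.a_nonneg i q) (h0 _)]
    exact Finset.sum_congr rfl fun i _ => ENNReal.ofReal_mul (T.a_nonneg i q)
  simp only [e]
  rw [lintegral_finsetSum _ fun i _ => by
    have := hm i; have := ha i; fun_prop]
  refine Finset.sum_congr rfl fun i _ => ?_
  rw [lintegral_map (by fun_prop) (hm i), lintegral_withDensity_eq_lintegral_mul _
    (by have := ha i; fun_prop) (by have := hm i; fun_prop)]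
  rfl

theorem integrable_op {g : X → ℝ} (hg : Measurable g) (hi : IntegrableOn g E lam) :
    Integrable (T.op g) lam := by
  refine ⟨(T.measurable_op hg).aestronglyMeasurable, ?_⟩
  have h1 : ∫⁻ q, ENNReal.ofReal (T.op (fun x => |g x|) q) ∂lam < ⊤ := by
    rw [T.lintegral_op (by fun_prop) fun x => abs_nonneg _]
    have := hi.2
    rw [hasFiniteIntegral_iff_norm] at this
    exact this
  rw [hasFiniteIntegral_iff_norm]
  refine (lintegral_mono fun q => ?_).trans_lt h1
  exact ENNReal.ofReal_le_ofReal (T.abs_op_le (fun x _ => le_rfl) q)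

theorem integral_op {g : X → ℝ} (hg : Measurable g) (hi : IntegrableOn g E lam) :
    ∫ q, T.op g q ∂lam = ∫ q in E, g q ∂lam := by
  have key : ∀ k : X → ℝ, Measurable k → (∀ x, 0 ≤ k x) →
      ∫ q, T.op k q ∂lam = ∫ q in E, k q ∂lam := fun k hk h0 => by
    rw [integral_eq_lintegral_of_nonneg_ae (ae_of_all _ fun q => T.op_nonneg (fun x _ => h0 x) q)
      (T.measurable_op hk).aestronglyMeasurable, T.lintegral_op hk h0,
      integral_eq_lintegral_of_nonneg_ae (ae_of_all _ h0) hk.aestronglyMeasurable]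
  have hp : IntegrableOn (fun x => max (g x) 0) E lam := hi.pos_part
  have hn : IntegrableOn (fun x => max (-g x) 0) E lam := hi.neg_part
  have e : ∀ x, g x = max (g x) 0 - max (-g x) 0 := fun x => by
    rcases le_total 0 (g x) with h | h
    · rw [max_eq_left h, max_eq_right (by linarith)]; ring
    · rw [max_eq_right h, max_eq_left (by linarith)]; ring
  have e2 : ∀ q, T.op g q = T.op (fun x => max (g x) 0) q - T.op (fun x => max (-g x) 0) q := by
    intro q
    rw [← T.op_sub]
    exact congrFun (T.op_congr fun x _ => e x) q
  have e3 : ∫ q in E, g q ∂lam = ∫ q in E, (max (g q) 0 - max (-g q) 0) ∂lam :=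
    integral_congr_ae (ae_of_all _ e)
  rw [e3, integral_sub hp hn]
  simp only [e2]
  rw [integral_sub (T.integrable_op (by fun_prop) hp) (T.integrable_op (by fun_prop) hn),
    key _ (by fun_prop) fun x => le_max_right _ _, key _ (by fun_prop) fun x => le_max_right _ _]

theorem iterate_op_nonneg {g : X → ℝ} (h : ∀ x, 0 ≤ g x) (n : ℕ) (q : X) : 0 ≤ T.op^[n] g q := by
  induction n generalizing g with
  | zero => exact h q
  | succ n ih => exact ih fun x => T.op_nonneg (fun y _ => h y) x

theorem abs_iterate_op_le {g k : X → ℝ} (h : ∀ x, |g x| ≤ k x) (n : ℕ) (q : X) :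
    |T.op^[n] g q| ≤ T.op^[n] k q := by
  induction n generalizing g k with
  | zero => exact h q
  | succ n ih => exact ih fun x => T.abs_op_le (fun y _ => h y) x

theorem measurable_iterate_op {g : X → ℝ} (hg : Measurable g) (n : ℕ) :
    Measurable (T.op^[n] g) := by
  induction n generalizing g with
  | zero => exact hg
  | succ n ih => exact ih (T.measurable_op hg)

theorem iterate_op_add (g k : X → ℝ) (n : ℕ) (q : X) :
    T.op^[n] (fun x => g x + k x) q = T.op^[n] g q + T.op^[n] k q := by
  induction n generalizing g k with
  | zero => rfl
  | succ n ih =>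
    simp only [Function.iterate_succ_apply]
    rw [← ih, show T.op (fun x => g x + k x) = fun x => T.op g x + T.op k x from
      funext fun x => T.op_add g k x]

theorem iterate_op_const_mul (c : ℝ) (g : X → ℝ) (n : ℕ) (q : X) :
    T.op^[n] (fun x => c * g x) q = c * T.op^[n] g q := by
  induction n generalizing g with
  | zero => rfl
  | succ n ih =>
    simp only [Function.iterate_succ_apply]
    rw [← ih, show T.op (fun x => c * g x) = fun x => c * T.op g x from
      funext fun x => T.op_const_mul c g x]

theorem iterate_op_sub (g k : X → ℝ) (n : ℕ) (q : X) :
    T.op^[n] (fun x => g x - k x) q = T.op^[n] g q - T.op^[n] k q := by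
  have := T.iterate_op_add g (fun x => (-1) * k x) n q
  rw [T.iterate_op_const_mul] at this
  simp only [neg_mul, one_mul, ← sub_eq_add_neg] at this
  exact this

theorem iterate_op_mul_comp (g k : X → ℝ) (n : ℕ) (q : X) :
    T.op^[n] (fun x => g x * k (S^[n] x)) q = T.op^[n] g q * k q := by
  induction n generalizing g with
  | zero => rfl
  | succ n ih =>
    simp only [Function.iterate_succ_apply]
    rw [← ih, show (T.op fun x => g x * k (S^[n] (S x))) = fun x => T.op g x * k (S^[n] x) from
      funext fun x => T.op_mul_comp g (fun y => k (S^[n] y)) x]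

end InverseBranches

/-- A map `S` whose excursions outside `Δ` are governed by the inverse branches `A` and whose
inverse branches `B` onto `Δ` have constant weights and contract the distance `d`; `H` is the time
needed to hit `Δ`, and `c` controls the distortion along excursions. -/
structure FirstReturnSystem {X : Type*} [MeasurableSpace X] (lam : Measure X) (S : X → X)
    (Δ : Set X) where
  A : InverseBranches lam S Δᶜ
  B : InverseBranches lam S Δ
  H : X → ℕ
  d : X → X → ℝ
  c : X → X → ℝ
  M : X → ℝ
  d₀ : ℝ
  κ : ℝ
  D : ℝ
  measurable_S : Measurable S
  measurableSet_Δ : MeasurableSet Δ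
  measure_Δ_ne_zero : lam Δ ≠ 0
  measurable_H : Measurable H
  H_of_mem : ∀ q ∈ Δ, H q = 0
  H_of_notMem : ∀ q ∉ Δ, H q = H (S q) + 1
  lintegral_H_ne_top : ∫⁻ q, (H q : ENNReal) ∂lam ≠ ⊤
  d_nonneg : ∀ q q', 0 ≤ d q q'
  d_le : ∀ q q', d q q' ≤ d₀
  κ_nonneg : 0 ≤ κ
  κ_lt_one : κ < 1
  D_nonneg : 0 ≤ D
  d_A_le : ∀ i q q', d (A.θ i q) (A.θ i q') ≤ d q q'
  d_B_le : ∀ i q q', d (B.θ i q) (B.θ i q') ≤ κ * d q q'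
  one_le_c : ∀ q q', 1 ≤ c q q'
  c_A_le : ∀ i q q', A.a i q * c (A.θ i q) (A.θ i q') ≤ A.a i q' * c q q'
  c_B_le : ∀ i q q', c (B.θ i q) (B.θ i q') ≤ c q q'
  c_le_exp : ∀ q ∈ Δ, ∀ q' ∈ Δ, c q q' ≤ Real.exp (D * d q q')
  c_le_M : ∀ q, ∀ q' ∈ Δ, c q q' ≤ M q
  B_a_const : ∀ i q q', B.a i q = B.a i q'
  B_a_pos : ∀ i q, 0 < B.a i q

namespace FirstReturnSystem

variable {X : Type*} [MeasurableSpace X] {lam : Measure X} {S : X → X} {Δ : Set X}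
  (R : FirstReturnSystem lam S Δ)

/-- Nonnegative functions with controlled distortion. -/
def InE (K : ℝ) (g : X → ℝ) : Prop :=
  (∀ q, 0 ≤ g q) ∧ ∀ q q', g q ≤ Real.exp (K * R.d q q') * R.c q q' * g q'

theorem c_pos (q q' : X) : 0 < R.c q q' := zero_lt_one.trans_le (R.one_le_c q q')

variable {R}

theorem InE.A {K : ℝ} (hK : 0 ≤ K) {g : X → ℝ} (hg : R.InE K g) : R.InE K (R.A.op g) := by
  refine ⟨fun q => R.A.op_nonneg (fun x _ => hg.1 x) q, fun q q' => ?_⟩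
  rw [InverseBranches.op, InverseBranches.op, Finset.mul_sum]
  refine Finset.sum_le_sum fun i _ => ?_
  have h1 := hg.2 (R.A.θ i q) (R.A.θ i q')
  have h2 := R.A.a_nonneg i q
  have h3 := hg.1 (R.A.θ i q')
  have h5 := R.c_pos (R.A.θ i q) (R.A.θ i q')
  calc R.A.a i q * g (R.A.θ i q) ≤ R.A.a i q * (Real.exp (K * R.d (R.A.θ i q) (R.A.θ i q'))
        * R.c (R.A.θ i q) (R.A.θ i q') * g (R.A.θ i q')) := by gcongr
    _ = Real.exp (K * R.d (R.A.θ i q) (R.A.θ i q'))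
        * (R.A.a i q * R.c (R.A.θ i q) (R.A.θ i q')) * g (R.A.θ i q') := by ring
    _ ≤ Real.exp (K * R.d q q') * (R.A.a i q' * R.c q q') * g (R.A.θ i q') := by
        have h6 := R.d_A_le i q q'
        have h7 := R.c_A_le i q q'
        have h8 := mul_nonneg h2 h5.le
        gcongr
    _ = _ := by ring

theorem InE.B {K : ℝ} (hK : 0 ≤ K) {g : X → ℝ} (hg : R.InE K g) : R.InE K (R.B.op g) := by
  refine ⟨fun q => R.B.op_nonneg (fun x _ => hg.1 x) q, fun q q' => ?_⟩
  rw [InverseBranches.op, InverseBranches.op, Finset.mul_sum]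
  refine Finset.sum_le_sum fun i _ => ?_
  have h1 := hg.2 (R.B.θ i q) (R.B.θ i q')
  have h2 := R.B.a_nonneg i q
  have h3 := hg.1 (R.B.θ i q')
  have h4 := R.c_pos (R.B.θ i q) (R.B.θ i q')
  have h6 : R.d (R.B.θ i q) (R.B.θ i q') ≤ R.d q q' :=
    (R.d_B_le i q q').trans (mul_le_of_le_one_left (R.d_nonneg q q') R.κ_lt_one.le)
  have h7 := R.c_B_le i q q'
  calc R.B.a i q * g (R.B.θ i q) ≤ R.B.a i q * (Real.exp (K * R.d (R.B.θ i q) (R.B.θ i q'))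
        * R.c (R.B.θ i q) (R.B.θ i q') * g (R.B.θ i q')) := by gcongr
    _ ≤ R.B.a i q * (Real.exp (K * R.d q q') * R.c q q' * g (R.B.θ i q')) := by gcongr
    _ = _ := by rw [R.B_a_const i q q']; ring

theorem InE.iterate {K : ℝ} (hK : 0 ≤ K) {g : X → ℝ} (hg : R.InE K g) (n : ℕ) :
    R.InE K (R.A.op^[n] g) := by
  induction n generalizing g with
  | zero => exact hg
  | succ n ih => exact ih (hg.A hK)

theorem InE.add {K : ℝ} {g k : X → ℝ} (hg : R.InE K g) (hk : R.InE K k) :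
    R.InE K fun x => g x + k x := by
  refine ⟨fun q => add_nonneg (hg.1 q) (hk.1 q), fun q q' => ?_⟩
  rw [mul_add]
  exact add_le_add (hg.2 q q') (hk.2 q q')

theorem InE.tsum {K : ℝ} {g : ℕ → X → ℝ} (hg : ∀ n, R.InE K (g n))
    (hs : ∀ q, Summable fun n => g n q) : R.InE K fun q => ∑' n, g n q := by
  refine ⟨fun q => tsum_nonneg fun n => (hg n).1 q, fun q q' => ?_⟩
  rw [← tsum_mul_left]
  exact (hs q).tsum_le_tsum (fun n => (hg n).2 q q') ((hs q').mul_left _)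

theorem inE_one : R.InE 0 fun _ => 1 := by
  refine ⟨fun _ => zero_le_one, fun q q' => ?_⟩
  simpa using R.one_le_c q q'

variable (R)

theorem mem_Δ_iff (q : X) : q ∈ Δ ↔ R.H q = 0 :=
  ⟨R.H_of_mem q, fun h => by
    by_contra h'
    have := R.H_of_notMem q h'
    omega⟩

include R in
theorem measure_pos [IsFiniteMeasure lam] : 0 < lam.real Δ :=
  ENNReal.toReal_pos R.measure_Δ_ne_zero (measure_ne_top _ _)

theorem integrable_iterate {g : X → ℝ} (hg : Measurable g) (hi : Integrable g lam) (n : ℕ) :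
    Integrable (R.A.op^[n] g) lam := by
  induction n generalizing g with
  | zero => exact hi
  | succ n ih => exact ih (R.A.measurable_op hg) (R.A.integrable_op hg hi.integrableOn)

theorem setIntegral_op {g : X → ℝ} (hg : Measurable g) (hi : Integrable g lam) (s : Set ℕ) :
    ∫ q in R.H ⁻¹' s, R.A.op g q ∂lam = ∫ q in R.H ⁻¹' ((· + 1) '' s), g q ∂lam := by
  have hs : MeasurableSet (R.H ⁻¹' s) := R.measurable_H (MeasurableSet.of_discrete)
  have hs' : MeasurableSet (R.H ⁻¹' ((· + 1) '' s)) := R.measurable_H (MeasurableSet.of_discrete)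
  have hsS : MeasurableSet (S ⁻¹' (R.H ⁻¹' s)) := R.measurable_S hs
  have hset : Δᶜ ∩ S ⁻¹' (R.H ⁻¹' s) = R.H ⁻¹' ((· + 1) '' s) := by
    ext q
    simp only [mem_inter_iff, mem_compl_iff, mem_preimage, mem_image]
    constructor
    · rintro ⟨h1, h2⟩
      exact ⟨_, h2, (R.H_of_notMem q h1).symm⟩
    · rintro ⟨n, hn, h⟩
      have h1 : q ∉ Δ := fun h' => by have := R.H_of_mem q h'; omega
      have h2 := R.H_of_notMem q h1
      refine ⟨h1, ?_⟩
      rwa [show R.H (S q) = n by omega]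
  have e : ∀ q, (R.H ⁻¹' s).indicator (R.A.op g) q
      = R.A.op ((S ⁻¹' (R.H ⁻¹' s)).indicator g) q := by
    intro q
    have := R.A.op_mul_comp g ((R.H ⁻¹' s).indicator fun _ => 1) q
    have e1 : (fun x => g x * (R.H ⁻¹' s).indicator (fun _ => (1 : ℝ)) (S x))
        = (S ⁻¹' (R.H ⁻¹' s)).indicator g := by
      funext x
      by_cases hx : S x ∈ R.H ⁻¹' s <;> simp [indicator, hx]
    rw [e1] at this
    rw [this]
    by_cases hx : q ∈ R.H ⁻¹' s <;> simp [indicator, hx]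
  rw [← integral_indicator hs]
  simp only [e]
  rw [R.A.integral_op (hg.indicator hsS) (hi.indicator hsS).integrableOn,
    setIntegral_indicator hsS, hset]

theorem setIntegral_iterate {g : X → ℝ} (hg : Measurable g) (hi : Integrable g lam) (s : Set ℕ)
    (n : ℕ) :
    ∫ q in R.H ⁻¹' s, R.A.op^[n] g q ∂lam = ∫ q in R.H ⁻¹' ((· + n) '' s), g q ∂lam := by
  induction n generalizing g with
  | zero => simp
  | succ n ih =>
    rw [Function.iterate_succ_apply, ih (R.A.measurable_op hg)
      (R.A.integrable_op hg hi.integrableOn), R.setIntegral_op hg hi, image_image]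
    rfl

theorem setIntegral_Δ_iterate {g : X → ℝ} (hg : Measurable g) (hi : Integrable g lam) (n : ℕ) :
    ∫ q in Δ, R.A.op^[n] g q ∂lam = ∫ q in R.H ⁻¹' {n}, g q ∂lam := by
  have := R.setIntegral_iterate hg hi {0} n
  rwa [image_singleton, zero_add, show R.H ⁻¹' {0} = Δ from ext fun q => (R.mem_Δ_iff q).symm]
    at this

theorem integral_iterate {g : X → ℝ} (hg : Measurable g) (hi : Integrable g lam) (n : ℕ) :
    ∫ q, R.A.op^[n] g q ∂lam = ∫ q in {q | n ≤ R.H q}, g q ∂lam := by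
  have := R.setIntegral_iterate hg hi univ n
  rw [preimage_univ, setIntegral_univ] at this
  rw [this]
  congr 2
  ext q
  simp only [mem_preimage, mem_image, mem_univ, true_and, mem_ofPred_eq]
  exact ⟨fun ⟨m, hm⟩ => by omega, fun h => ⟨R.H q - n, by omega⟩⟩

theorem hasSum_setIntegral {g : X → ℝ} (hi : Integrable g lam) :
    HasSum (fun n => ∫ q in R.H ⁻¹' {n}, g q ∂lam) (∫ q, g q ∂lam) := by
  have h := hasSum_integral_iUnion (μ := lam) (f := g) (s := fun n => R.H ⁻¹' {n})
    (fun n => R.measurable_H (MeasurableSet.of_discrete))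
    (fun i j hij => Disjoint.preimage _ (by simpa using hij)) hi.integrableOn
  rwa [← preimage_iUnion, iUnion_of_singleton, preimage_univ, setIntegral_univ] at h

variable {R} in
theorem InE.iterate_le [IsFiniteMeasure lam] {K : ℝ} (hK : 0 ≤ K) {g : X → ℝ} (hg : R.InE K g)
    (hm : Measurable g) (hi : Integrable g lam) (n : ℕ) (q : X) :
    R.A.op^[n] g q ≤ Real.exp (K * R.d₀) * R.M q / lam.real Δ * ∫ q in R.H ⁻¹' {n}, g q ∂lam := by
  rw [← R.setIntegral_Δ_iterate hm hi, div_mul_eq_mul_div, le_div_iff₀ R.measure_pos,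
    ← integral_const_mul]
  have hgn := hg.iterate hK n
  calc R.A.op^[n] g q * lam.real Δ = ∫ _ in Δ, R.A.op^[n] g q ∂lam := by
        rw [setIntegral_const, smul_eq_mul, mul_comm]
    _ ≤ _ := by
        refine setIntegral_mono_on (integrable_const _)
          ((R.integrable_iterate hm hi n).integrableOn.const_mul _) R.measurableSet_Δ
          fun q' hq' => (hgn.2 q q').trans ?_
        have h1 := R.c_le_M q q' hq'
        have h2 := R.d_le q q'
        have h3 := hgn.1 q'
        have h4 := R.c_pos q q'
        gcongr

theorem integrable_H : Integrable (fun q => (R.H q : ℝ)) lam := by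
  have hm := R.measurable_H
  refine ⟨Measurable.aestronglyMeasurable (by fun_prop), ?_⟩
  rw [hasFiniteIntegral_iff_ofReal (ae_of_all _ fun q => Nat.cast_nonneg _)]
  simpa using lt_top_iff_ne_top.2 R.lintegral_H_ne_top

theorem summable_mul_iterate_one [IsFiniteMeasure lam] (q : X) :
    Summable fun n : ℕ => ((n : ℝ) + 1) * R.A.op^[n] (fun _ => 1) q := by
  have h1 := (R.hasSum_setIntegral (g := fun q => (R.H q : ℝ) + 1)
    (R.integrable_H.add (integrable_const (1 : ℝ)))).summable
  refine Summable.of_nonneg_of_le (fun n => ?_) (fun n => ?_)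
    (h1.mul_left (Real.exp (0 * R.d₀) * R.M q / lam.real Δ))
  · exact mul_nonneg (by positivity) (R.A.iterate_op_nonneg (fun _ => zero_le_one) n q)
  · have h2 := inE_one.iterate_le (R := R) le_rfl measurable_const (integrable_const _) n q
    have h3 : ∫ q in R.H ⁻¹' {n}, ((R.H q : ℝ) + 1) ∂lam
        = ((n : ℝ) + 1) * ∫ q in R.H ⁻¹' {n}, (1 : ℝ) ∂lam := by
      rw [← integral_const_mul]
      refine setIntegral_congr_fun (R.measurable_H (MeasurableSet.of_discrete)) fun q hq => ?_
      simp only [mem_preimage, mem_singleton_iff] at hq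
      simp [hq]
    rw [h3, mul_left_comm]
    exact mul_le_mul_of_nonneg_left h2 (by positivity)

theorem summable_iterate_one [IsFiniteMeasure lam] (q : X) :
    Summable fun n : ℕ => R.A.op^[n] (fun _ => 1) q := by
  refine Summable.of_nonneg_of_le (fun n => R.A.iterate_op_nonneg (fun _ => zero_le_one) n q)
    (fun n => ?_) (R.summable_mul_iterate_one q)
  have := R.A.iterate_op_nonneg (g := fun _ => 1) (fun _ => zero_le_one) n q
  nlinarith [(Nat.cast_nonneg n : (0 : ℝ) ≤ n)]

/-- The potential `∑ Aⁿ g` of the excursions. -/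
def U (g : X → ℝ) (q : X) : ℝ := ∑' n : ℕ, R.A.op^[n] g q

/-- The potential of the constant function `1`. -/
def u₁ : X → ℝ := R.U fun _ => 1

theorem measurable_tsum_of_summable {g : ℕ → X → ℝ} (hg : ∀ n, Measurable (g n))
    (hs : ∀ q, Summable fun n => g n q) : Measurable fun q => ∑' n, g n q := by
  refine measurable_of_tendsto_metrizable (f := fun (n : ℕ) q => ∑ k ∈ Finset.range n, g k q)
    (fun n => Finset.measurable_fun_sum _ fun k _ => hg k) ?_
  rw [tendsto_pi_nhds]
  exact fun q => (hs q).hasSum.tendsto_sum_nat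

theorem inE_u₁ [IsFiniteMeasure lam] : R.InE 0 R.u₁ :=
  InE.tsum (fun n => inE_one.iterate le_rfl n) R.summable_iterate_one

theorem measurable_u₁ [IsFiniteMeasure lam] : Measurable R.u₁ :=
  measurable_tsum_of_summable (R.A.measurable_iterate_op measurable_const) R.summable_iterate_one

theorem one_le_u₁ [IsFiniteMeasure lam] (q : X) : 1 ≤ R.u₁ q :=
  (R.summable_iterate_one q).le_tsum 0 fun n _ => R.A.iterate_op_nonneg (fun _ => zero_le_one) n q

theorem integrable_u₁ [IsFiniteMeasure lam] : Integrable R.u₁ lam := by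
  refine ⟨R.measurable_u₁.aestronglyMeasurable, ?_⟩
  rw [hasFiniteIntegral_iff_ofReal (ae_of_all _ R.inE_u₁.1)]
  have h1 : ∀ q, ENNReal.ofReal (R.u₁ q) = ∑' n, ENNReal.ofReal (R.A.op^[n] (fun _ => 1) q) :=
    fun q => ENNReal.ofReal_tsum_of_nonneg
      (fun n => R.A.iterate_op_nonneg (fun _ => zero_le_one) n q) (R.summable_iterate_one q)
  simp only [h1]
  have hmeas : ∀ n : ℕ, MeasurableSet {q | n ≤ R.H q} := fun n =>
    measurableSet_le measurable_const R.measurable_H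
  rw [lintegral_tsum fun n => ((R.A.measurable_iterate_op measurable_const n).ennreal_ofReal
    ).aemeasurable]
  have h2 : ∀ n, ∫⁻ q, ENNReal.ofReal (R.A.op^[n] (fun _ => 1) q) ∂lam
      = ∫⁻ q, {q | n ≤ R.H q}.indicator (fun _ => 1) q ∂lam := by
    intro n
    rw [← ofReal_integral_eq_lintegral_ofReal
      (R.integrable_iterate measurable_const (integrable_const _) n)
      (ae_of_all _ fun q => R.A.iterate_op_nonneg (fun _ => zero_le_one) n q),
      R.integral_iterate measurable_const (integrable_const _), lintegral_indicator_const (hmeas n)]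
    simp
  simp only [h2]
  rw [← lintegral_tsum fun n => (measurable_const.indicator (hmeas n)).aemeasurable]
  have h3 : ∀ q, ∑' n : ℕ, {q | n ≤ R.H q}.indicator (fun _ => (1 : ENNReal)) q = R.H q + 1 := by
    intro q
    rw [tsum_eq_sum (s := Finset.range (R.H q + 1)) (fun n hn => by
      simp only [Finset.mem_range] at hn
      simp only [indicator, mem_ofPred_eq, ite_eq_right_iff]
      omega)]
    rw [Finset.sum_congr rfl fun n hn => by
      simp only [Finset.mem_range] at hn
      rw [indicator_of_mem (by simp only [mem_ofPred_eq]; omega)]]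
    simp
  simp only [h3]
  rw [lintegral_add_right _ measurable_const]
  simp only [lintegral_const, one_mul]
  exact ENNReal.add_lt_top.2 ⟨lt_top_iff_ne_top.2 R.lintegral_H_ne_top, measure_lt_top _ _⟩

end FirstReturnSystem

namespace FirstReturnSystem

variable {X : Type*} [MeasurableSpace X] {lam : Measure X} {S : X → X} {Δ : Set X}
  (R : FirstReturnSystem lam S Δ)

/-- Measurable functions dominated by the potential `u₁`. -/
def Good (g : X → ℝ) : Prop := Measurable g ∧ ∃ C, ∀ q, |g q| ≤ C * R.u₁ q

/-- Measurable functions bounded on `Δ`. -/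
def Adm (Δ : Set X) (w : X → ℝ) : Prop := Measurable w ∧ ∃ C, ∀ q ∈ Δ, |w q| ≤ C

/-- Nonnegative log-Lipschitz functions on `Δ`. -/
def InC (K : ℝ) (w : X → ℝ) : Prop :=
  (∀ q ∈ Δ, 0 ≤ w q) ∧ ∀ q ∈ Δ, ∀ q' ∈ Δ, w q ≤ Real.exp (K * R.d q q') * w q'

include R in
theorem nonempty_Δ : Δ.Nonempty := nonempty_of_measure_ne_zero R.measure_Δ_ne_zero

section Potential

variable [IsFiniteMeasure lam]

theorem summable_iterate_u₁ (q : X) : Summable fun n : ℕ => R.A.op^[n] R.u₁ q := by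
  refine Summable.of_nonneg_of_le (fun n => R.A.iterate_op_nonneg R.inE_u₁.1 n q)
    (fun n => R.inE_u₁.iterate_le le_rfl R.measurable_u₁ R.integrable_u₁ n q) ?_
  exact (R.hasSum_setIntegral R.integrable_u₁).summable.mul_left _

variable {R}

theorem Good.summable_abs {g : X → ℝ} (hg : R.Good g) (q : X) :
    Summable fun n : ℕ => |R.A.op^[n] g q| := by
  obtain ⟨C, hC⟩ := hg.2
  refine Summable.of_nonneg_of_le (fun n => abs_nonneg _) (fun n => ?_)
    ((R.summable_iterate_u₁ q).mul_left C)
  rw [← R.A.iterate_op_const_mul]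
  exact R.A.abs_iterate_op_le hC n q

theorem Good.summable {g : X → ℝ} (hg : R.Good g) (q : X) :
    Summable fun n : ℕ => R.A.op^[n] g q := (hg.summable_abs q).of_abs

theorem Good.integrable {g : X → ℝ} (hg : R.Good g) : Integrable g lam := by
  obtain ⟨C, hC⟩ := hg.2
  exact (R.integrable_u₁.const_mul C).mono' hg.1.aestronglyMeasurable (ae_of_all _ hC)

omit [IsFiniteMeasure lam] in
theorem Good.const_mul {g : X → ℝ} (hg : R.Good g) (a : ℝ) : R.Good fun q => a * g q := by
  obtain ⟨C, hC⟩ := hg.2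
  refine ⟨hg.1.const_mul a, |a| * C, fun q => ?_⟩
  rw [abs_mul, mul_assoc]
  exact mul_le_mul_of_nonneg_left (hC q) (abs_nonneg _)

theorem good_of_bounded {g : X → ℝ} (hm : Measurable g) {C : ℝ} (hC : ∀ q, |g q| ≤ C) :
    R.Good g := by
  refine ⟨hm, C, fun q => (hC q).trans ?_⟩
  have h0 : 0 ≤ C := (abs_nonneg _).trans (hC q)
  exact le_mul_of_one_le_right h0 (R.one_le_u₁ q)

theorem Good.measurable_U {g : X → ℝ} (hg : R.Good g) : Measurable (R.U g) :=
  measurable_tsum_of_summable (R.A.measurable_iterate_op hg.1) hg.summable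

theorem Good.U_add {g k : X → ℝ} (hg : R.Good g) (hk : R.Good k) (q : X) :
    R.U (fun x => g x + k x) q = R.U g q + R.U k q := by
  simp only [U, R.A.iterate_op_add]
  exact (hg.summable q).tsum_add (hk.summable q)

theorem Good.U_sub {g k : X → ℝ} (hg : R.Good g) (hk : R.Good k) (q : X) :
    R.U (fun x => g x - k x) q = R.U g q - R.U k q := by
  simp only [U, R.A.iterate_op_sub]
  exact (hg.summable q).tsum_sub (hk.summable q)

omit [IsFiniteMeasure lam] in
variable (R) in
theorem U_const_mul (a : ℝ) (g : X → ℝ) (q : X) : R.U (fun x => a * g x) q = a * R.U g q := by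
  simp only [U, R.A.iterate_op_const_mul, tsum_mul_left]

omit [IsFiniteMeasure lam] in
/-- The resolvent equation of the excursion operator. -/
theorem U_eq_of_summable {g : X → ℝ} (hg : ∀ q, Summable fun n : ℕ => R.A.op^[n] g q) (q : X) :
    R.U g q = g q + R.A.op (R.U g) q := by
  have h1 := (hg q).tsum_eq_zero_add
  rw [U, h1, Function.iterate_zero_apply]
  congr 1
  simp only [Function.iterate_succ_apply', InverseBranches.op, U]
  rw [Summable.tsum_finsetSum fun i _ => (hg _).mul_left _]
  exact Finset.sum_congr rfl fun i _ => tsum_mul_left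

theorem Good.U_eq {g : X → ℝ} (hg : R.Good g) (q : X) : R.U g q = g q + R.A.op (R.U g) q :=
  U_eq_of_summable hg.summable q

omit [IsFiniteMeasure lam] in
variable (R) in
theorem U_mul_of_invariant {k : X → ℝ} (hk : ∀ q, k (S q) = k q) (g : X → ℝ) (q : X) :
    R.U (fun x => g x * k x) q = R.U g q * k q := by
  have h : ∀ (n : ℕ) x, k (S^[n] x) = k x := by
    intro n x
    induction n with
    | zero => rfl
    | succ n ih => rw [Function.iterate_succ_apply', hk, ih]
  simp only [U]
  rw [← tsum_mul_right]
  refine tsum_congr fun n => ?_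
  rw [← R.A.iterate_op_mul_comp]
  simp only [h]

theorem Good.abs_U_le {g k : X → ℝ} (hk : R.Good k) (h : ∀ q, |g q| ≤ k q) (q : X) :
    |R.U g q| ≤ R.U k q := by
  have h1 : Summable fun n : ℕ => ‖R.A.op^[n] g q‖ :=
    Summable.of_nonneg_of_le (fun n => norm_nonneg _)
      (fun n => R.A.abs_iterate_op_le h n q) (hk.summable q)
  exact (norm_tsum_le_tsum_norm h1).trans
    (h1.tsum_le_tsum (fun n => R.A.abs_iterate_op_le h n q) (hk.summable q))

theorem InE.U {K : ℝ} (hK : 0 ≤ K) {g : X → ℝ} (hg : R.InE K g) (h : R.Good g) :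
    R.InE K (R.U g) :=
  InE.tsum (fun n => hg.iterate hK n) h.summable

omit [IsFiniteMeasure lam] in
theorem InE.inC {K : ℝ} {g : X → ℝ} (hg : R.InE K g) : R.InC (K + R.D) g := by
  refine ⟨fun q _ => hg.1 q, fun q hq q' hq' => (hg.2 q q').trans ?_⟩
  have h1 := R.c_le_exp q hq q' hq'
  have h2 := hg.1 q'
  rw [add_mul, Real.exp_add]
  gcongr

omit [IsFiniteMeasure lam] in
theorem InC.mono {K K' : ℝ} (h : K ≤ K') {w : X → ℝ} (hw : R.InC K w) : R.InC K' w := by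
  refine ⟨hw.1, fun q hq q' hq' => (hw.2 q hq q' hq').trans ?_⟩
  have := R.d_nonneg q q'
  have := hw.1 q' hq'
  gcongr

omit [IsFiniteMeasure lam] in
theorem InC.bounded {K : ℝ} (hK : 0 ≤ K) {w : X → ℝ} (hw : R.InC K w) :
    ∃ C, ∀ q ∈ Δ, |w q| ≤ C := by
  obtain ⟨q', hq'⟩ := R.nonempty_Δ
  refine ⟨Real.exp (K * R.d₀) * w q', fun q hq => ?_⟩
  rw [abs_of_nonneg (hw.1 q hq)]
  refine (hw.2 q hq q' hq').trans ?_
  have := R.d_le q q'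
  have := hw.1 q' hq'
  gcongr

theorem good_u₁ : R.Good R.u₁ :=
  ⟨R.measurable_u₁, 1, fun q => by rw [one_mul, abs_of_nonneg (R.inE_u₁.1 q)]⟩

theorem Good.adm_U {g : X → ℝ} (hg : R.Good g) : Adm Δ (R.U g) := by
  refine ⟨hg.measurable_U, ?_⟩
  obtain ⟨C, hC⟩ := hg.2
  obtain ⟨C', hC'⟩ := (R.inE_u₁.U le_rfl good_u₁).inC.bounded (by simpa using R.D_nonneg)
  have hC0 : 0 ≤ C := by
    obtain ⟨q, -⟩ := R.nonempty_Δ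
    have h1 := (abs_nonneg _).trans (hC q)
    exact nonneg_of_mul_nonneg_left h1 (zero_lt_one.trans_le (R.one_le_u₁ q))
  refine ⟨C * C', fun q hq => ((good_u₁.const_mul C).abs_U_le hC q).trans ?_⟩
  rw [R.U_const_mul]
  exact mul_le_mul_of_nonneg_left ((le_abs_self _).trans (hC' q hq)) hC0

include R in
theorem Adm.integrableOn {w : X → ℝ} (hw : Adm Δ w) : IntegrableOn w Δ lam := by
  obtain ⟨C, hC⟩ := hw.2
  exact Measure.integrableOn_of_bounded (measure_ne_top _ _) hw.1.aestronglyMeasurable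
    (M := C) ((ae_restrict_iff' R.measurableSet_Δ).2 (ae_of_all _ hC))

theorem Good.setIntegral_U {g : X → ℝ} (hg : R.Good g) :
    ∫ q in Δ, R.U g q ∂lam = ∫ q, g q ∂lam := by
  have hi := fun n => (R.integrable_iterate hg.1 hg.integrable n).integrableOn (s := Δ)
  have habs : R.Good fun q => |g q| := by
    obtain ⟨C, hC⟩ := hg.2
    exact ⟨by have := hg.1; fun_prop, C, fun q => by rw [abs_abs]; exact hC q⟩
  have hs : Summable fun n => ∫ q in Δ, ‖R.A.op^[n] g q‖ ∂lam := by
    refine Summable.of_nonneg_of_le (fun n => integral_nonneg fun q => norm_nonneg _) (fun n => ?_)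
      (R.hasSum_setIntegral habs.integrable).summable
    rw [← R.setIntegral_Δ_iterate habs.1 habs.integrable]
    exact integral_mono (hi n).norm
      (R.integrable_iterate habs.1 habs.integrable n).integrableOn
      (fun q => R.A.abs_iterate_op_le (fun _ => le_rfl) n q)
  have h1 := hasSum_integral_of_summable_integral_norm hi hs
  have h2 := R.hasSum_setIntegral hg.integrable
  simp only [← R.setIntegral_Δ_iterate hg.1 hg.integrable] at h2
  exact h1.unique h2

end Potential

section Induced

/-- The transfer operator of the first return map. -/
def L (w : X → ℝ) : X → ℝ := R.U (R.B.op w)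

variable [IsFiniteMeasure lam] {R}

include R in
omit [IsFiniteMeasure lam] in
theorem B_one_const (q q' : X) : R.B.op (fun _ => 1) q = R.B.op (fun _ => 1) q' := by
  simp only [InverseBranches.op, mul_one]
  exact Finset.sum_congr rfl fun i _ => R.B_a_const i q q'

omit [IsFiniteMeasure lam] in
variable (R) in
theorem B_one_pos (q : X) : 0 < R.B.op (fun _ => 1) q := by
  simp only [InverseBranches.op, mul_one]
  exact Finset.sum_pos (fun i _ => R.B_a_pos i q) Finset.univ_nonempty

omit [IsFiniteMeasure lam] in
variable (R) in
theorem B_bounded {w : X → ℝ} (hw : Adm Δ w) : ∃ C, ∀ q, |R.B.op w q| ≤ C := by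
  obtain ⟨C, hC⟩ := hw.2
  obtain ⟨q', hq'⟩ := R.nonempty_Δ
  refine ⟨C * R.B.op (fun _ => 1) q', fun q => ?_⟩
  rw [← B_one_const q q', ← R.B.op_const_mul]
  exact R.B.abs_op_le (fun x hx => by rw [mul_one]; exact hC x hx) q

theorem Adm.good_B {w : X → ℝ} (hw : Adm Δ w) : R.Good (R.B.op w) := by
  obtain ⟨C, hC⟩ := R.B_bounded hw
  exact good_of_bounded (R.B.measurable_op hw.1) hC

theorem Adm.L {w : X → ℝ} (hw : Adm Δ w) : Adm Δ (R.L w) := (hw.good_B (R := R)).adm_U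

omit [MeasurableSpace X] in
theorem adm_bound_add {w v : X → ℝ} (hw : ∃ C, ∀ q ∈ Δ, |w q| ≤ C)
    (hv : ∃ C, ∀ q ∈ Δ, |v q| ≤ C) : ∃ C, ∀ q ∈ Δ, |w q + v q| ≤ C := by
  obtain ⟨C, hC⟩ := hw
  obtain ⟨C', hC'⟩ := hv
  exact ⟨C + C', fun q hq => (abs_add_le _ _).trans (add_le_add (hC q hq) (hC' q hq))⟩

theorem Adm.add {w v : X → ℝ} (hw : Adm Δ w) (hv : Adm Δ v) : Adm Δ fun q => w q + v q :=
  ⟨hw.1.add hv.1, adm_bound_add hw.2 hv.2⟩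

theorem Adm.const_mul {w : X → ℝ} (hw : Adm Δ w) (a : ℝ) : Adm Δ fun q => a * w q := by
  obtain ⟨C, hC⟩ := hw.2
  refine ⟨hw.1.const_mul a, |a| * C, fun q hq => ?_⟩
  rw [abs_mul]
  exact mul_le_mul_of_nonneg_left (hC q hq) (abs_nonneg _)

theorem Adm.sub {w v : X → ℝ} (hw : Adm Δ w) (hv : Adm Δ v) : Adm Δ fun q => w q - v q := by
  simpa [sub_eq_add_neg] using hw.add (hv.const_mul (-1))

theorem adm_const (a : ℝ) : Adm Δ fun _ => a := ⟨measurable_const, |a|, fun _ _ => le_rfl⟩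

theorem Adm.L_add {w v : X → ℝ} (hw : Adm Δ w) (hv : Adm Δ v) (q : X) :
    R.L (fun x => w x + v x) q = R.L w q + R.L v q := by
  rw [FirstReturnSystem.L, funext (R.B.op_add w v)]
  exact (hw.good_B).U_add (hv.good_B) q

theorem Adm.L_sub {w v : X → ℝ} (hw : Adm Δ w) (hv : Adm Δ v) (q : X) :
    R.L (fun x => w x - v x) q = R.L w q - R.L v q := by
  rw [FirstReturnSystem.L, funext (R.B.op_sub w v)]
  exact (hw.good_B).U_sub (hv.good_B) q

omit [IsFiniteMeasure lam] in
variable (R) in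
theorem L_const_mul (a : ℝ) (w : X → ℝ) (q : X) : R.L (fun x => a * w x) q = a * R.L w q := by
  rw [FirstReturnSystem.L, funext (R.B.op_const_mul a w)]
  exact R.U_const_mul a _ q

theorem Adm.abs_L_le {w v : X → ℝ} (hv : Adm Δ v) (h : ∀ q ∈ Δ, |w q| ≤ v q) (q : X) :
    |R.L w q| ≤ R.L v q :=
  (hv.good_B).abs_U_le (fun x => R.B.abs_op_le h x) q

omit [IsFiniteMeasure lam] in
variable (R) in
theorem L_mul_of_invariant {k : X → ℝ} (hk : ∀ q, k (S q) = k q) (w : X → ℝ) (q : X) :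
    R.L (fun x => w x * k x) q = R.L w q * k q := by
  change R.U (R.B.op fun x => w x * k x) q = R.U (R.B.op w) q * k q
  rw [← R.U_mul_of_invariant hk]
  congr 1
  funext x
  rw [← R.B.op_mul_comp]
  simp only [hk]

theorem Adm.setIntegral_L {w : X → ℝ} (hw : Adm Δ w) :
    ∫ q in Δ, R.L w q ∂lam = ∫ q in Δ, w q ∂lam := by
  rw [FirstReturnSystem.L, (hw.good_B).setIntegral_U,
    R.B.integral_op hw.1 (Adm.integrableOn (R := R) hw)]

omit [IsFiniteMeasure lam] in
theorem InC.B {K : ℝ} (hK : 0 ≤ K) {w : X → ℝ} (hw : R.InC K w) : R.InE (R.κ * K) (R.B.op w) := by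
  refine ⟨fun q => R.B.op_nonneg hw.1 q, fun q q' => ?_⟩
  rw [InverseBranches.op, InverseBranches.op, Finset.mul_sum]
  refine Finset.sum_le_sum fun i _ => ?_
  have h1 := hw.2 _ (R.B.θ_mem i q) _ (R.B.θ_mem i q')
  have h2 := R.B.a_nonneg i q
  have h3 := hw.1 _ (R.B.θ_mem i q')
  have h4 := R.one_le_c q q'
  have h5 := R.d_B_le i q q'
  have h6 : K * R.d (R.B.θ i q) (R.B.θ i q') ≤ R.κ * K * R.d q q' := by
    calc _ ≤ K * (R.κ * R.d q q') := by gcongr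
      _ = _ := by ring
  calc R.B.a i q * w (R.B.θ i q)
      ≤ R.B.a i q * (Real.exp (K * R.d (R.B.θ i q) (R.B.θ i q')) * w (R.B.θ i q')) := by gcongr
    _ ≤ R.B.a i q * (Real.exp (R.κ * K * R.d q q') * R.c q q' * w (R.B.θ i q')) := by
        refine mul_le_mul_of_nonneg_left (mul_le_mul_of_nonneg_right ?_ h3) h2
        exact (Real.exp_le_exp.2 h6).trans (le_mul_of_one_le_right (Real.exp_pos _).le h4)
    _ = _ := by rw [R.B_a_const i q q']; ring

theorem InC.L {K : ℝ} (hK : 0 ≤ K) {w : X → ℝ} (hw : R.InC K w) (hm : Measurable w) :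
    R.InC (R.κ * K + R.D) (R.L w) :=
  ((hw.B hK).U (mul_nonneg R.κ_nonneg hK) (Adm.good_B ⟨hm, hw.bounded hK⟩)).inC

theorem InC.le_mul {K : ℝ} (hK : 0 ≤ K) {w : X → ℝ} (hw : R.InC K w) (hm : Measurable w) {q : X}
    (hq : q ∈ Δ) : w q * lam.real Δ ≤ Real.exp (K * R.d₀) * ∫ q in Δ, w q ∂lam := by
  have hi := Adm.integrableOn (R := R) ⟨hm, hw.bounded hK⟩
  calc w q * lam.real Δ = ∫ _ in Δ, w q ∂lam := by rw [setIntegral_const, smul_eq_mul, mul_comm]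
    _ ≤ ∫ q' in Δ, Real.exp (K * R.d₀) * w q' ∂lam := by
        refine setIntegral_mono_on (integrable_const _) (hi.const_mul _) R.measurableSet_Δ
          fun q' hq' => (hw.2 q hq q' hq').trans ?_
        have := R.d_le q q'
        have := hw.1 q' hq'
        gcongr
    _ = _ := integral_const_mul _ _

theorem InC.mul_le {K : ℝ} (hK : 0 ≤ K) {w : X → ℝ} (hw : R.InC K w) (hm : Measurable w) {q : X}
    (hq : q ∈ Δ) : ∫ q in Δ, w q ∂lam ≤ Real.exp (K * R.d₀) * (w q * lam.real Δ) := by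
  have hi := Adm.integrableOn (R := R) ⟨hm, hw.bounded hK⟩
  calc _ ≤ ∫ q' in Δ, Real.exp (K * R.d₀) * w q ∂lam := by
        refine setIntegral_mono_on hi (integrable_const _) R.measurableSet_Δ
          fun q' hq' => (hw.2 q' hq' q hq).trans ?_
        have := R.d_le q' q
        have := hw.1 q hq
        gcongr
    _ = _ := by rw [setIntegral_const, smul_eq_mul]; ring

theorem adm_iterate_L {w : X → ℝ} (hw : Adm Δ w) (n : ℕ) : Adm Δ (R.L^[n] w) := by
  induction n generalizing w with
  | zero => exact hw
  | succ n ih => exact ih hw.L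

theorem iterate_L_sub {w v : X → ℝ} (hw : Adm Δ w) (hv : Adm Δ v) (n : ℕ) (q : X) :
    R.L^[n] (fun x => w x - v x) q = R.L^[n] w q - R.L^[n] v q := by
  induction n generalizing w v with
  | zero => rfl
  | succ n ih =>
    simp only [Function.iterate_succ_apply]
    rw [funext (hw.L_sub hv)]
    exact ih hw.L hv.L

/-- The cone contraction estimate for the first return transfer operator. -/
theorem exists_contraction {K : ℝ} (hK : 0 < K) (hKD : R.κ * K + R.D < K) :
    ∃ C r : ℝ, 0 ≤ C ∧ 0 ≤ r ∧ r < 1 ∧ ∀ (n : ℕ) (w₁ w₂ : X → ℝ), Measurable w₁ → Measurable w₂ →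
      R.InC K w₁ → R.InC K w₂ → ∫ q in Δ, w₁ q ∂lam = ∫ q in Δ, w₂ q ∂lam →
      ∀ q ∈ Δ, |R.L^[n] w₁ q - R.L^[n] w₂ q| ≤ C * r ^ n * ∫ q in Δ, w₁ q ∂lam := by
  set K' := R.κ * K + R.D with hK'
  have hK'0 : 0 ≤ K' := add_nonneg (mul_nonneg R.κ_nonneg hK.le) R.D_nonneg
  have hl := R.measure_pos
  set ε := 1 - K' / K with hε
  have hε0 : 0 < ε := by
    rw [hε, sub_pos, div_lt_one hK]; exact hKD
  have hε1 : ε ≤ 1 := by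
    have : 0 ≤ K' / K := by positivity
    linarith
  have hd₀ : 0 ≤ R.d₀ := by
    obtain ⟨q, -⟩ := R.nonempty_Δ
    exact (R.d_nonneg q q).trans (R.d_le q q)
  set s := ε * Real.exp (-(K' * R.d₀)) with hs
  have hs0 : 0 < s := by positivity
  have hs1 : s ≤ 1 := by
    refine mul_le_one₀ hε1 (Real.exp_pos _).le (Real.exp_le_one_iff.2 ?_)
    have := mul_nonneg hK'0 hd₀
    linarith
  -- one step of the cone contraction
  have step : ∀ w : X → ℝ, Measurable w → R.InC K w →
      R.InC K (fun q => R.L w q - s / lam.real Δ * ∫ q in Δ, w q ∂lam) := by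
    intro w hm hw
    set I := ∫ q in Δ, w q ∂lam with hI
    have hadm : Adm Δ w := ⟨hm, hw.bounded hK.le⟩
    have hLw := hw.L hK.le hm
    have hI0 : 0 ≤ I := setIntegral_nonneg R.measurableSet_Δ hw.1
    have hlow : ∀ q ∈ Δ, s / lam.real Δ * I ≤ ε * R.L w q := by
      intro q hq
      have h1 := hLw.mul_le hK'0 (hadm.L (R := R)).1 hq
      rw [hadm.setIntegral_L] at h1
      rw [hs, div_mul_eq_mul_div, div_le_iff₀ hl, mul_assoc, mul_assoc]
      refine mul_le_mul_of_nonneg_left ?_ hε0.le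
      calc Real.exp (-(K' * R.d₀)) * I
          ≤ Real.exp (-(K' * R.d₀)) * (Real.exp (K' * R.d₀) * (R.L w q * lam.real Δ)) := by
            gcongr
        _ = _ := by rw [← mul_assoc, ← Real.exp_add]; simp
    refine ⟨fun q hq => ?_, fun q hq q' hq' => ?_⟩
    · have h1 := hlow q hq
      have h2 := hLw.1 q hq
      nlinarith
    · have h1 := hlow q' hq'
      have h2 := hLw.1 q' hq'
      have h3 := hLw.2 q hq q' hq'
      have hd := R.d_nonneg q q'
      set x := R.d q q'
      have hconv : Real.exp (K' * x) ≤ ε + (1 - ε) * Real.exp (K * x) := by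
        have := convexOn_exp.2 (mem_univ (0 : ℝ)) (mem_univ (K * x)) hε0.le
          (show 0 ≤ 1 - ε by linarith) (by ring)
        simp only [smul_eq_mul, mul_zero, zero_add, Real.exp_zero, mul_one] at this
        rwa [show (1 - ε) * (K * x) = K' * x by rw [hε]; field_simp; ring] at this
      have hexp1 : 1 ≤ Real.exp (K * x) := Real.one_le_exp (by positivity)
      have h4 : R.L w q ≤ (ε + (1 - ε) * Real.exp (K * x)) * R.L w q' :=
        h3.trans (mul_le_mul_of_nonneg_right hconv h2)
      have h5 : s / lam.real Δ * I * (Real.exp (K * x) - 1)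
          ≤ ε * R.L w q' * (Real.exp (K * x) - 1) :=
        mul_le_mul_of_nonneg_right h1 (by linarith)
      nlinarith
  refine ⟨Real.exp (K * R.d₀) / lam.real Δ, 1 - s, by positivity, by linarith, by linarith, ?_⟩
  intro n
  induction n with
  | zero =>
    intro w₁ w₂ m₁ m₂ h₁ h₂ heq q hq
    have b₁ := h₁.le_mul hK.le m₁ hq
    have b₂ := h₂.le_mul hK.le m₂ hq
    rw [← heq] at b₂
    rw [← le_div_iff₀ hl] at b₁ b₂
    have p₁ := h₁.1 q hq
    have p₂ := h₂.1 q hq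
    simp only [Function.iterate_zero_apply, pow_zero, mul_one]
    rw [div_mul_eq_mul_div, abs_le]
    constructor <;> linarith
  | succ n ih =>
    intro w₁ w₂ m₁ m₂ h₁ h₂ heq q hq
    have a₁ : Adm Δ w₁ := ⟨m₁, h₁.bounded hK.le⟩
    have a₂ : Adm Δ w₂ := ⟨m₂, h₂.bounded hK.le⟩
    have l₁ := a₁.L (R := R)
    have l₂ := a₂.L (R := R)
    set I := ∫ q in Δ, w₁ q ∂lam with hI
    have hi0 : ∀ w, Adm Δ w → ∫ q in Δ, (R.L w q - s / lam.real Δ * ∫ q in Δ, w q ∂lam) ∂lam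
        = (1 - s) * ∫ q in Δ, w q ∂lam := by
      intro w hw
      rw [integral_sub (Adm.integrableOn (R := R) hw.L) (integrable_const _), hw.setIntegral_L,
        setIntegral_const, smul_eq_mul]
      field_simp
    have key := ih _ _ (l₁.1.sub_const _) (l₂.1.sub_const _) (step w₁ m₁ h₁) (step w₂ m₂ h₂)
      (by rw [hi0 _ a₁, hi0 _ a₂, ← heq]) q hq
    rw [hi0 _ a₁, ← heq, iterate_L_sub l₁ (adm_const _), iterate_L_sub l₂ (adm_const _),
      sub_sub_sub_cancel_right] at key
    simp only [Function.iterate_succ_apply]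
    calc _ ≤ _ := key
      _ = _ := by rw [pow_succ, ← hI]; ring

end Induced

end FirstReturnSystem

namespace FirstReturnSystem

variable {X : Type*} [MeasurableSpace X] {lam : Measure X} {S : X → X} {Δ : Set X}
  {R : FirstReturnSystem lam S Δ} [IsFiniteMeasure lam]

/-- Solution of `g = w + L g` by summing an exponentially decaying Neumann series. -/
theorem exists_neumann_series {w : X → ℝ} (hw : Adm Δ w) {C r : ℝ} (hr : 0 ≤ r) (hr1 : r < 1)
    (hd : ∀ n : ℕ, ∀ q ∈ Δ, |R.L^[n] w q| ≤ C * r ^ n) :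
    ∃ g, Adm Δ g ∧ (∀ q ∈ Δ, g q = w q + R.L g q) ∧
      ∀ q ∈ Δ, HasSum (fun n : ℕ => R.L^[n] w q) (g q) := by
  have hgs : Summable fun n : ℕ => C * r ^ n := (summable_geometric_of_lt_one hr hr1).mul_left C
  have hC : 0 ≤ C := by
    obtain ⟨q, hq⟩ := R.nonempty_Δ
    simpa using (abs_nonneg _).trans (hd 0 q hq)
  have hb : ∀ n : ℕ, ∀ q, |Δ.indicator (R.L^[n] w) q| ≤ C * r ^ n := by
    intro n q
    by_cases hq : q ∈ Δ
    · rw [indicator_of_mem hq]; exact hd n q hq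
    · rw [indicator_of_notMem hq, abs_zero]; positivity
  have hs : ∀ q, Summable fun n : ℕ => Δ.indicator (R.L^[n] w) q := fun q =>
    Summable.of_norm_bounded hgs fun n => hb n q
  set g : X → ℝ := fun q => ∑' n : ℕ, Δ.indicator (R.L^[n] w) q with hg
  have hsum : ∀ q ∈ Δ, HasSum (fun n : ℕ => R.L^[n] w q) (g q) := by
    intro q hq
    have h1 := (hs q).hasSum
    simp only [indicator_of_mem hq] at h1
    simpa only [hg, indicator_of_mem hq] using h1
  have hga : Adm Δ g := by
    refine ⟨measurable_tsum_of_summable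
      (fun n => (adm_iterate_L hw n).1.indicator R.measurableSet_Δ) hs,
      ∑' n : ℕ, C * r ^ n, fun q _ => ?_⟩
    exact tsum_of_norm_bounded (f := fun n : ℕ => Δ.indicator (R.L^[n] w) q) hgs.hasSum
      fun n => hb n q
  refine ⟨g, hga, fun q hq => ?_, hsum⟩
  have hpart : ∀ N : ℕ, Adm Δ (fun q => ∑ n ∈ Finset.range N, R.L^[n] w q) ∧
      ∀ q, R.L (fun q => ∑ n ∈ Finset.range N, R.L^[n] w q) q
        = ∑ n ∈ Finset.range N, R.L^[n + 1] w q := by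
    intro N
    induction N with
    | zero =>
      refine ⟨by simpa using adm_const (Δ := Δ) (0 : ℝ), fun q => ?_⟩
      have := R.L_const_mul 0 (fun _ => 0) q
      simpa using this
    | succ N ih =>
      simp only [Finset.sum_range_succ]
      refine ⟨ih.1.add (adm_iterate_L hw N), fun q => ?_⟩
      rw [ih.1.L_add (adm_iterate_L hw N), ih.2, Function.iterate_succ_apply']
  have hrest : ∀ N : ℕ, ∀ q ∈ Δ, |g q - ∑ n ∈ Finset.range N, R.L^[n] w q|
      ≤ C * r ^ N / (1 - r) := by
    intro N q hq
    rw [abs_sub_comm]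
    exact (dist_le_of_le_geometric_of_tendsto (C := C) (f := fun N =>
      ∑ n ∈ Finset.range N, R.L^[n] w q) r hr1 (fun n => by
        rw [Real.dist_eq, Finset.sum_range_succ, abs_sub_comm, add_sub_cancel_left]
        exact hd n q hq) (hsum q hq).tendsto_sum_nat N)
  have hlim : Tendsto (fun N : ℕ => ∑ n ∈ Finset.range N, R.L^[n + 1] w q) atTop
      (𝓝 (R.L g q)) := by
    rw [tendsto_iff_dist_tendsto_zero]
    refine squeeze_zero (fun _ => dist_nonneg)
      (g := fun N : ℕ => C * r ^ N / (1 - r) * R.L (fun _ => 1) q) (fun N => ?_) ?_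
    · rw [dist_comm, Real.dist_eq, ← (hpart N).2, ← hga.L_sub (hpart N).1]
      refine (Adm.abs_L_le (adm_const (C * r ^ N / (1 - r))) (hrest N) q).trans (le_of_eq ?_)
      rw [← R.L_const_mul]
      simp
    · have := ((tendsto_pow_atTop_nhds_zero_of_lt_one hr hr1).const_mul C).div_const (1 - r)
      simpa using this.mul_const (R.L (fun _ => 1) q)
  have h1 := ((hasSum_nat_add_iff' 1).2 (hsum q hq)).tendsto_sum_nat
  have h2 := tendsto_nhds_unique hlim h1
  simp only [Finset.range_one, Finset.sum_singleton, Function.iterate_zero_apply] at h2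
  linarith

omit [IsFiniteMeasure lam] in
variable (R) in
theorem inC_const {K : ℝ} (hK : 0 ≤ K) {a : ℝ} (ha : 0 ≤ a) : R.InC K fun _ => a :=
  ⟨fun _ _ => ha, fun q _ q' _ => le_mul_of_one_le_left ha
    (Real.one_le_exp (mul_nonneg hK (R.d_nonneg q q')))⟩

variable (R) in
/-- The first return transfer operator has a fixed density in a cone, bounded below. -/
theorem exists_invariant_density : ∃ (h : X → ℝ) (K ε : ℝ), 0 ≤ K ∧ 0 < ε ∧ Measurable h ∧
    R.InC K h ∧ (∀ q ∈ Δ, ε ≤ h q) ∧ ∀ q ∈ Δ, R.L h q = h q := by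
  have hκ : 0 < 1 - R.κ := by linarith [R.κ_lt_one]
  have hD := R.D_nonneg
  set K := (R.D + 1) / (1 - R.κ) with hKdef
  have hK : 0 < K := by positivity
  have hKe : R.κ * K + R.D = K - 1 := by
    rw [hKdef]; field_simp; ring
  obtain ⟨C, r, hC, hr, hr1, hcontr⟩ := R.exists_contraction hK (by linarith)
  have one : R.InC K fun _ => 1 := R.inC_const hK.le zero_le_one
  have aone : Adm Δ fun _ => (1 : ℝ) := adm_const 1
  have hiter : ∀ n : ℕ, ∀ w, Measurable w → R.InC K w → R.InC K (R.L^[n] w) := by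
    intro n
    induction n with
    | zero => exact fun w _ h => h
    | succ n ih =>
      intro w hm h
      exact ih _ (Adm.L (R := R) ⟨hm, h.bounded hK.le⟩).1 ((h.L hK.le hm).mono (by linarith))
  have hi0 : ∀ n : ℕ, ∀ w, Adm Δ w → ∫ q in Δ, R.L^[n] w q ∂lam = ∫ q in Δ, w q ∂lam := by
    intro n
    induction n with
    | zero => exact fun w _ => rfl
    | succ n ih => exact fun w hw => (ih _ hw.L).trans hw.setIntegral_L
  have aL := aone.L (R := R)
  have oneL : R.InC K (R.L fun _ => 1) := hiter 1 _ measurable_const one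
  obtain ⟨g, hga, hge, hgs⟩ := exists_neumann_series (R := R) (aL.sub aone)
    (C := C * ∫ q in Δ, R.L (fun _ => 1) q ∂lam) hr hr1 (by
      intro n q hq
      rw [iterate_L_sub aL aone]
      refine (hcontr n _ _ aL.1 aone.1 oneL one aone.setIntegral_L q hq).trans (le_of_eq (by ring)))
  have hlim : ∀ q ∈ Δ, Tendsto (fun n : ℕ => R.L^[n] (fun _ => 1) q) atTop (𝓝 (1 + g q)) := by
    intro q hq
    have h1 := (hgs q hq).tendsto_sum_nat.const_add 1
    refine h1.congr fun N => ?_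
    simp only [iterate_L_sub aL aone, ← Function.iterate_succ_apply]
    rw [Finset.sum_range_sub (fun n => R.L^[n] (fun _ => 1) q)]
    simp
  have hl := R.measure_pos
  refine ⟨fun q => 1 + g q, K, Real.exp (-(K * R.d₀)), hK.le, Real.exp_pos _,
    (aone.add hga).1, ⟨fun q hq => ?_, fun q hq q' hq' => ?_⟩, fun q hq => ?_, fun q hq => ?_⟩
  · exact ge_of_tendsto' (hlim q hq) fun n => (hiter n _ aone.1 one).1 q hq
  · exact le_of_tendsto_of_tendsto' (hlim q hq) ((hlim q' hq').const_mul _)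
      fun n => (hiter n _ aone.1 one).2 q hq q' hq'
  · refine ge_of_tendsto' (hlim q hq) fun n => ?_
    have h1 := (hiter n _ aone.1 one).mul_le hK.le (adm_iterate_L (R := R) aone n).1 hq
    rw [hi0 n _ aone, setIntegral_const, smul_eq_mul, mul_one, ← mul_assoc] at h1
    rw [Real.exp_neg, inv_le_iff_one_le_mul₀' (Real.exp_pos _)]
    exact le_of_mul_le_mul_right (by simpa using h1) hl
  · rw [aone.L_add hga]
    simp only [hge q hq]
    ring

/-- Observables which are bounded and Lipschitz with respect to `d`. -/
def Lip (R : FirstReturnSystem lam S Δ) (l : ℝ) (w : X → ℝ) : Prop :=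
  ∀ q q', w q ≤ w q' + l * R.d q q'

omit [IsFiniteMeasure lam] in
theorem Lip.exp_le {l : ℝ} {w : X → ℝ} (hw : R.Lip l w) (hl : 0 ≤ l) {M : ℝ}
    (hM : ∀ q, |w q| + 1 ≤ M) (q q' : X) :
    w q + M ≤ Real.exp (l * R.d q q') * (w q' + M) := by
  have h1 := hw q q'
  have h2 := hM q'
  have h3 := neg_abs_le (w q')
  have h4 := mul_nonneg hl (R.d_nonneg q q')
  have h5 := Real.add_one_le_exp (l * R.d q q')
  calc w q + M ≤ (l * R.d q q' + 1) * (w q' + M) := by nlinarith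
    _ ≤ _ := by gcongr; linarith

theorem setIntegral_iterate_mul {k : X → ℝ} (hk : ∀ q, k (S q) = k q) (hka : Adm Δ k)
    {w : X → ℝ} (hw : Adm Δ w) (n : ℕ) :
    ∫ q in Δ, R.L^[n] w q * k q ∂lam = ∫ q in Δ, w q * k q ∂lam := by
  induction n generalizing w with
  | zero => rfl
  | succ n ih =>
    rw [Function.iterate_succ_apply, ih hw.L]
    have h1 : Adm Δ fun q => w q * k q := by
      obtain ⟨C, hC⟩ := hw.2
      obtain ⟨C', hC'⟩ := hka.2
      refine ⟨hw.1.mul hka.1, C * C', fun q hq => ?_⟩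
      rw [abs_mul]
      exact mul_le_mul (hC q hq) (hC' q hq) (abs_nonneg _) ((abs_nonneg _).trans (hC q hq))
    rw [← h1.setIntegral_L (R := R)]
    exact setIntegral_congr_fun R.measurableSet_Δ fun q _ => (R.L_mul_of_invariant hk w q).symm

/-- An invariant function is uncorrelated with Lipschitz functions on `Δ`. -/
theorem setIntegral_mul_of_invariant {k : X → ℝ} (hk : ∀ q, k (S q) = k q) (hka : Adm Δ k)
    {w : X → ℝ} (hm : Measurable w) {C l : ℝ} (hC : ∀ q, |w q| ≤ C) (hl : 0 ≤ l)
    (hw : R.Lip l w) :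
    ∫ q in Δ, w q * k q ∂lam
      = (∫ q in Δ, w q ∂lam) / lam.real Δ * ∫ q in Δ, k q ∂lam := by
  have hκ : 0 < 1 - R.κ := by linarith [R.κ_lt_one]
  have hD := R.D_nonneg
  have hlam := R.measure_pos
  set K := (l + R.D + 1) / (1 - R.κ) with hKdef
  have hK : 0 < K := by positivity
  have hKe : R.κ * K + R.D = K - 1 - l := by
    rw [hKdef]; field_simp; ring
  have hKl : l ≤ K := by
    have := mul_nonneg R.κ_nonneg hK.le
    linarith
  obtain ⟨C₁, r, hC₁, hr, hr1, hcontr⟩ := R.exists_contraction hK (by linarith)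
  obtain ⟨C', hC'⟩ := hka.2
  have hmul : ∀ v, Adm Δ v → IntegrableOn (fun q => v q * k q) Δ lam := by
    intro v hv
    obtain ⟨V, hV⟩ := hv.2
    refine Adm.integrableOn (R := R) ⟨hv.1.mul hka.1, V * C', fun q hq => ?_⟩
    rw [abs_mul]
    exact mul_le_mul (hV q hq) (hC' q hq) (abs_nonneg _) ((abs_nonneg _).trans (hV q hq))
  set M := C + 1 with hMdef
  have hC0 : ∀ q, |w q| + 1 ≤ M := fun q => by linarith [hC q]
  set v : X → ℝ := fun q => w q + M with hv
  have hvC : R.InC K v := by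
    have : R.InC l v := ⟨fun q _ => by
      have := hC0 q
      have := neg_abs_le (w q)
      simp only [hv]; linarith, fun q _ q' _ => hw.exp_le hl hC0 q q'⟩
    exact this.mono hKl
  have hva : Adm Δ v := ⟨hm.add_const M, hvC.bounded hK.le⟩
  set a := (∫ q in Δ, v q ∂lam) / lam.real Δ with ha
  have ha0 : 0 ≤ a := div_nonneg (setIntegral_nonneg R.measurableSet_Δ hvC.1) hlam.le
  have haC := R.inC_const hK.le ha0
  have haa : Adm Δ fun _ => a := adm_const a
  have hab : ∀ n : ℕ, ∀ q ∈ Δ, |R.L^[n] v q - R.L^[n] (fun _ => a) q|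
      ≤ C₁ * r ^ n * ∫ q in Δ, v q ∂lam := fun n =>
    hcontr n _ _ hva.1 haa.1 hvC haC (by rw [setIntegral_const, smul_eq_mul, ha]; field_simp)
  have hdiff : ∀ n : ℕ, |∫ q in Δ, v q * k q ∂lam - ∫ q in Δ, a * k q ∂lam|
      ≤ C₁ * r ^ n * (∫ q in Δ, v q ∂lam) * C' * lam.real Δ := by
    intro n
    rw [← setIntegral_iterate_mul hk hka hva n, ← setIntegral_iterate_mul hk hka haa n,
      ← integral_sub (hmul _ (adm_iterate_L hva n)) (hmul _ (adm_iterate_L haa n))]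
    refine norm_setIntegral_le_of_norm_le_const (measure_lt_top lam Δ)
      (C := C₁ * r ^ n * (∫ q in Δ, v q ∂lam) * C')
      (f := fun q => R.L^[n] v q * k q - R.L^[n] (fun _ => a) q * k q) fun q hq => ?_
    rw [← sub_mul, norm_mul]
    exact mul_le_mul (hab n q hq) (hC' q hq) (abs_nonneg _)
      ((abs_nonneg _).trans (hab n q hq))
  have hz : Tendsto (fun n : ℕ => C₁ * r ^ n * (∫ q in Δ, v q ∂lam) * C' * lam.real Δ) atTop
      (𝓝 0) := by
    have := ((((tendsto_pow_atTop_nhds_zero_of_lt_one hr hr1).const_mul C₁).mul_const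
      (∫ q in Δ, v q ∂lam)).mul_const C').mul_const (lam.real Δ)
    simpa using this
  have heq : ∫ q in Δ, v q * k q ∂lam = ∫ q in Δ, a * k q ∂lam := by
    have := ge_of_tendsto' hz hdiff
    exact sub_eq_zero.1 (abs_eq_zero.1 (le_antisymm this (abs_nonneg _)))
  have hwa : Adm Δ w := ⟨hm, C, fun q _ => hC q⟩
  have hvint : ∫ q in Δ, v q ∂lam = ∫ q in Δ, w q ∂lam + M * lam.real Δ := by
    rw [hv, integral_add (Adm.integrableOn (R := R) hwa) (integrable_const _), setIntegral_const,
      smul_eq_mul, mul_comm M]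
  rw [integral_const_mul, ha, hvint, hv] at heq
  simp only [add_mul] at heq
  rw [integral_add (hmul _ hwa) ((Adm.integrableOn (R := R) hka).const_mul _),
    integral_const_mul, add_div, mul_div_assoc, div_self hlam.ne'] at heq
  linarith

/-- Lipschitz functions separate points of `L¹(Δ)`. -/
def Separating (R : FirstReturnSystem lam S Δ) : Prop :=
  ∀ g : X → ℝ, Measurable g → (∃ C, ∀ q, |g q| ≤ C) →
    (∀ w : X → ℝ, Measurable w → (∃ C, ∀ q, |w q| ≤ C) → (∃ l, 0 ≤ l ∧ R.Lip l w) →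
      ∫ q in Δ, w q * g q ∂lam = 0) → ∀ᵐ q ∂lam.restrict Δ, g q = 0

theorem measure_eq_zero_of_invariant (hsep : R.Separating) {s : Set X} (hs : MeasurableSet s)
    (hSs : S ⁻¹' s = s) : lam s = 0 ∨ lam sᶜ = 0 := by
  have hkey : ∀ s : Set X, MeasurableSet s → S ⁻¹' s = s →
      (∀ᵐ q ∂lam.restrict Δ, q ∉ s) → lam s = 0 := by
    intro s hs hSs h
    have hk : ∀ q, s.indicator (1 : X → ℝ) (S q) = s.indicator 1 q := fun q => by
      conv_rhs => rw [← hSs]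
      rfl
    have hg : R.Good (fun q => 1 * s.indicator (1 : X → ℝ) q) :=
      good_of_bounded (measurable_const.mul (measurable_one.indicator hs)) (C := 1) fun q => by
        by_cases hq : q ∈ s <;> simp [hq]
    have h1 := hg.setIntegral_U
    have h2 : R.U (fun q => 1 * s.indicator (1 : X → ℝ) q)
        = fun q => R.U (fun _ => 1) q * s.indicator 1 q :=
      funext fun q => R.U_mul_of_invariant hk _ q
    rw [h2] at h1
    simp only [one_mul] at h1
    rw [integral_indicator_one hs, integral_eq_zero_of_ae] at h1
    · exact (measureReal_eq_zero_iff (measure_ne_top _ _)).1 h1.symm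
    · filter_upwards [h] with q hq
      simp [indicator_of_notMem hq]
  set k : X → ℝ := s.indicator 1 with hkdef
  have hk : ∀ q, k (S q) = k q := fun q => by
    rw [hkdef]
    conv_rhs => rw [← hSs]
    rfl
  have hk1 : ∀ q, |k q| ≤ 1 := fun q => by by_cases hq : q ∈ s <;> simp [hkdef, hq]
  have hkm : Measurable k := measurable_one.indicator hs
  have hka : Adm Δ k := ⟨hkm, 1, fun q _ => hk1 q⟩
  set a := (∫ q in Δ, k q ∂lam) / lam.real Δ with ha
  have hae := hsep (fun q => k q - a) (hkm.sub_const a) ⟨1 + |a|, fun q =>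
    (abs_sub _ _).trans (by linarith [hk1 q])⟩ (by
    rintro w hm ⟨C, hC⟩ ⟨l, hl, hw⟩
    have h1 := setIntegral_mul_of_invariant hk hka hm hC hl hw
    have hwa : Adm Δ w := ⟨hm, C, fun q _ => hC q⟩
    have hwi := Adm.integrableOn (R := R) hwa
    simp only [mul_sub]
    rw [integral_sub (hwi.mul_bdd (c := 1) hkm.aestronglyMeasurable (ae_of_all _ hk1))
      (hwi.mul_const a), h1, integral_mul_const, ha]
    ring)
  by_cases ha0 : a = 0
  · left
    refine hkey s hs hSs ?_
    filter_upwards [hae] with q hq hqs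
    simp [hkdef, hqs, ha0] at hq
  · right
    refine hkey sᶜ hs.compl (by rw [preimage_compl, hSs]) ?_
    filter_upwards [hae] with q hq hqs
    have : q ∉ s := hqs
    simp only [hkdef, indicator_of_notMem this, zero_sub, neg_eq_zero] at hq
    exact ha0 hq

end FirstReturnSystem

namespace FirstReturnSystem

variable {X : Type*} [MeasurableSpace X] {lam : Measure X} {S : X → X} {Δ : Set X}
  (R : FirstReturnSystem lam S Δ)

/-- The transfer operator of `S`. -/
def P (g : X → ℝ) (q : X) : ℝ := R.A.op g q + R.B.op g q

theorem P_mul_comp (g k : X → ℝ) (q : X) : R.P (fun x => g x * k (S x)) q = R.P g q * k q := by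
  rw [P, R.A.op_mul_comp, R.B.op_mul_comp, P, add_mul]

theorem P_sub (g k : X → ℝ) (q : X) : R.P (fun x => g x - k x) q = R.P g q - R.P k q := by
  rw [P, R.A.op_sub, R.B.op_sub, P, P]; ring

theorem P_const_mul (a : ℝ) (g : X → ℝ) (q : X) : R.P (fun x => a * g x) q = a * R.P g q := by
  rw [P, R.A.op_const_mul, R.B.op_const_mul, P]; ring

theorem abs_P_le {g k : X → ℝ} (h : ∀ x, |g x| ≤ k x) (q : X) : |R.P g q| ≤ R.P k q :=
  (abs_add_le _ _).trans (add_le_add (R.A.abs_op_le (fun x _ => h x) q)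
    (R.B.abs_op_le (fun x _ => h x) q))

theorem measurable_P {g : X → ℝ} (hg : Measurable g) : Measurable (R.P g) :=
  (R.A.measurable_op hg).add (R.B.measurable_op hg)

theorem integral_P {g : X → ℝ} (hg : Measurable g) (hi : Integrable g lam) :
    ∫ q, R.P g q ∂lam = ∫ q, g q ∂lam := by
  simp only [P]
  rw [integral_add (R.A.integrable_op hg hi.integrableOn) (R.B.integrable_op hg hi.integrableOn),
    R.A.integral_op hg hi.integrableOn, R.B.integral_op hg hi.integrableOn, add_comm,
    integral_add_compl R.measurableSet_Δ hi]

theorem integral_mul_comp {g k : X → ℝ} (hg : Measurable g) (hk : Measurable k)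
    (hi : Integrable (fun x => g x * k (S x)) lam) :
    ∫ q, g q * k (S q) ∂lam = ∫ q, R.P g q * k q ∂lam := by
  have h := R.integral_P (hg.mul (hk.comp R.measurable_S)) hi
  refine h.symm.trans (integral_congr_ae (ae_of_all _ fun q => ?_))
  exact R.P_mul_comp g k q

/-- An invariant density of controlled distortion, bounded below. -/
structure IsDensity [IsFiniteMeasure lam] (ρ : X → ℝ) (K ε : ℝ) : Prop where
  K_nonneg : 0 ≤ K
  ε_pos : 0 < ε
  good : R.Good ρ
  inE : R.InE K ρ
  le : ∀ q, ε ≤ ρ q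
  L_eq : ∀ q, R.L ρ q = ρ q

variable [IsFiniteMeasure lam]

theorem exists_isDensity : ∃ ρ K ε, R.IsDensity ρ K ε := by
  obtain ⟨h, K, ε, hK, hε, hm, hC, hle, hL⟩ := R.exists_invariant_density
  have ha : Adm Δ h := ⟨hm, hC.bounded hK⟩
  have hB : R.B.op (R.L h) = R.B.op h := R.B.op_congr hL
  have hE := hC.B hK
  obtain ⟨q₀, -⟩ := R.nonempty_Δ
  have hLE : R.InE (R.κ * K) (R.L h) :=
    hE.U (mul_nonneg R.κ_nonneg hK) ha.good_B
  refine ⟨R.L h, R.κ * K, ε * R.B.op (fun _ => 1) q₀, mul_nonneg R.κ_nonneg hK,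
    mul_pos hε (R.B_one_pos q₀), ⟨ha.L.1, ?_⟩, hLE, fun q => ?_, fun q => ?_⟩
  · obtain ⟨C, hC'⟩ := R.B_bounded ha
    refine ⟨C, fun q => ?_⟩
    have := (good_of_bounded (R := R) (measurable_const (a := C)) (fun _ => le_rfl)).abs_U_le hC' q
    have h2 := R.U_const_mul C (fun _ => 1) q
    simp only [mul_one] at h2
    rw [h2] at this
    exact this
  · have h1 : R.B.op h q ≤ R.L h q := by
      rw [FirstReturnSystem.L, (ha.good_B).U_eq]
      exact le_add_of_nonneg_right (R.A.op_nonneg (fun x _ => hLE.1 x) q)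
    refine le_trans ?_ h1
    rw [← R.B_one_const q q₀, ← R.B.op_const_mul]
    exact R.B.op_mono (fun x hx => by simpa using hle x hx) q
  · change R.U (R.B.op (R.L h)) q = R.L h q
    rw [hB]
    rfl

variable {R}

namespace IsDensity

variable {ρ : X → ℝ} {K ε : ℝ} (hρ : R.IsDensity ρ K ε)
include hρ

theorem pos (q : X) : 0 < ρ q := hρ.ε_pos.trans_le (hρ.le q)

theorem integrable : Integrable ρ lam := hρ.good.integrable

theorem adm : Adm Δ ρ := by
  have h := (hρ.inE.inC).bounded (add_nonneg hρ.K_nonneg R.D_nonneg)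
  exact ⟨hρ.good.1, h⟩

theorem P_eq (q : X) : R.P ρ q = ρ q := by
  have h := ((hρ.adm).good_B (R := R)).U_eq q
  have h1 : R.U (R.B.op ρ) = ρ := funext hρ.L_eq
  rw [h1] at h
  rw [P, h, add_comm]

theorem integrable_mul {g : X → ℝ} (hg : Measurable g) {C : ℝ} (hC : ∀ q, |g q| ≤ C) :
    Integrable (fun q => ρ q * g q) lam :=
  hρ.integrable.mul_bdd (c := C) hg.aestronglyMeasurable (ae_of_all _ hC)

theorem integral_pos : 0 < ∫ q, ρ q ∂lam := by
  have h := R.measure_pos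
  refine (integral_pos_iff_support_of_nonneg (fun q => (hρ.pos q).le) hρ.integrable).2 ?_
  have : Function.support ρ = univ := eq_univ_of_forall fun q => (hρ.pos q).ne'
  rw [this]
  exact (R.measure_Δ_ne_zero.bot_lt).trans_le (measure_mono (subset_univ _))

theorem good_P {g : X → ℝ} (hg : Measurable g) {C : ℝ} (hC : ∀ q, |g q| ≤ C) :
    R.Good (R.P fun q => ρ q * g q) := by
  refine ⟨R.measurable_P (hρ.good.1.mul hg), ?_⟩
  obtain ⟨C', hC'⟩ := hρ.good.2
  have hC0 : 0 ≤ C := by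
    obtain ⟨q, -⟩ := R.nonempty_Δ
    exact (abs_nonneg _).trans (hC q)
  refine ⟨C * C', fun q => ?_⟩
  have h1 : |R.P (fun q => ρ q * g q) q| ≤ R.P (fun q => C * ρ q) q := by
    refine R.abs_P_le (fun x => ?_) q
    rw [abs_mul, abs_of_pos (hρ.pos x), mul_comm]
    exact mul_le_mul_of_nonneg_right (hC x) (hρ.pos x).le
  rw [R.P_const_mul, hρ.P_eq] at h1
  refine h1.trans ?_
  rw [mul_assoc]
  exact mul_le_mul_of_nonneg_left ((le_abs_self _).trans (hC' q)) hC0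

/-- Any absolutely continuous invariant probability measure has density proportional to `ρ`. -/
theorem ergodic_and_eq (hsep : R.Separating) {ν : Measure X} [IsProbabilityMeasure ν]
    (hν : MeasurePreserving S ν ν) (hac : ν ≪ lam) :
    Ergodic S ν ∧ ∀ g : X → ℝ, Measurable g →
      ∫ q, g q ∂ν = (∫ q, ρ q ∂lam)⁻¹ * ∫ q, ρ q * g q ∂lam := by
  set Z := ∫ q, ρ q ∂lam with hZ
  have hZ0 : 0 < Z := hρ.integral_pos
  have hm := hρ.good.1
  set μ := lam.withDensity fun q => ENNReal.ofReal (Z⁻¹ * ρ q) with hμ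
  have hi : Integrable (fun q => Z⁻¹ * ρ q) lam := hρ.integrable.const_mul _
  have hpos : ∀ q, 0 ≤ Z⁻¹ * ρ q := fun q => mul_nonneg (inv_nonneg.2 hZ0.le) (hρ.pos q).le
  have hset : ∀ s, MeasurableSet s →
      μ s = ENNReal.ofReal (∫ q, Z⁻¹ * ρ q * s.indicator 1 q ∂lam) := by
    intro s hs
    rw [hμ, withDensity_apply _ hs, ← ofReal_integral_eq_lintegral_ofReal hi.integrableOn
      (ae_of_all _ hpos), ← integral_indicator hs]
    congr 2
    funext q
    by_cases hq : q ∈ s <;> simp [hq]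
  have hμp : IsProbabilityMeasure μ := ⟨by
    rw [hset _ MeasurableSet.univ]
    simp only [indicator_univ, Pi.one_apply, mul_one]
    rw [integral_const_mul, ← hZ, inv_mul_cancel₀ hZ0.ne', ENNReal.ofReal_one]⟩
  have hμinv : MeasurePreserving S μ μ := by
    refine ⟨R.measurable_S, Measure.ext fun s hs => ?_⟩
    rw [Measure.map_apply R.measurable_S hs, hset _ (R.measurable_S hs), hset _ hs]
    congr 1
    have h1 := R.integral_mul_comp (g := ρ) (k := fun q => Z⁻¹ * s.indicator 1 q) hm
      ((measurable_one.indicator hs).const_mul _)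
      (hρ.integrable_mul (((measurable_one.indicator hs).const_mul _).comp R.measurable_S)
        (C := Z⁻¹) fun q => by
          by_cases hq : S q ∈ s <;> simp [hq, abs_of_pos hZ0, hZ0.le])
    simp only [hρ.P_eq] at h1
    calc _ = ∫ q, ρ q * (Z⁻¹ * s.indicator 1 (S q)) ∂lam := by
          congr 1; funext q
          rw [show (S ⁻¹' s).indicator (1 : X → ℝ) q = s.indicator 1 (S q) from rfl]; ring
      _ = _ := h1
      _ = _ := by congr 1; funext q; ring
  have hμac : μ ≪ lam := withDensity_absolutelyContinuous _ _
  have hacμ : ν ≪ μ := by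
    refine hac.trans (withDensity_absolutelyContinuous' (by fun_prop) (ae_of_all _ fun q => ?_))
    simp only [ne_eq, ENNReal.ofReal_eq_zero, not_le]
    exact mul_pos (inv_pos.2 hZ0) (hρ.pos q)
  have hμerg : Ergodic S μ := by
    refine ⟨hμinv, ⟨fun s hs hSs => ?_⟩⟩
    rw [eventuallyConst_set']
    rcases R.measure_eq_zero_of_invariant hsep hs hSs with h | h
    · exact Or.inl (ae_eq_empty.2 (hμac h))
    · exact Or.inr (ae_eq_univ.2 (hμac h))
  have heq := Ergodic.eq_of_absolutelyContinuous hμerg hν hacμ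
  refine ⟨heq ▸ hμerg, fun g hg => ?_⟩
  rw [heq, hμ, integral_withDensity_eq_integral_toReal_smul (by fun_prop) (by simp),
    ← integral_const_mul]
  congr 1
  funext q
  rw [ENNReal.toReal_ofReal (hpos q), smul_eq_mul, mul_assoc]

end IsDensity

end FirstReturnSystem

namespace InverseBranches

variable {X : Type*} [MeasurableSpace X] {lam : Measure X} {S : X → X} {E : Set X}
  (T : InverseBranches lam S E)

theorem tendsto_op {w : ℕ → X → ℝ} {v : X → ℝ}
    (h : ∀ q ∈ E, Tendsto (fun j => w j q) atTop (𝓝 (v q))) (q : X) :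
    Tendsto (fun j => T.op (w j) q) atTop (𝓝 (T.op v q)) :=
  tendsto_finsetSum _ fun i _ => (h _ (T.θ_mem i q)).const_mul _

theorem tendsto_iterate_op {w : ℕ → X → ℝ} {v : X → ℝ}
    (h : ∀ q, Tendsto (fun j => w j q) atTop (𝓝 (v q))) (n : ℕ) (q : X) :
    Tendsto (fun j => T.op^[n] (w j) q) atTop (𝓝 (T.op^[n] v q)) := by
  induction n generalizing w v with
  | zero => exact h q
  | succ n ih => exact ih fun q => T.tendsto_op (fun x _ => h x) q

end InverseBranches

namespace FirstReturnSystem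

variable {X : Type*} [MeasurableSpace X] {lam : Measure X} {S : X → X} {Δ : Set X}
  (R : FirstReturnSystem lam S Δ)

/-- The Birkhoff sum of `f` along the excursion up to the entrance into `Δ`. -/
def W (f : X → ℝ) (q : X) : ℝ := birkhoffSum S f (R.H q) q

theorem measurable_W {f : X → ℝ} (hf : Measurable f) : Measurable (R.W f) := by
  have h : Measurable fun p : X × ℕ => birkhoffSum S f p.2 p.1 :=
    measurable_from_prod_countable_left fun n => measurable_birkhoffSum R.measurable_S hf n
  exact h.comp (measurable_id.prodMk R.measurable_H)

theorem W_of_notMem (f : X → ℝ) {q : X} (hq : q ∉ Δ) : R.W f q = f q + R.W f (S q) := by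
  rw [W, R.H_of_notMem q hq, birkhoffSum_succ', W]

theorem abs_W_le {f : X → ℝ} {F : ℝ} (hF : ∀ q, |f q| ≤ F) (q : X) : |R.W f q| ≤ F * R.H q := by
  rw [W, birkhoffSum]
  refine (Finset.abs_sum_le_sum_abs _ _).trans ?_
  refine (Finset.sum_le_card_nsmul _ _ F fun k _ => hF _).trans (le_of_eq ?_)
  rw [Finset.card_range, nsmul_eq_mul, mul_comm]

theorem iterate_mul_H (g : X → ℝ) (a : ℝ) (n : ℕ) (q : X) :
    R.A.op^[n] (fun q => g q * (R.H q + a)) q = R.A.op^[n] g q * (R.H q + (n + a)) := by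
  induction n generalizing g a with
  | zero => simp
  | succ n ih =>
    rw [Function.iterate_succ_apply, Function.iterate_succ_apply]
    have h : R.A.op (fun q => g q * (R.H q + a)) = fun q => R.A.op g q * (R.H q + (a + 1)) := by
      funext q
      rw [← R.A.op_mul_comp g fun x => R.H x + (a + 1)]
      refine congrFun (R.A.op_congr fun x hx => ?_) q
      rw [R.H_of_notMem x hx]
      push_cast
      ring
    rw [h, ih]
    push_cast
    ring

variable [IsFiniteMeasure lam]

theorem tendsto_iterate_u₁_mul_H (q : X) :
    Tendsto (fun N : ℕ => R.A.op^[N] R.u₁ q * (R.H q + N)) atTop (𝓝 0) := by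
  have hs := R.summable_iterate_one q
  have hs' := R.summable_mul_iterate_one q
  have h0 : ∀ n, 0 ≤ R.A.op^[n] (fun _ => 1) q :=
    fun n => R.A.iterate_op_nonneg (fun _ => zero_le_one) n q
  have h1 : ∀ N : ℕ, R.A.op^[N] R.u₁ q = ∑' k, R.A.op^[k + N] (fun _ => 1) q := by
    intro N
    have : ∑ k ∈ Finset.range N, R.A.op^[k] (fun _ => 1) q + R.A.op^[N] R.u₁ q = R.u₁ q := by
      induction N with
      | zero => simp
      | succ N ih =>
        rw [← ih, Finset.sum_range_succ, add_assoc, Function.iterate_succ_apply,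
          ← R.A.iterate_op_add]
        have : R.u₁ = fun x => 1 + R.A.op R.u₁ x :=
          funext fun x => R.U_eq_of_summable R.summable_iterate_one x
        rw [← this]
    have h2 := hs.sum_add_tsum_nat_add N
    have h3 : R.u₁ q = ∑' i, R.A.op^[i] (fun _ => 1) q := rfl
    linarith
  have h2 := (tendsto_sum_nat_add fun n : ℕ => ((n : ℝ) + 1) * R.A.op^[n] (fun _ => 1) q).const_mul
    ((R.H q : ℝ) + 1)
  rw [mul_zero] at h2
  have hH : (0 : ℝ) ≤ R.H q := Nat.cast_nonneg _
  refine squeeze_zero (fun N => ?_) (fun N => ?_) h2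
  · exact mul_nonneg (R.A.iterate_op_nonneg R.inE_u₁.1 N q) (by positivity)
  · rw [h1, ← tsum_mul_right, ← tsum_mul_left]
    refine Summable.tsum_le_tsum (fun k => ?_) (((summable_nat_add_iff N).2 hs).mul_right _)
      (((summable_nat_add_iff N).2 hs').mul_left _)
    rw [mul_comm, ← mul_assoc]
    refine mul_le_mul_of_nonneg_right ?_ (h0 _)
    have hk : (0 : ℝ) ≤ k := Nat.cast_nonneg _
    have hN : (0 : ℝ) ≤ N := Nat.cast_nonneg _
    push_cast
    nlinarith [mul_nonneg hH hN, mul_nonneg hH hk]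

/-- Excursion sums of functions growing at most linearly in the next excursion time. -/
theorem exists_summable_bound (C : ℝ) (q : X) : ∃ b : ℕ → ℝ, Summable b ∧
    ∀ v : X → ℝ, (∀ x ∈ Δ, |v x| ≤ C * (R.H (S x) + 1)) →
      ∀ n, |R.A.op^[n] (R.B.op v) q| ≤ b n := by
  refine ⟨fun n => |C| * R.B.op (fun _ => 1) q * (R.H q + 1) *
    (((n : ℝ) + 1) * R.A.op^[n] (fun _ => 1) q),
    (R.summable_mul_iterate_one q).mul_left _, fun v hv n => ?_⟩
  have h1 : ∀ x, |R.B.op v x| ≤ (C * R.B.op (fun _ => 1) q) * (1 * (R.H x + 1)) := by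
    intro x
    refine (R.B.abs_op_le hv x).trans (le_of_eq ?_)
    rw [R.B_one_const q x, R.B.op_const_mul, mul_assoc, one_mul,
      ← R.B.op_mul_comp (fun _ => 1) fun x => R.H x + 1]
    simp only [one_mul]
  refine (R.A.abs_iterate_op_le h1 n q).trans ?_
  rw [R.A.iterate_op_const_mul, R.iterate_mul_H]
  have h2 := R.A.iterate_op_nonneg (g := fun _ => 1) (fun _ => zero_le_one) n q
  have h3 := (R.B_one_pos q).le
  have hH : (0 : ℝ) ≤ R.H q := Nat.cast_nonneg _
  have hn : (0 : ℝ) ≤ n := Nat.cast_nonneg _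
  calc _ = C * (R.B.op (fun _ => 1) q * R.A.op^[n] (fun _ => 1) q * (R.H q + (n + 1))) := by ring
    _ ≤ |C| * (R.B.op (fun _ => 1) q * R.A.op^[n] (fun _ => 1) q * ((R.H q + 1) * (n + 1))) := by
        have h4 : (R.H q : ℝ) + (n + 1) ≤ (R.H q + 1) * (n + 1) := by nlinarith
        have h5 := le_abs_self C
        gcongr
    _ = _ := by ring

omit [IsFiniteMeasure lam] in
theorem integrableOn_W_comp {f : X → ℝ} (hf : Measurable f)
    (hW : Integrable (fun q => R.W f q ^ 2) lam) :
    IntegrableOn (fun q => R.W f (S q) ^ 2) Δ lam := by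
  have hm := R.measurable_W hf
  have hm' : Measurable fun q => R.W f (S q) ^ 2 := (hm.comp R.measurable_S).pow_const 2
  refine ⟨hm'.aestronglyMeasurable, ?_⟩
  obtain ⟨q₀, -⟩ := R.nonempty_Δ
  rw [hasFiniteIntegral_iff_ofReal (ae_of_all _ fun q => sq_nonneg _),
    ← R.B.lintegral_op hm' fun q => sq_nonneg _]
  have h1 : ∀ q, R.B.op (fun q => R.W f (S q) ^ 2) q
      = R.B.op (fun _ => 1) q₀ * R.W f q ^ 2 := by
    intro q
    rw [R.B_one_const q₀ q, ← R.B.op_mul_comp (fun _ => 1) fun x => R.W f x ^ 2]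
    simp only [one_mul]
  simp only [h1]
  have := (hW.const_mul (R.B.op (fun _ => 1) q₀)).2
  rwa [hasFiniteIntegral_iff_ofReal (ae_of_all _ fun q =>
    mul_nonneg (R.B_one_pos q₀).le (sq_nonneg _))] at this

variable {R}

namespace IsDensity

variable {ρ : X → ℝ} {K ε : ℝ} (hρ : R.IsDensity ρ K ε)
include hρ

/-- Solution of the Poisson equation for the first return transfer operator. -/
theorem exists_poisson {f : X → ℝ} (hf : Measurable f) {F l : ℝ} (hF : ∀ q, |f q| ≤ F)
    (hl : 0 ≤ l) (hlip : R.Lip l f) (h0 : ∫ q, ρ q * f q ∂lam = 0) :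
    ∃ g, Adm Δ g ∧ ∀ q ∈ Δ, g q = R.U (R.P fun q => ρ q * f q) q + R.L g q := by
  have hκ : 0 < 1 - R.κ := by linarith [R.κ_lt_one]
  have hD := R.D_nonneg
  have hK := hρ.K_nonneg
  set K' := (K + l + R.D + 1) / (1 - R.κ) with hKdef
  have hK' : 0 < K' := by positivity
  have hKe : R.κ * K' + R.D = K' - 1 - l - K := by
    rw [hKdef]; field_simp; ring
  have hKl : K + l + R.D ≤ K' := by
    have := mul_nonneg R.κ_nonneg hK'.le
    linarith
  obtain ⟨C, r, hC, hr, hr1, hcontr⟩ := R.exists_contraction hK' (by linarith)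
  obtain ⟨M, hM⟩ : ∃ M, M = F + 1 := ⟨_, rfl⟩
  have hF0 : 0 ≤ F := by
    obtain ⟨q, -⟩ := R.nonempty_Δ
    exact (abs_nonneg _).trans (hF q)
  have cone : ∀ k : X → ℝ, Measurable k → (∀ q, |k q| ≤ F + M) → (∀ q, 0 ≤ k q) →
      (∀ q q', k q ≤ Real.exp (l * R.d q q') * k q') →
      R.Good (R.P fun q => ρ q * k q) ∧ R.InC K' (R.U (R.P fun q => ρ q * k q)) := by
    intro k hkm hkb hk0 hke
    have hg := hρ.good_P hkm hkb
    refine ⟨hg, ?_⟩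
    have hE : R.InE (K + l) fun q => ρ q * k q := by
      refine ⟨fun q => mul_nonneg (hρ.pos q).le (hk0 q), fun q q' => ?_⟩
      calc ρ q * k q ≤ (Real.exp (K * R.d q q') * R.c q q' * ρ q')
            * (Real.exp (l * R.d q q') * k q') :=
            mul_le_mul (hρ.inE.2 q q') (hke q q') (hk0 q)
              (mul_nonneg (mul_nonneg (Real.exp_pos _).le (R.c_pos q q').le) (hρ.pos q').le)
        _ = _ := by rw [add_mul, Real.exp_add]; ring
    have hKl0 := add_nonneg hK hl
    exact (((hE.A hKl0).add (hE.B hKl0)).U hKl0 hg).inC.mono hKl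
  have hfM : ∀ q, |f q + M| ≤ F + M := fun q =>
    (abs_add_le _ _).trans (add_le_add (hF q) (abs_of_nonneg (by linarith)).le)
  have hfM' : ∀ q, |f q| + 1 ≤ M := fun q => by linarith [hF q]
  obtain ⟨g₁, c₁⟩ := cone (fun q => f q + M) (hf.add_const M) hfM
    (fun q => by linarith [neg_abs_le (f q), hfM' q]) (hlip.exp_le hl hfM')
  obtain ⟨g₂, c₂⟩ := cone (fun _ => M) measurable_const
    (fun q => by rw [abs_of_nonneg (by linarith)]; linarith) (fun q => by linarith)
    (fun q q' => le_mul_of_one_le_left (by linarith)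
      (Real.one_le_exp (mul_nonneg hl (R.d_nonneg q q'))))
  have hi₁ := hρ.integrable_mul (hf.add_const M) hfM
  have hi₂ : Integrable (fun q => ρ q * M) lam := hρ.integrable.mul_const M
  have heq : ∫ q in Δ, R.U (R.P fun q => ρ q * (f q + M)) q ∂lam
      = ∫ q in Δ, R.U (R.P fun q => ρ q * M) q ∂lam := by
    rw [g₁.setIntegral_U, g₂.setIntegral_U]
    refine (R.integral_P (hρ.good.1.mul (hf.add_const M)) hi₁).trans
      (Eq.trans ?_ (R.integral_P (hρ.good.1.mul measurable_const) hi₂).symm)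
    simp only [Pi.mul_apply, mul_add]
    rw [integral_add (hρ.integrable_mul hf hF) hi₂, h0, zero_add]
  have hsub : R.U (R.P fun q => ρ q * f q) = fun q =>
      R.U (R.P fun q => ρ q * (f q + M)) q - R.U (R.P fun q => ρ q * M) q := by
    funext q
    rw [← g₁.U_sub g₂]
    congr 1
    funext x
    rw [← R.P_sub]
    congr 1
    funext y
    ring
  obtain ⟨g, hg, hge, -⟩ := exists_neumann_series (R := R)
    (w := R.U (R.P fun q => ρ q * f q)) (hρ.good_P hf hF).adm_U
    (C := C * ∫ q in Δ, R.U (R.P fun q => ρ q * (f q + M)) q ∂lam) hr hr1 (by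
      intro n q hq
      rw [hsub, iterate_L_sub g₁.adm_U g₂.adm_U]
      exact (hcontr n _ _ g₁.adm_U.1 g₂.adm_U.1 c₁ c₂ heq q hq).trans (le_of_eq (by ring)))
  exact ⟨g, hg, hge⟩

/-- The potential of the transferred induced martingale part. -/
theorem hasSum_induced {f g : X → ℝ} (hf : Measurable f) {F : ℝ} (hF : ∀ q, |f q| ≤ F)
    (hg : Adm Δ g) {C : ℝ}
    (hb : ∀ x ∈ Δ, |ρ x * (f x + R.W f (S x)) + g x| ≤ C * (R.H (S x) + 1)) (q : X) :
    HasSum (fun n : ℕ => R.A.op^[n] (R.B.op fun x => ρ x * (f x + R.W f (S x)) + g x) q)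
      (R.U (R.P fun q => ρ q * f q) q + R.L g q + ρ q * R.W f q) := by
  obtain ⟨b, hbs, hbb⟩ := R.exists_summable_bound C q
  have hs : Summable fun n : ℕ =>
      R.A.op^[n] (R.B.op fun x => ρ x * (f x + R.W f (S x)) + g x) q :=
    Summable.of_norm_bounded hbs fun n => hbb _ hb n
  have h1 := ((hρ.good_P hf hF).summable q).hasSum.tendsto_sum_nat
  have h2 := ((hg.good_B (R := R)).summable q).hasSum.tendsto_sum_nat
  have h3 : Tendsto (fun N : ℕ => R.A.op^[N] (fun x => ρ x * R.W f x) q) atTop (𝓝 0) := by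
    obtain ⟨C', hC'⟩ := hρ.good.2
    have h4 := (R.tendsto_iterate_u₁_mul_H q).const_mul (C' * F)
    rw [mul_zero] at h4
    refine squeeze_zero_norm (fun N => ?_) h4
    have h5 : ∀ x, |ρ x * R.W f x| ≤ (C' * F) * (R.u₁ x * (R.H x + 0)) := by
      intro x
      rw [abs_mul, add_zero]
      calc _ ≤ (C' * R.u₁ x) * (F * R.H x) :=
            mul_le_mul (hC' x) (R.abs_W_le hF x) (abs_nonneg _) ((abs_nonneg _).trans (hC' x))
        _ = _ := by ring
    refine (R.A.abs_iterate_op_le h5 N q).trans (le_of_eq ?_)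
    rw [R.A.iterate_op_const_mul, R.iterate_mul_H, add_zero]
  have hop : (R.B.op fun x => ρ x * (f x + R.W f (S x)) + g x) = fun x =>
      (R.P (fun q => ρ q * f q) x + R.B.op g x)
        + (ρ x * R.W f x - R.A.op (fun x => ρ x * R.W f x) x) := by
    funext x
    have e1 : R.B.op (fun x => ρ x * (f x + R.W f (S x)) + g x) x
        = R.B.op (fun x => ρ x * f x) x + R.B.op ρ x * R.W f x + R.B.op g x := by
      rw [R.B.op_add, ← R.B.op_mul_comp]
      simp only [mul_add]
      rw [R.B.op_add]
    have e2 : R.A.op (fun x => ρ x * R.W f x) x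
        = R.A.op (fun x => ρ x * f x) x + R.A.op ρ x * R.W f x := by
      rw [← R.A.op_mul_comp, ← R.A.op_add]
      refine congrFun (R.A.op_congr fun y hy => ?_) x
      rw [R.W_of_notMem f hy, mul_add]
    have e3 := hρ.P_eq x
    rw [P] at e3
    rw [e1, e2, ← e3, P]
    ring
  have hpart : ∀ N : ℕ, ∑ n ∈ Finset.range N,
      R.A.op^[n] (R.B.op fun x => ρ x * (f x + R.W f (S x)) + g x) q
      = ∑ n ∈ Finset.range N, R.A.op^[n] (R.P fun q => ρ q * f q) q
        + ∑ n ∈ Finset.range N, R.A.op^[n] (R.B.op g) q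
        + (ρ q * R.W f q - R.A.op^[N] (fun x => ρ x * R.W f x) q) := by
    intro N
    have h4 : ρ q * R.W f q - R.A.op^[N] (fun x => ρ x * R.W f x) q
        = ∑ n ∈ Finset.range N, (R.A.op^[n] (fun x => ρ x * R.W f x) q
          - R.A.op^[n + 1] (fun x => ρ x * R.W f x) q) := by
      rw [Finset.sum_range_sub' (fun n => R.A.op^[n] (fun x => ρ x * R.W f x) q)]
      rfl
    rw [h4, ← Finset.sum_add_distrib, ← Finset.sum_add_distrib]
    refine Finset.sum_congr rfl fun n _ => ?_
    rw [hop, R.A.iterate_op_add, R.A.iterate_op_add, R.A.iterate_op_sub,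
      Function.iterate_succ_apply]
  have h6 := (h1.add h2).add (h3.const_sub (ρ q * R.W f q))
  have h7 := hs.hasSum.tendsto_sum_nat
  have h8 := h7.congr hpart
  rw [sub_zero] at h6
  have := tendsto_nhds_unique h8 h6
  have h9 := hs.hasSum
  rw [this] at h9
  exact h9

end IsDensity

end FirstReturnSystem

namespace FirstReturnSystem

variable {X : Type*} [MeasurableSpace X] {lam : Measure X} {S : X → X} {Δ : Set X}
  {R : FirstReturnSystem lam S Δ} [IsFiniteMeasure lam]

namespace IsDensity

variable {ρ : X → ℝ} {K ε : ℝ} (hρ : R.IsDensity ρ K ε)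
include hρ

/-- Conditional expectation, `u = P(ρv)/ρ`, of the function `v` equal to a given `m` on `Δ` and
to `u` outside `Δ`. -/
theorem P_extension [DecidablePred (· ∈ Δ)] {m : X → ℝ} (hm : Measurable m) {C : ℝ}
    (hC : ∀ q, |m q| ≤ C) (q : X) :
    R.P (fun q => ρ q * Δ.piecewise m (fun q => R.L (fun x => ρ x * m x) q / ρ q) q) q
      = R.L (fun x => ρ x * m x) q := by
  have ha : Adm Δ fun x => ρ x * m x := by
    obtain ⟨C', hC'⟩ := hρ.adm.2
    refine ⟨hρ.good.1.mul hm, C' * C, fun q hq => ?_⟩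
    rw [abs_mul]
    exact mul_le_mul (hC' q hq) (hC q) (abs_nonneg _) ((abs_nonneg _).trans (hC' q hq))
  have h1 : ∀ x, R.L (fun x => ρ x * m x) x
      = R.B.op (fun x => ρ x * m x) x + R.A.op (R.L fun x => ρ x * m x) x :=
    fun x => (ha.good_B (R := R)).U_eq x
  rw [h1, P, add_comm]
  congr 1
  · refine congrFun (R.B.op_congr fun x hx => ?_) q
    rw [piecewise_eq_of_mem _ _ _ hx]
  · refine congrFun (R.A.op_congr fun x hx => ?_) q
    rw [piecewise_eq_of_notMem _ _ _ hx, mul_div_cancel₀ _ (hρ.pos x).ne']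

theorem abs_L_div_le {m : X → ℝ} {C : ℝ} (hC : ∀ q, |m q| ≤ C) (q : X) :
    |R.L (fun x => ρ x * m x) q / ρ q| ≤ C := by
  rw [abs_div, abs_of_pos (hρ.pos q), div_le_iff₀ (hρ.pos q)]
  have h := (hρ.adm.const_mul C).abs_L_le (R := R) (w := fun x => ρ x * m x) (fun x _ => by
    rw [abs_mul, abs_of_pos (hρ.pos x), mul_comm]
    exact mul_le_mul_of_nonneg_right (hC x) (hρ.pos x).le) q
  rwa [R.L_const_mul, hρ.L_eq] at h

variable {v u : X → ℝ} (hv : Measurable v) (hu : Measurable u) {C : ℝ} (hvC : ∀ q, |v q| ≤ C)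
  (huC : ∀ q, |u q| ≤ C) (hP : ∀ q, R.P (fun x => ρ x * v x) q = ρ q * u q)
include hv hu hvC huC hP

theorem integral_sub_comp_mul_comp {k : X → ℝ} (hk : Measurable k) {C' : ℝ}
    (hkC : ∀ q, |k q| ≤ C') :
    ∫ q, ρ q * ((v q - u (S q)) * k (S q)) ∂lam = 0 := by
  have hkS := hk.comp R.measurable_S
  have huS := hu.comp R.measurable_S
  have bd : ∀ a b : ℝ, |a| ≤ C → |b| ≤ C' → |a * b| ≤ C * C' := fun a b ha hb => by
    rw [abs_mul]
    exact mul_le_mul ha hb (abs_nonneg _) ((abs_nonneg _).trans ha)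
  have i1 : Integrable (fun q => ρ q * (v q * k (S q))) lam :=
    hρ.integrable_mul (hv.mul hkS) fun q => bd _ _ (hvC q) (hkC (S q))
  have i2 : Integrable (fun q => ρ q * (u (S q) * k (S q))) lam :=
    hρ.integrable_mul (huS.mul hkS) fun q => bd _ _ (huC (S q)) (hkC (S q))
  have h1 := R.integral_mul_comp (g := fun q => ρ q * v q) (k := k) (hρ.good.1.mul hv) hk
    (by simpa only [mul_assoc] using i1)
  have h2 := R.integral_mul_comp (g := ρ) (k := fun q => u q * k q) hρ.good.1 (hu.mul hk) i2
  simp only [hP] at h1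
  simp only [hρ.P_eq] at h2
  calc _ = ∫ q, (ρ q * v q * k (S q) - ρ q * (u (S q) * k (S q))) ∂lam := by
        congr 1; funext q; ring
    _ = 0 := by
        rw [integral_sub (by simpa only [mul_assoc] using i1) i2, h1, h2, sub_eq_zero]
        congr 1; funext q; ring

theorem integral_sub_comp_sq :
    ∫ q, ρ q * (v q - u (S q)) ^ 2 ∂lam = ∫ q, ρ q * (v q ^ 2 - u q ^ 2) ∂lam := by
  have huS := hu.comp R.measurable_S
  have bd : ∀ a b : ℝ, |a| ≤ C → |b| ≤ C → |a * b| ≤ C * C := fun a b ha hb => by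
    rw [abs_mul]
    exact mul_le_mul ha hb (abs_nonneg _) ((abs_nonneg _).trans ha)
  have h1 := hρ.integral_sub_comp_mul_comp hv hu hvC huC hP hu huC
  have i1 : Integrable (fun q => ρ q * (v q * v q)) lam :=
    hρ.integrable_mul (hv.mul hv) fun q => bd _ _ (hvC q) (hvC q)
  have i2 : Integrable (fun q => ρ q * (v q * u (S q))) lam :=
    hρ.integrable_mul (hv.mul huS) fun q => bd _ _ (hvC q) (huC (S q))
  have i3 : Integrable (fun q => ρ q * (u (S q) * u (S q))) lam :=
    hρ.integrable_mul (huS.mul huS) fun q => bd _ _ (huC (S q)) (huC (S q))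
  have i4 : Integrable (fun q => ρ q * (u q * u q)) lam :=
    hρ.integrable_mul (hu.mul hu) fun q => bd _ _ (huC q) (huC q)
  have h2 := R.integral_mul_comp (g := ρ) (k := fun q => u q * u q) hρ.good.1 (hu.mul hu) i3
  simp only [hρ.P_eq] at h2
  have e1 : ∫ q, ρ q * (v q - u (S q)) ^ 2 ∂lam
      = ∫ q, ((ρ q * (v q * v q) - ρ q * (u (S q) * u (S q)))
        - 2 * (ρ q * ((v q - u (S q)) * u (S q)))) ∂lam := by
    congr 1; funext q; ring
  have i5 : Integrable (fun q => ρ q * ((v q - u (S q)) * u (S q))) lam :=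
    (i2.sub i3).congr (ae_of_all _ fun q => by simp only [Pi.sub_apply]; ring)
  have i6 : Integrable (fun q => ρ q * (v q * v q) - ρ q * (u (S q) * u (S q))) lam := i1.sub i3
  rw [e1, integral_sub i6 (i5.const_mul 2), integral_const_mul, h1, mul_zero, sub_zero,
    integral_sub i1 i3, h2, ← integral_sub i1 i4]
  congr 1; funext q; ring

end IsDensity

/-- Truncation at level `j`. -/
def trunc (m : X → ℝ) (j : ℕ) (q : X) : ℝ := {q | |m q| ≤ j}.indicator m q

omit [MeasurableSpace X] in
theorem abs_trunc_le (m : X → ℝ) (j : ℕ) (q : X) : |trunc m j q| ≤ j := by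
  unfold trunc
  by_cases h : |m q| ≤ j
  · rwa [indicator_of_mem (by exact h)]
  · rw [indicator_of_notMem (by exact h), abs_zero]
    exact Nat.cast_nonneg j

omit [MeasurableSpace X] in
theorem abs_trunc_le_abs (m : X → ℝ) (j : ℕ) (q : X) : |trunc m j q| ≤ |m q| := by
  unfold trunc
  by_cases h : |m q| ≤ j
  · rw [indicator_of_mem (by exact h)]
  · rw [indicator_of_notMem (by exact h), abs_zero]
    exact abs_nonneg _

theorem measurable_trunc {m : X → ℝ} (hm : Measurable m) (j : ℕ) : Measurable (trunc m j) :=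
  hm.indicator (measurableSet_le hm.abs measurable_const)

omit [MeasurableSpace X] in
theorem tendsto_trunc (m : X → ℝ) (q : X) :
    Tendsto (fun j => trunc m j q) atTop (𝓝 (m q)) := by
  obtain ⟨N, hN⟩ := exists_nat_ge |m q|
  refine tendsto_const_nhds.congr' ?_
  filter_upwards [eventually_ge_atTop N] with j hj
  rw [trunc, indicator_of_mem]
  exact hN.trans (Nat.cast_le.2 hj)

omit [MeasurableSpace X] in
theorem sq_trunc_sub_le (m : X → ℝ) {k j : ℕ} (hkj : k ≤ j) (q : X) :
    (trunc m j q - trunc m k q) ^ 2 ≤ (m q - trunc m k q) ^ 2 := by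
  by_cases h : |m q| ≤ k
  · have h' : |m q| ≤ j := h.trans (Nat.cast_le.2 hkj)
    rw [trunc, indicator_of_mem (s := {q | |m q| ≤ (j : ℝ)}) (by exact h')]
  · have hk : trunc m k q = 0 := indicator_of_notMem (by exact h) _
    rw [hk, sub_zero, sub_zero, ← sq_abs, ← sq_abs (m q)]
    exact pow_le_pow_left₀ (abs_nonneg _) (abs_trunc_le_abs m j q) 2

/-- Central limit theorem for maps with a uniformly expanding first return, for observables whose
excursion sums are square integrable. -/
theorem clt (hsep : R.Separating) {ν : Measure X} [IsProbabilityMeasure ν]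
    (hν : MeasurePreserving S ν ν) (hac : ν ≪ lam) {f : X → ℝ} (hf : Measurable f) {F l : ℝ}
    (hF : ∀ q, |f q| ≤ F) (hl : 0 ≤ l) (hlip : R.Lip l f) (h0 : ∫ q, f q ∂ν = 0)
    (hW : Integrable (fun q => R.W f q ^ 2) lam) :
    ∃ σ2 : NNReal, ∀ φ : BoundedContinuousFunction ℝ ℝ,
      Tendsto (fun n : ℕ => ∫ x, φ (birkhoffSum S f n x / √n) ∂ν) atTop
        (𝓝 (∫ x, φ x ∂(ProbabilityTheory.gaussianReal 0 σ2))) := by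
  classical
  obtain ⟨ρ, K, ε, hρ⟩ := R.exists_isDensity
  obtain ⟨herg, hi0⟩ := hρ.ergodic_and_eq hsep hν hac
  set Z := ∫ q, ρ q ∂lam with hZ
  have hZ0 : 0 < Z := hρ.integral_pos
  have hρm := hρ.good.1
  have hf0 : ∫ q, ρ q * f q ∂lam = 0 := by
    rw [hi0 f hf] at h0
    exact (mul_eq_zero.1 h0).resolve_left (inv_ne_zero hZ0.ne')
  obtain ⟨g, hg, hge⟩ := hρ.exists_poisson hf hF hl hlip hf0
  obtain ⟨Cρ, hCρ⟩ := hρ.adm.2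
  obtain ⟨Cg, hCg⟩ := hg.2
  have hWm := R.measurable_W hf
  have hWS : Measurable fun q => R.W f (S q) := hWm.comp R.measurable_S
  set G : X → ℝ := fun q => R.U (R.P fun q => ρ q * f q) q + R.L g q with hG
  have hGm : Measurable G := (hρ.good_P hf hF).measurable_U.add hg.L.1
  have hGg : ∀ q ∈ Δ, G q = g q := fun q hq => (hge q hq).symm
  set m : X → ℝ := fun q => f q + R.W f (S q) + g q / ρ q with hm
  have hgm := hg.1
  have hmm : Measurable m := by fun_prop
  have hρm_eq : ∀ q, ρ q * m q = ρ q * (f q + R.W f (S q)) + g q := by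
    intro q
    have := (hρ.pos q).ne'
    rw [hm]; field_simp
  set C := Cρ * F + Cg with hC
  have hF0 : 0 ≤ F := by
    obtain ⟨q, -⟩ := R.nonempty_Δ
    exact (abs_nonneg _).trans (hF q)
  have hbound : ∀ x ∈ Δ, |ρ x * m x| ≤ C * (R.H (S x) + 1) := by
    intro x hx
    have hH : (0 : ℝ) ≤ R.H (S x) := Nat.cast_nonneg _
    have h1 : |f x + R.W f (S x)| ≤ F * (R.H (S x) + 1) :=
      (abs_add_le _ _).trans (by linarith [hF x, R.abs_W_le hF (S x)])
    rw [hρm_eq]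
    refine (abs_add_le _ _).trans ?_
    rw [abs_mul]
    have h2 := hCg x hx
    have h3 : |ρ x| * |f x + R.W f (S x)| ≤ Cρ * (F * (R.H (S x) + 1)) :=
      mul_le_mul (hCρ x hx) h1 (abs_nonneg _) ((abs_nonneg _).trans (hCρ x hx))
    have h4 : 0 ≤ Cg * R.H (S x) := mul_nonneg ((abs_nonneg _).trans h2) hH
    rw [hC]; linarith
  have hsum : ∀ q, HasSum (fun n : ℕ => R.A.op^[n] (R.B.op fun x => ρ x * m x) q)
      (G q + ρ q * R.W f q) := by
    have heq : (fun x => ρ x * m x) = fun x => ρ x * (f x + R.W f (S x)) + g x := funext hρm_eq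
    rw [heq]
    exact hρ.hasSum_induced hf hF hg fun x hx => by rw [← hρm_eq]; exact hbound x hx
  set u : ℕ → X → ℝ := fun j q => R.L (fun x => ρ x * trunc m j x) q / ρ q with hu
  set v : ℕ → X → ℝ := fun j => Δ.piecewise (trunc m j) (u j) with hv
  have htm := fun j => measurable_trunc hmm j
  have hadm : ∀ j, Adm Δ fun x => ρ x * trunc m j x := fun j => by
    refine ⟨hρm.mul (htm j), Cρ * j, fun q hq => ?_⟩
    rw [abs_mul]
    exact mul_le_mul (hCρ q hq) (abs_trunc_le m j q) (abs_nonneg _)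
      ((abs_nonneg _).trans (hCρ q hq))
  have hum : ∀ j, Measurable (u j) := fun j => (hadm j).L.1.div hρm
  have hvm : ∀ j, Measurable (v j) := fun j => (htm j).piecewise R.measurableSet_Δ (hum j)
  have hub : ∀ j q, |u j q| ≤ j := fun j => hρ.abs_L_div_le (abs_trunc_le m j)
  have hvb : ∀ j q, |v j q| ≤ j := fun j q => by
    by_cases hq : q ∈ Δ
    · rw [hv]; simp only [piecewise_eq_of_mem _ _ _ hq]; exact abs_trunc_le m j q
    · rw [hv]; simp only [piecewise_eq_of_notMem _ _ _ hq]; exact hub j q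
  have hP : ∀ j q, R.P (fun x => ρ x * v j x) q = ρ q * u j q := fun j q => by
    have h1 := hρ.P_extension (htm j) (abs_trunc_le m j) q
    rw [hu]
    simp only
    rw [mul_div_cancel₀ _ (hρ.pos q).ne', ← h1]
  have hulim : ∀ q, Tendsto (fun j => u j q) atTop (𝓝 ((G q + ρ q * R.W f q) / ρ q)) := by
    intro q
    refine Tendsto.div_const ?_ _
    rw [← (hsum q).tsum_eq]
    obtain ⟨b, hbs, hbb⟩ := R.exists_summable_bound C q
    refine tendsto_tsum_of_dominated_convergence hbs (fun n => ?_)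
      (Eventually.of_forall fun j n => hbb _ (fun x hx => ?_) n)
    · exact R.A.tendsto_iterate_op
        (fun x => R.B.tendsto_op (fun y _ => (tendsto_trunc m y).const_mul _) x) n q
    · refine le_trans ?_ (hbound x hx)
      rw [abs_mul, abs_mul]
      exact mul_le_mul_of_nonneg_left (abs_trunc_le_abs m j x) (abs_nonneg _)
  set w : X → ℝ := fun q => (G q + ρ q * R.W f q) / ρ q with hw
  have hwm : Measurable w := by fun_prop
  have hwe : ∀ q, w q = G q / ρ q + R.W f q := fun q => by
    rw [hw]; simp only
    rw [add_div, mul_div_cancel_left₀ _ (hρ.pos q).ne']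
  set e : ℕ → X → ℝ := fun k => Δ.indicator fun q => ρ q * (m q - trunc m k q) ^ 2 with he
  have hmsq : IntegrableOn (fun q => ρ q * m q ^ 2) Δ lam := by
    have h1 := R.integrableOn_W_comp hf hW
    have h2 : IntegrableOn (fun q => 3 * Cρ * (F ^ 2 + R.W f (S q) ^ 2 + (Cg / ε) ^ 2)) Δ lam :=
      (((integrable_const _).add h1).add (integrable_const _)).const_mul _
    refine h2.mono' (by fun_prop) ((ae_restrict_iff' R.measurableSet_Δ).2 (ae_of_all _ ?_))
    intro q hq
    rw [Real.norm_of_nonneg (mul_nonneg (hρ.pos q).le (sq_nonneg _))]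
    have h3 : ρ q ≤ Cρ := (le_abs_self _).trans (hCρ q hq)
    have h4 : f q ^ 2 ≤ F ^ 2 := by rw [← sq_abs]; exact pow_le_pow_left₀ (abs_nonneg _) (hF q) 2
    have h5 : (g q / ρ q) ^ 2 ≤ (Cg / ε) ^ 2 := by
      rw [← sq_abs, abs_div, abs_of_pos (hρ.pos q)]
      have h6 := hρ.ε_pos
      have h7 := hρ.le q
      have h8 := hCg q hq
      have h9 := (abs_nonneg _).trans h8
      have h10 : |g q| / ρ q ≤ Cg / ε := by gcongr
      exact pow_le_pow_left₀ (div_nonneg (abs_nonneg _) (hρ.pos q).le) h10 2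
    have h6 : m q ^ 2 ≤ 3 * (F ^ 2 + R.W f (S q) ^ 2 + (Cg / ε) ^ 2) := by
      rw [hm]; simp only
      nlinarith [sq_nonneg (f q - R.W f (S q)), sq_nonneg (f q - g q / ρ q),
        sq_nonneg (R.W f (S q) - g q / ρ q)]
    calc ρ q * m q ^ 2 ≤ Cρ * (3 * (F ^ 2 + R.W f (S q) ^ 2 + (Cg / ε) ^ 2)) :=
          mul_le_mul h3 h6 (sq_nonneg _) ((hρ.pos q).le.trans h3)
      _ = _ := by ring
  have hebound : ∀ k q, |e k q| ≤ Δ.indicator (fun q => ρ q * m q ^ 2) q := by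
    intro k q
    rw [he]
    by_cases hq : q ∈ Δ
    · simp only [indicator_of_mem hq]
      rw [abs_of_nonneg (mul_nonneg (hρ.pos q).le (sq_nonneg _))]
      refine mul_le_mul_of_nonneg_left ?_ (hρ.pos q).le
      unfold trunc
      by_cases h : |m q| ≤ k
      · rw [indicator_of_mem (by exact h), sub_self]; simpa using sq_nonneg (m q)
      · rw [indicator_of_notMem (by exact h), sub_zero]
    · simp [indicator_of_notMem hq]
  have hemeas : ∀ k, Measurable (e k) := fun k =>
    (hρm.mul ((hmm.sub (htm k)).pow_const 2)).indicator R.measurableSet_Δ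
  have heint : ∀ k, Integrable (e k) lam := fun k =>
    (hmsq.integrable_indicator R.measurableSet_Δ).mono' (hemeas k).aestronglyMeasurable
      (ae_of_all _ (hebound k))
  have helim : Tendsto (fun k => Z⁻¹ * ∫ q, e k q ∂lam) atTop (𝓝 0) := by
    have h1 := tendsto_integral_of_dominated_convergence (μ := lam) (F := e) (f := fun _ => 0)
      _ (fun k => (hemeas k).aestronglyMeasurable)
      (hmsq.integrable_indicator R.measurableSet_Δ) (fun k => ae_of_all _ (hebound k))
      (ae_of_all _ fun q => by
        by_cases hq : q ∈ Δ
        · simp only [he, indicator_of_mem hq]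
          have := (((tendsto_trunc m q).const_sub (m q)).pow 2).const_mul (ρ q)
          simpa using this
        · simp only [he, indicator_of_notMem hq]
          exact tendsto_const_nhds)
    simpa using h1.const_mul Z⁻¹
  refine clt_of_martingale_approximation herg (f := f)
    (g := fun q => Δ.piecewise m w q - w (S q)) (u := fun q => G q / ρ q)
    (m := fun j q => v j q - u j (S q)) hf
    ((hmm.piecewise R.measurableSet_Δ hwm).sub (hwm.comp R.measurable_S)) (hGm.div hρm)
    (fun q => ?_) (fun j => (hvm j).sub ((hum j).comp R.measurable_S))
    (fun j => ⟨j + j, fun q => (abs_sub _ _).trans (add_le_add (hvb j q) (hub j (S q)))⟩)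
    (fun j k hk ⟨C', hC'⟩ => ?_) helim (fun k j hkj => ?_) (fun q => ?_)
  · simp only [hwe]
    by_cases hq : q ∈ Δ
    · rw [piecewise_eq_of_mem _ _ _ hq, hGg q hq, hm]
      ring
    · rw [piecewise_eq_of_notMem _ _ _ hq, hwe, R.W_of_notMem f hq]
      ring
  · refine (hi0 (fun x => (v j x - u j (S x)) * k (S x))
      (((hvm j).sub ((hum j).comp R.measurable_S)).mul (hk.comp R.measurable_S))).trans ?_
    rw [hρ.integral_sub_comp_mul_comp (hvm j) (hum j) (hvb j) (hub j) (hP j) hk hC', mul_zero]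
  · have hvm' := (hvm j).sub (hvm k)
    have hum' := (hum j).sub (hum k)
    have hbd : ∀ a b : ℝ, |a| ≤ j → |b| ≤ k → |a - b| ≤ j + j := fun a b ha hb =>
      (abs_sub _ _).trans (add_le_add ha (hb.trans (Nat.cast_le.2 hkj)))
    have hP' : ∀ q, R.P (fun x => ρ x * (v j x - v k x)) q = ρ q * (u j q - u k q) := by
      intro q
      simp only [mul_sub]
      rw [R.P_sub, hP, hP]
    have h1 := hρ.integral_sub_comp_sq (v := fun x => v j x - v k x)
      (u := fun x => u j x - u k x) hvm' hum' (fun q => hbd _ _ (hvb j q) (hvb k q))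
      (fun q => hbd _ _ (hub j q) (hub k q)) hP'
    have h2 : ∀ q, v j q - u j (S q) - (v k q - u k (S q))
        = v j q - v k q - (u j (S q) - u k (S q)) := fun q => by ring
    simp only [h2]
    rw [hi0 (fun q => (v j q - v k q - (u j (S q) - u k (S q))) ^ 2)
      (by exact (hvm'.sub (hum'.comp R.measurable_S)).pow_const 2), h1]
    refine mul_le_mul_of_nonneg_left ?_ (inv_nonneg.2 hZ0.le)
    have hsqb : ∀ q, |(v j q - v k q) ^ 2 - (u j q - u k q) ^ 2| ≤ (j + j) ^ 2 := by
      intro q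
      have a1 := sq_le_sq' (abs_le.1 (hbd _ _ (hvb j q) (hvb k q))).1
        (abs_le.1 (hbd _ _ (hvb j q) (hvb k q))).2
      have a2 := sq_le_sq' (abs_le.1 (hbd _ _ (hub j q) (hub k q))).1
        (abs_le.1 (hbd _ _ (hub j q) (hub k q))).2
      rw [abs_le]
      constructor <;> nlinarith [sq_nonneg (v j q - v k q), sq_nonneg (u j q - u k q)]
    refine integral_mono (hρ.integrable_mul ((hvm'.pow_const 2).sub (hum'.pow_const 2)) hsqb)
      (heint k) fun q => ?_
    by_cases hq : q ∈ Δ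
    · simp only [he, hv, indicator_of_mem hq, piecewise_eq_of_mem _ _ _ hq]
      refine mul_le_mul_of_nonneg_left ?_ (hρ.pos q).le
      linarith [sq_trunc_sub_le m hkj q, sq_nonneg (u j q - u k q)]
    · simp only [he, hv, indicator_of_notMem hq, piecewise_eq_of_notMem _ _ _ hq]
      simp
  · refine Tendsto.sub ?_ (hulim (S q))
    by_cases hq : q ∈ Δ
    · simp only [hv, piecewise_eq_of_mem _ _ _ hq]
      exact tendsto_trunc m q
    · simp only [hv, piecewise_eq_of_notMem _ _ _ hq]
      exact hulim q

end FirstReturnSystem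

/-- Lebesgue measure on a subset of the line. -/
abbrev subvol (I : Set ℝ) : Measure I := (volume : Measure ℝ).comap Subtype.val

/-- Change of variables for an inverse branch `θ` of a map `τ` of an interval. -/
theorem map_withDensity_inverse {I s : Set ℝ} (hI : MeasurableSet I) (hs : MeasurableSet s)
    (hsI : s ⊆ I) {τ τ' : ℝ → ℝ} (hd : ∀ x ∈ s, HasDerivWithinAt τ (τ' x) s x)
    (hinj : InjOn τ s) (hmaps : MapsTo τ s I) (hpos : ∀ x ∈ s, 0 < τ' x) (hτ' : Measurable τ')
    {θ : I → I} (hθ : Measurable θ) (hθs : ∀ y, (θ y : ℝ) ∈ s) (hτθ : ∀ y, τ (θ y) = y) :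
    ((subvol I).withDensity fun y => ENNReal.ofReal (τ' (θ y))⁻¹).map θ
      = (subvol I).restrict (Subtype.val ⁻¹' s) := by
  have himg : τ '' s = I :=
    Subset.antisymm hmaps.image_subset fun y hy => ⟨θ ⟨y, hy⟩, hθs _, hτθ _⟩
  refine Measure.ext fun t ht => ?_
  obtain ⟨t', ht', rfl⟩ := ht
  set σ : ℝ → ℝ := Function.extend Subtype.val (fun y => (θ y : ℝ)) 0 with hσ
  have hσθ : ∀ y : I, σ y = θ y := fun y => Subtype.val_injective.extend_apply _ _ _
  have hστ : ∀ x ∈ s, σ (τ x) = x := fun x hx => by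
    have h1 := hσθ ⟨τ x, hmaps hx⟩
    rw [h1]
    exact hinj (hθs _) hx (hτθ _)
  have hm : Measurable fun y : I => ENNReal.ofReal (τ' (θ y))⁻¹ := by fun_prop
  rw [Measure.map_apply hθ (measurable_subtype_coe ht'), withDensity_apply _
    (hθ (measurable_subtype_coe ht')), ← lintegral_indicator (hθ (measurable_subtype_coe ht')),
    Measure.restrict_apply (measurable_subtype_coe ht')]
  have h1 : ∀ y : I, (θ ⁻¹' (Subtype.val ⁻¹' t')).indicator
      (fun y : I => ENNReal.ofReal (τ' (θ y))⁻¹) y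
      = (fun x : ℝ => t'.indicator (fun x => ENNReal.ofReal (τ' x)⁻¹) (σ x)) y := by
    intro y
    simp only [hσθ]
    rfl
  simp only [h1]
  have h2 :
      ∫⁻ x : I, (fun x : ℝ => t'.indicator (fun x => ENNReal.ofReal (τ' x)⁻¹) (σ x)) x ∂subvol I
      = ∫⁻ x in I, t'.indicator (fun x => ENNReal.ofReal (τ' x)⁻¹) (σ x) :=
    lintegral_subtype_comap hI
      fun x : ℝ => t'.indicator (fun x => ENNReal.ofReal (τ' x)⁻¹) (σ x)
  rw [h2]
  conv_lhs => rw [← himg]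
  rw [lintegral_image_eq_lintegral_abs_deriv_mul hs hd hinj, ← preimage_inter]
  have h3 : subvol I (Subtype.val ⁻¹' (t' ∩ s)) = volume (t' ∩ s) := by
    rw [comap_subtype_coe_apply hI, Subtype.image_preimage_coe,
      inter_eq_right.2 (inter_subset_right.trans hsI)]
  rw [h3, ← lintegral_indicator_one (ht'.inter hs), ← lintegral_indicator hs]
  congr 1
  funext x
  by_cases hx : x ∈ s
  · rw [indicator_of_mem hx, hστ x hx]
    by_cases hx' : x ∈ t'
    · rw [indicator_of_mem hx', indicator_of_mem (show x ∈ t' ∩ s from ⟨hx', hx⟩),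
        abs_of_pos (hpos x hx), ← ENNReal.ofReal_mul (hpos x hx).le, mul_inv_cancel₀ (hpos x hx).ne',
        ENNReal.ofReal_one,
        Pi.one_apply]
    · rw [indicator_of_notMem hx', indicator_of_notMem fun h : x ∈ t' ∩ s => hx' h.1, mul_zero]
  · rw [indicator_of_notMem hx, indicator_of_notMem fun h : x ∈ t' ∩ s => hx h.2]

/-- The left branch of the LSV map. -/
def lsvLeft (a x : ℝ) : ℝ := x * (1 + (2 : ℝ) ^ a * x ^ a)

/-- The derivative of the left branch of the LSV map. -/
def lsvDeriv (a x : ℝ) : ℝ := 1 + (1 + a) * ((2 : ℝ) ^ a * x ^ a)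

theorem lsv_of_le {a x : ℝ} (h : x ≤ 1 / 2) : lsv a x = lsvLeft a x := if_pos h

theorem lsv_of_lt {a x : ℝ} (h : 1 / 2 < x) : lsv a x = 2 * x - 1 := if_neg h.not_ge

theorem measurable_lsvDeriv (a : ℝ) : Measurable (lsvDeriv a) := by
  unfold lsvDeriv; fun_prop

theorem hasDerivAt_lsvLeft (a : ℝ) {x : ℝ} (hx : 0 < x) :
    HasDerivAt (lsvLeft a) (lsvDeriv a x) x := by
  have h := (hasDerivAt_id x).mul
    (((Real.hasDerivAt_rpow_const (p := a) (Or.inl hx.ne')).const_mul ((2 : ℝ) ^ a)).const_add 1)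
  refine (h.congr_deriv ?_ : HasDerivAt (id * fun x => 1 + (2 : ℝ) ^ a * x ^ a) _ x)
  have h1 : x * x ^ (a - 1) = x ^ a := by
    rw [Real.rpow_sub_one hx.ne']; field_simp
  rw [lsvDeriv, id]
  linear_combination (2 : ℝ) ^ a * a * h1

theorem two_rpow_mul_rpow_le {a x y : ℝ} (ha : 0 < a) (hx : 0 ≤ x) (hxy : x ≤ y) :
    (2 : ℝ) ^ a * x ^ a ≤ (2 : ℝ) ^ a * y ^ a := by gcongr

theorem lsvLeft_strictMonoOn {a : ℝ} (ha : 0 < a) : StrictMonoOn (lsvLeft a) (Ici 0) := by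
  intro x hx y hy hxy
  have h0 : (0 : ℝ) ≤ 2 ^ a * x ^ a := by have : (0 : ℝ) ≤ x := hx; positivity
  have h1 := two_rpow_mul_rpow_le ha hx hxy.le
  have : (0 : ℝ) ≤ x := hx
  unfold lsvLeft
  nlinarith

theorem lsvLeft_half {a : ℝ} : lsvLeft a (1 / 2) = 1 := by
  rw [lsvLeft, ← Real.mul_rpow (by norm_num) (by norm_num)]
  norm_num

theorem one_le_lsvDeriv {a x : ℝ} (ha : 0 < a) (hx : 0 ≤ x) : 1 ≤ lsvDeriv a x := by
  unfold lsvDeriv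
  have : 0 ≤ (1 + a) * ((2 : ℝ) ^ a * x ^ a) := by positivity
  linarith

theorem lsvDeriv_le {a x y : ℝ} (ha : 0 < a) (hx : 0 ≤ x) (hxy : x ≤ y) :
    lsvDeriv a x ≤ lsvDeriv a y := by
  unfold lsvDeriv; gcongr

theorem le_lsvLeft {a x : ℝ} (hx : 0 ≤ x) : x ≤ lsvLeft a x := by
  unfold lsvLeft
  have : 0 ≤ x * ((2 : ℝ) ^ a * x ^ a) := by positivity
  linarith

theorem lsvLeft_pos {a x : ℝ} (hx : 0 < x) : 0 < lsvLeft a x := hx.trans_le (le_lsvLeft hx.le)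

theorem lsvLeft_le_one {a x : ℝ} (ha : 0 < a) (hx : 0 ≤ x) (hx' : x ≤ 1 / 2) :
    lsvLeft a x ≤ 1 := by
  rw [← lsvLeft_half (a := a)]
  exact (lsvLeft_strictMonoOn ha).monotoneOn hx (mem_Ici.2 (by norm_num)) hx'

theorem exists_lsvLeft_eq {a y : ℝ} (ha : 0 < a) (hy : y ∈ Ioc (0 : ℝ) 1) :
    ∃ x ∈ Ioc (0 : ℝ) (1 / 2), lsvLeft a x = y := by
  have hc : ContinuousOn (lsvLeft a) (Icc 0 (1 / 2)) := by
    unfold lsvLeft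
    have : Continuous fun x : ℝ => x ^ a := Real.continuous_rpow_const ha.le
    fun_prop
  have h0 : lsvLeft a 0 = 0 := by simp [lsvLeft]
  have h := intermediate_value_Icc (by norm_num : (0 : ℝ) ≤ 1 / 2) hc
  rw [h0, lsvLeft_half] at h
  obtain ⟨x, hx, rfl⟩ := h ⟨hy.1.le, hy.2⟩
  refine ⟨x, ⟨hx.1.lt_of_ne ?_, hx.2⟩, rfl⟩
  rintro rfl
  exact (h0 ▸ hy.1).ne rfl

/-- The inverse of the left branch decreases distances. -/
theorem sub_le_lsvLeft_sub {a x y : ℝ} (ha : 0 < a) (hx : 0 ≤ x) (hxy : x ≤ y) :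
    y - x ≤ lsvLeft a y - lsvLeft a x := by
  have h1 := two_rpow_mul_rpow_le ha hx hxy
  have h0 : (0 : ℝ) ≤ 2 ^ a * x ^ a := by positivity
  unfold lsvLeft
  nlinarith [mul_le_mul hxy h1 h0 (hx.trans hxy)]

/-- Distortion of the left branch of the LSV map. -/
theorem lsvLeft_distortion {a x y : ℝ} (ha : 0 < a) (ha1 : a ≤ 1) (hx : 0 < x) (hxy : x ≤ y) :
    (lsvDeriv a x)⁻¹ * (y / x) ^ 2
      ≤ (lsvDeriv a y)⁻¹ * (lsvLeft a y / lsvLeft a x) ^ 2 := by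
  have hy := hx.trans_le hxy
  have h1 := two_rpow_mul_rpow_le ha hx.le hxy
  have h0 : (0 : ℝ) < 2 ^ a * x ^ a := by positivity
  unfold lsvDeriv lsvLeft
  generalize (2 : ℝ) ^ a * x ^ a = u at *
  generalize (2 : ℝ) ^ a * y ^ a = v at *
  have hv := h0.trans_le h1
  rw [mul_div_mul_comm, mul_pow, mul_left_comm, mul_comm]
  refine mul_le_mul_of_nonneg_left ?_ (sq_nonneg _)
  rw [div_pow, inv_eq_one_div, inv_mul_eq_div, div_div, div_le_div_iff₀ (by positivity)
    (by positivity)]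
  nlinarith [mul_nonneg (sub_nonneg.2 h1) (by nlinarith [mul_pos h0 hv] :
    0 ≤ 2 + u + v + (1 + a) * (u * v - 1))]

/-- The function `(2 * x)⁻ᵇ`. -/
def escape (b x : ℝ) : ℝ := ((2 * x) ^ b)⁻¹

theorem escape_pos {b x : ℝ} (hx : 0 < x) : 0 < escape b x := by unfold escape; positivity

theorem escape_anti {b x y : ℝ} (hb : 0 < b) (hx : 0 < x) (hxy : x ≤ y) :
    escape b y ≤ escape b x := by unfold escape; gcongr

/-- The decrease of `(2 * x)⁻ᵇ` along one step of the left branch. -/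
def escapeRate (b : ℝ) : ℝ := (2 ^ b - 1) / 2 ^ b

theorem escapeRate_pos {b : ℝ} (hb : 0 < b) : 0 < escapeRate b := by
  have := Real.one_lt_rpow (by norm_num : (1 : ℝ) < 2) hb
  unfold escapeRate
  have : 0 < (2 : ℝ) ^ b - 1 := by linarith
  positivity

theorem escape_lsvLeft_le {a b x : ℝ} (hab : a ≤ b) (hb : 0 < b) (hb1 : b ≤ 1)
    (hx : 0 < x) (hx' : x ≤ 1 / 2) : escape b (lsvLeft a x) ≤ escape b x - escapeRate b := by
  have h2x : 0 < 2 * x := by linarith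
  have hu : (2 * x) ^ b ≤ (2 * x) ^ a :=
    Real.rpow_le_rpow_of_exponent_ge h2x (by linarith) hab
  have hu1 : (2 * x) ^ b ≤ 1 := Real.rpow_le_one h2x.le (by linarith) hb.le
  have hu0 : 0 < (2 * x) ^ b := by positivity
  have hκ := Real.one_lt_rpow (by norm_num : (1 : ℝ) < 2) hb
  have h1 : 1 + (2 * x) ^ b * (2 ^ b - 1) ≤ (1 + (2 * x) ^ b) ^ b := by
    have h := (Real.concaveOn_rpow hb.le hb1).2 (mem_Ici.2 zero_le_one)
      (mem_Ici.2 zero_le_two) (sub_nonneg.2 hu1) hu0.le (sub_add_cancel _ _)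
    simp only [smul_eq_mul, Real.one_rpow] at h
    calc _ = (1 - (2 * x) ^ b) * 1 + (2 * x) ^ b * 2 ^ b := by ring
      _ ≤ _ := h
      _ = _ := by congr 1; ring
  have h2 : (2 * x) ^ b * (1 + (2 * x) ^ b * (2 ^ b - 1)) ≤ (2 * lsvLeft a x) ^ b := by
    rw [lsvLeft, ← Real.mul_rpow (by norm_num) hx.le, ← mul_assoc,
      Real.mul_rpow h2x.le (by positivity)]
    refine mul_le_mul_of_nonneg_left (h1.trans ?_) hu0.le
    gcongr
  unfold escape escapeRate
  generalize (2 * x) ^ b = u at *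
  generalize (2 : ℝ) ^ b = k at *
  have h3 : 0 < k - 1 := by linarith
  refine (inv_anti₀ (by positivity) h2).trans ?_
  rw [le_sub_iff_add_le, inv_eq_one_div, inv_eq_one_div, div_add_div _ _ (by positivity)
    (by positivity), div_le_div_iff₀ (by positivity) (by positivity)]
  nlinarith [mul_nonneg (mul_nonneg hu0.le (sq_nonneg u)) (sub_nonneg.2 hu1),
    mul_nonneg (mul_nonneg (mul_nonneg hu0.le hu0.le) (sub_nonneg.2 hu1)) (mul_nonneg h3.le h3.le),
    mul_nonneg (mul_nonneg (mul_nonneg hu0.le hu0.le) (sub_nonneg.2 hu1)) h3.le]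

/-- Standing assumptions on the parameters. -/
structure IsParam (α β p₁ : ℝ) : Prop where
  α_pos : 0 < α
  α_le : α ≤ β
  β_lt : β < 1
  p_pos : 0 < p₁
  p_lt : p₁ < 1

/-- Base interval. -/
abbrev I₀ : Set ℝ := Ioc 0 1

/-- Noise interval. -/
abbrev J₀ : Set ℝ := Ico 0 1

/-- Phase space of the skew product. -/
abbrev Q₀ : Type := I₀ × J₀

/-- Lebesgue measure on the phase space. -/
abbrev lamQ : Measure Q₀ := (subvol I₀).prod (subvol J₀)

/-- Base of inducing. -/
def ΔQ : Set Q₀ := {q | 1 / 2 < (q.1 : ℝ)}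

theorem measurableSet_ΔQ : MeasurableSet ΔQ :=
  measurableSet_lt measurable_const (measurable_subtype_coe.comp measurable_fst)

instance : IsProbabilityMeasure (subvol I₀) :=
  ⟨by rw [comap_subtype_coe_apply measurableSet_Ioc, image_univ, Subtype.range_coe]; simp⟩

instance : IsProbabilityMeasure (subvol J₀) :=
  ⟨by rw [comap_subtype_coe_apply measurableSet_Ico, image_univ, Subtype.range_coe]; simp⟩

/-- The parameter of the `i`-th map. -/
def expo (α β : ℝ) (i : Bool) : ℝ := cond i α β

/-- The probability of the `i`-th map. -/
def wt (p₁ : ℝ) (i : Bool) : ℝ := cond i p₁ (1 - p₁)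

/-- The left end point of the `i`-th noise interval. -/
def off (p₁ : ℝ) (i : Bool) : ℝ := cond i 0 p₁

namespace IsParam

variable {α β p₁ : ℝ} (h : IsParam α β p₁)
include h

theorem β_pos : 0 < β := h.α_pos.trans_le h.α_le

theorem expo_pos (i : Bool) : 0 < expo α β i := by
  cases i
  · exact h.β_pos
  · exact h.α_pos

theorem expo_le (i : Bool) : expo α β i ≤ β := by
  cases i
  · exact le_rfl
  · exact h.α_le

theorem wt_pos (i : Bool) : 0 < wt p₁ i := by
  cases i
  · exact sub_pos.2 h.p_lt
  · exact h.p_pos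

omit h in
theorem wt_le (i : Bool) : wt p₁ i ≤ max p₁ (1 - p₁) := by
  cases i
  · exact le_max_right _ _
  · exact le_max_left _ _

theorem off_nonneg (i : Bool) : 0 ≤ off p₁ i := by
  cases i
  · exact h.p_pos.le
  · exact le_rfl

theorem off_add_wt_le (i : Bool) : off p₁ i + wt p₁ i ≤ 1 := by
  cases i
  · simp [off, wt]
  · simp [off, wt, h.p_lt.le]

omit h in
theorem alphaOf_mem (ω : ℝ) : alphaOf α β p₁ ω = α ∨ alphaOf α β p₁ ω = β := by
  unfold alphaOf; split_ifs <;> simp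

theorem alphaOf_pos (ω : ℝ) : 0 < alphaOf α β p₁ ω := by
  rcases alphaOf_mem (α := α) (β := β) (p₁ := p₁) ω with h1 | h1 <;> rw [h1]
  exacts [h.α_pos, h.β_pos]

theorem alphaOf_le (ω : ℝ) : alphaOf α β p₁ ω ≤ β := by
  rcases alphaOf_mem (α := α) (β := β) (p₁ := p₁) ω with h1 | h1 <;> rw [h1]
  exact h.α_le

theorem phiMap_mem {ω : ℝ} (hω : ω ∈ J₀) : phiMap p₁ ω ∈ J₀ := by
  have h1 := h.p_pos
  have h2 : 0 < 1 - p₁ := sub_pos.2 h.p_lt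
  unfold phiMap
  split_ifs with h3
  · exact ⟨div_nonneg hω.1 h1.le, (div_lt_one h1).2 h3⟩
  · exact ⟨div_nonneg (by linarith) h2.le, (div_lt_one h2).2 (by linarith [hω.2])⟩

omit h in
theorem lsv_mem {a x : ℝ} (ha : 0 < a) (hx : x ∈ I₀) : lsv a x ∈ I₀ := by
  rcases le_or_gt x (1 / 2) with h1 | h1
  · rw [lsv_of_le h1]
    exact ⟨lsvLeft_pos hx.1, lsvLeft_le_one ha hx.1.le h1⟩
  · rw [lsv_of_lt h1]
    exact ⟨by linarith, by linarith [hx.2]⟩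

/-- The skew product on the phase space. -/
def sys (q : Q₀) : Q₀ :=
  (⟨lsv (alphaOf α β p₁ q.2) q.1, lsv_mem (h.alphaOf_pos _) q.1.2⟩,
    ⟨phiMap p₁ q.2, h.phiMap_mem q.2.2⟩)

/-- The `i`-th fibre map. -/
def fib (i : Bool) (x : I₀) : I₀ := ⟨lsv (expo α β i) x, lsv_mem (h.expo_pos i) x.2⟩

/-- The noise dynamics on the noise interval. -/
def shift (ξ : J₀) : J₀ := ⟨phiMap p₁ ξ, h.phiMap_mem ξ.2⟩

/-- Inverse branches of the noise dynamics. -/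
def ι (i : Bool) (ξ : J₀) : J₀ :=
  ⟨off p₁ i + wt p₁ i * ξ, by
    have h1 := h.wt_pos i
    have h2 := h.off_nonneg i
    have h3 := h.off_add_wt_le i
    have h4 := ξ.2.1
    have h5 := ξ.2.2
    constructor
    · positivity
    · nlinarith⟩

theorem shift_ι (i : Bool) (ξ : J₀) : h.shift (h.ι i ξ) = ξ := by
  have h1 := h.p_pos
  have h2 : 0 < 1 - p₁ := sub_pos.2 h.p_lt
  have h4 := ξ.2.1
  have h5 := ξ.2.2
  refine Subtype.ext ?_
  cases i
  · have h6 : ¬ p₁ + (1 - p₁) * (ξ : ℝ) < p₁ := by nlinarith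
    change phiMap p₁ (p₁ + (1 - p₁) * (ξ : ℝ)) = ξ
    rw [phiMap, if_neg h6]
    field_simp
    ring
  · have h6 : p₁ * (ξ : ℝ) < p₁ := by nlinarith
    simp only [shift, ι, off, wt, cond_true, phiMap, zero_add, if_pos h6]
    field_simp

theorem alphaOf_ι (i : Bool) (ξ : J₀) : alphaOf α β p₁ (h.ι i ξ) = expo α β i := by
  have h1 := h.p_pos
  have h2 : 0 < 1 - p₁ := sub_pos.2 h.p_lt
  have h4 := ξ.2.1
  have h5 := ξ.2.2
  cases i
  · have h6 : ¬ p₁ + (1 - p₁) * (ξ : ℝ) < p₁ := by nlinarith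
    change alphaOf α β p₁ (p₁ + (1 - p₁) * (ξ : ℝ)) = β
    rw [alphaOf, if_neg h6]
  · have h6 : p₁ * (ξ : ℝ) < p₁ := by nlinarith
    simp only [ι, off, wt, cond_true, alphaOf, zero_add, if_pos h6, expo]

theorem sys_ι (i : Bool) (x : I₀) (ξ : J₀) : h.sys (x, h.ι i ξ) = (h.fib i x, ξ) := by
  refine Prod.ext (Subtype.ext ?_) (h.shift_ι i ξ)
  simp only [sys, fib, alphaOf_ι]

omit h in
theorem measurable_lsv : Measurable fun p : ℝ × ℝ => lsv p.1 p.2 := by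
  unfold lsv
  exact Measurable.ite (measurableSet_le measurable_snd measurable_const) (by fun_prop)
    (by fun_prop)

omit h in
theorem measurable_skewLSV : Measurable (skewLSV α β p₁) := by
  have h1 : Measurable (alphaOf α β p₁) := by
    unfold alphaOf
    exact Measurable.ite (measurableSet_lt measurable_id measurable_const) measurable_const
      measurable_const
  have h2 : Measurable (phiMap p₁) := by
    unfold phiMap
    exact Measurable.ite (measurableSet_lt measurable_id measurable_const) (by fun_prop)
      (by fun_prop)
  exact (measurable_lsv.comp ((h1.comp measurable_snd).prodMk measurable_fst)).prodMk
    (h2.comp measurable_snd)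

theorem measurable_sys : Measurable h.sys := by
  have h1 : Measurable fun q : Q₀ => skewLSV α β p₁ (q.1, q.2) :=
    measurable_skewLSV.comp (by fun_prop)
  exact (Measurable.subtype_mk (measurable_fst.comp h1)).prodMk
    (Measurable.subtype_mk (measurable_snd.comp h1))

theorem measurable_shift : Measurable h.shift := by
  have h1 : Measurable fun ξ : J₀ => skewLSV α β p₁ (0, ξ) :=
    measurable_skewLSV.comp (by fun_prop)
  exact Measurable.subtype_mk (measurable_snd.comp h1)

theorem measurable_ι (i : Bool) : Measurable (h.ι i) :=
  Measurable.subtype_mk (by fun_prop)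

/-- The `i`-th noise interval. -/
def noise (p₁ : ℝ) (i : Bool) : Set ℝ := Ico (off p₁ i) (off p₁ i + wt p₁ i)

theorem map_ι (i : Bool) :
    ((subvol J₀).withDensity fun _ => ENNReal.ofReal (wt p₁ i)).map (h.ι i)
      = (subvol J₀).restrict (Subtype.val ⁻¹' noise p₁ i) := by
  have hw := h.wt_pos i
  have h0 := h.off_nonneg i
  have h1 := h.off_add_wt_le i
  have := map_withDensity_inverse (I := J₀) (s := noise p₁ i)
    (τ := fun x => (x - off p₁ i) / wt p₁ i) (τ' := fun _ => (wt p₁ i)⁻¹) measurableSet_Ico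
    measurableSet_Ico (Ico_subset_Ico h0 h1) (fun x _ => by
      have := (((hasDerivAt_id x).sub_const (off p₁ i)).div_const (wt p₁ i)).hasDerivWithinAt
        (s := noise p₁ i)
      rwa [one_div] at this)
    (fun x _ y _ hxy => by
      have : x - off p₁ i = y - off p₁ i := (div_left_inj' hw.ne').1 hxy
      linarith)
    (fun x hx => ⟨div_nonneg (by linarith [hx.1]) hw.le, (div_lt_one hw).2 (by linarith [hx.2])⟩)
    (fun x _ => inv_pos.2 hw) measurable_const (h.measurable_ι i)
    (fun y => ⟨by simp only [ι]; nlinarith [y.2.1], by simp only [ι]; nlinarith [y.2.2]⟩)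
    (fun y => by simp only [ι]; field_simp; ring)
  simpa only [inv_inv] using this

omit h in
theorem sum_restrict_noise :
    (subvol J₀) = ∑ i, (subvol J₀).restrict (Subtype.val ⁻¹' noise p₁ i) := by
  have hm : MeasurableSet (Subtype.val ⁻¹' noise p₁ false : Set J₀) :=
    measurable_subtype_coe measurableSet_Ico
  rw [Fintype.sum_bool, ← Measure.restrict_union _ hm]
  · symm
    convert Measure.restrict_univ
    refine eq_univ_of_forall fun ξ => ?_
    rcases lt_or_ge (ξ : ℝ) p₁ with h1 | h1
    · exact Or.inl ⟨ξ.2.1, by simpa [off, wt] using h1⟩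
    · exact Or.inr ⟨h1, by simpa [off, wt] using ξ.2.2⟩
  · rw [disjoint_left]
    intro ξ h1 h2
    have h3 : (ξ : ℝ) < 0 + p₁ := h1.2
    have h4 : p₁ ≤ (ξ : ℝ) := h2.1
    linarith

/-- Product of inverse branches on the base with the inverse branches of the noise dynamics. -/
theorem restrict_prod_eq {s : Set I₀} {θ : Bool → I₀ → I₀} {w : Bool → I₀ → ℝ}
    (hθ : ∀ i, Measurable (θ i)) (hw : ∀ i, Measurable (w i)) (hw0 : ∀ i y, 0 ≤ w i y)
    (hmap : ∀ i, ((subvol I₀).withDensity fun y => ENNReal.ofReal (w i y)).map (θ i)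
      = (subvol I₀).restrict s) :
    lamQ.restrict (s ×ˢ univ) = ∑ i, (lamQ.withDensity fun q =>
      ENNReal.ofReal (w i q.1 * wt p₁ i)).map (Prod.map (θ i) (h.ι i)) := by
  have h1 : ∀ i, (lamQ.withDensity fun q =>
      ENNReal.ofReal (w i q.1 * wt p₁ i)).map (Prod.map (θ i) (h.ι i))
      = ((subvol I₀).restrict s).prod ((subvol J₀).restrict (Subtype.val ⁻¹' noise p₁ i)) := by
    intro i
    have hwi := hw i
    rw [← hmap i, ← h.map_ι i, Measure.map_prod_map _ _ (hθ i) (h.measurable_ι i),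
      prod_withDensity (by fun_prop) (by fun_prop)]
    simp only [ENNReal.ofReal_mul (hw0 i _)]
  simp only [h1]
  rw [← Measure.prod_restrict, Measure.restrict_univ]
  conv_lhs => rw [sum_restrict_noise (p₁ := p₁)]
  rw [Fintype.sum_bool, Fintype.sum_bool, Measure.prod_add]

end IsParam

namespace IsParam

variable {α β p₁ : ℝ} (h : IsParam α β p₁)
include h

/-- The inverse of the left branch of the `i`-th fibre map. -/
def leftInv (i : Bool) (y : I₀) : I₀ :=
  ⟨(exists_lsvLeft_eq (h.expo_pos i) y.2).choose,
    Ioc_subset_Ioc_right (by norm_num) (exists_lsvLeft_eq (h.expo_pos i) y.2).choose_spec.1⟩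

theorem leftInv_mem (i : Bool) (y : I₀) : (h.leftInv i y : ℝ) ∈ Ioc (0 : ℝ) (1 / 2) :=
  (exists_lsvLeft_eq (h.expo_pos i) y.2).choose_spec.1

theorem lsvLeft_leftInv (i : Bool) (y : I₀) : lsvLeft (expo α β i) (h.leftInv i y) = y :=
  (exists_lsvLeft_eq (h.expo_pos i) y.2).choose_spec.2

theorem leftInv_mono (i : Bool) : Monotone (h.leftInv i) := by
  intro y y' hy
  by_contra hlt
  have h1 := lsvLeft_strictMonoOn (h.expo_pos i) (h.leftInv i y').2.1.le (h.leftInv i y).2.1.le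
    (not_le.1 hlt)
  rw [lsvLeft_leftInv, lsvLeft_leftInv] at h1
  exact h1.not_ge hy

theorem measurable_leftInv (i : Bool) : Measurable (h.leftInv i) := (h.leftInv_mono i).measurable

theorem map_leftInv (i : Bool) :
    ((subvol I₀).withDensity fun y =>
      ENNReal.ofReal (lsvDeriv (expo α β i) (h.leftInv i y))⁻¹).map (h.leftInv i)
      = (subvol I₀).restrict (Subtype.val ⁻¹' Ioc 0 (1 / 2)) :=
  map_withDensity_inverse (τ := lsvLeft (expo α β i)) measurableSet_Ioc measurableSet_Ioc
    (Ioc_subset_Ioc_right (by norm_num))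
    (fun _ hx => (hasDerivAt_lsvLeft _ hx.1).hasDerivWithinAt)
    ((lsvLeft_strictMonoOn (h.expo_pos i)).injOn.mono fun _ hx => hx.1.le)
    (fun _ hx => ⟨lsvLeft_pos hx.1, lsvLeft_le_one (h.expo_pos i) hx.1.le hx.2⟩)
    (fun _ hx => zero_lt_one.trans_le (one_le_lsvDeriv (h.expo_pos i) hx.1.le))
    (measurable_lsvDeriv _) (h.measurable_leftInv i) (h.leftInv_mem i) (h.lsvLeft_leftInv i)

omit h in
/-- The inverse of the right branch. -/
def rightInv (y : I₀) : I₀ := ⟨(1 + y) / 2, by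
  have h1 := y.2.1
  have h2 := y.2.2
  constructor <;> linarith⟩

omit h in
theorem measurable_rightInv : Measurable rightInv := Measurable.subtype_mk (by fun_prop)

omit h in
theorem map_rightInv :
    ((subvol I₀).withDensity fun _ => ENNReal.ofReal (2 : ℝ)⁻¹).map rightInv
      = (subvol I₀).restrict (Subtype.val ⁻¹' Ioc (1 / 2) 1) := by
  refine map_withDensity_inverse (τ := fun x => 2 * x - 1) (τ' := fun _ => 2) measurableSet_Ioc
    measurableSet_Ioc (Ioc_subset_Ioc_left (by norm_num)) (fun x _ => ?_) (fun x _ y _ hxy => ?_)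
    (fun x hx => ?_) (fun _ _ => two_pos) measurable_const measurable_rightInv (fun y => ?_)
    (fun y => ?_)
  · have := (((hasDerivAt_id x).const_mul 2).sub_const 1).hasDerivWithinAt (s := Ioc (1 / 2) 1)
    rwa [mul_one] at this
  · have : 2 * x - 1 = 2 * y - 1 := hxy
    linarith
  · have h1 := hx.1
    have h2 := hx.2
    constructor <;> simp only <;> linarith
  · have h1 := y.2.1
    have h2 := y.2.2
    simp only [rightInv]
    constructor <;> linarith
  · simp only [rightInv]
    ring

omit h in
theorem compl_ΔQ : ΔQᶜ = ((Subtype.val ⁻¹' Ioc 0 (1 / 2) : Set I₀) ×ˢ univ : Set Q₀) := by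
  ext q
  simp only [ΔQ, mem_compl_iff, mem_ofPred_eq, not_lt, mem_prod, mem_preimage, mem_Ioc, mem_univ,
    and_true, iff_and_self]
  exact fun _ => q.1.2.1

omit h in
theorem ΔQ_eq : ΔQ = ((Subtype.val ⁻¹' Ioc (1 / 2) 1 : Set I₀) ×ˢ univ : Set Q₀) := by
  ext q
  simp only [ΔQ, mem_ofPred_eq, mem_prod, mem_preimage, mem_Ioc, mem_univ,
    and_true, iff_self_and]
  exact fun _ => q.1.2.2

/-- The inverse branches outside the base. -/
def branchesA : InverseBranches lamQ h.sys ΔQᶜ where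
  θ i := Prod.map (h.leftInv i) (h.ι i)
  a i q := (lsvDeriv (expo α β i) (h.leftInv i q.1))⁻¹ * wt p₁ i
  measurable_θ i := (h.measurable_leftInv i).prodMap (h.measurable_ι i)
  measurable_a i := ((((measurable_lsvDeriv _).comp measurable_subtype_coe).comp
    ((h.measurable_leftInv i).comp measurable_fst)).inv).mul_const _
  a_nonneg i q := mul_nonneg (inv_nonneg.2 (zero_le_one.trans
    (one_le_lsvDeriv (h.expo_pos i) (h.leftInv i q.1).2.1.le))) (h.wt_pos i).le
  θ_mem i q := not_lt.2 (h.leftInv_mem i q.1).2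
  S_θ i q := by
    refine (h.sys_ι i (h.leftInv i q.1) q.2).trans (Prod.ext (Subtype.ext ?_) rfl)
    exact (lsv_of_le (h.leftInv_mem i q.1).2).trans (h.lsvLeft_leftInv i q.1)
  restrict_eq := by
    rw [compl_ΔQ]
    exact h.restrict_prod_eq (w := fun i y => (lsvDeriv (expo α β i) (h.leftInv i y))⁻¹)
      h.measurable_leftInv
      (fun i => ((measurable_lsvDeriv _).comp
        (measurable_subtype_coe.comp (h.measurable_leftInv i))).inv)
      (fun i y => inv_nonneg.2 (zero_le_one.trans
        (one_le_lsvDeriv (h.expo_pos i) (h.leftInv i y).2.1.le))) h.map_leftInv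

/-- The inverse branches in the base. -/
def branchesB : InverseBranches lamQ h.sys ΔQ where
  θ i := Prod.map rightInv (h.ι i)
  a i _ := 2⁻¹ * wt p₁ i
  measurable_θ i := measurable_rightInv.prodMap (h.measurable_ι i)
  measurable_a i := measurable_const
  a_nonneg i q := mul_nonneg (by norm_num) (h.wt_pos i).le
  θ_mem i q := show (1 / 2 : ℝ) < (1 + q.1) / 2 by linarith [q.1.2.1]
  S_θ i q := by
    refine (h.sys_ι i (rightInv q.1) q.2).trans (Prod.ext (Subtype.ext ?_) rfl)
    refine (lsv_of_lt (show (1 / 2 : ℝ) < (1 + q.1) / 2 by linarith [q.1.2.1])).trans ?_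
    ring
  restrict_eq := by
    rw [ΔQ_eq]
    exact h.restrict_prod_eq (w := fun _ _ => 2⁻¹) (fun _ => measurable_rightInv)
      (fun _ => measurable_const) (fun _ _ => by norm_num) fun _ => map_rightInv

theorem sys_fst_of_notMem {q : Q₀} (hq : q ∉ ΔQ) :
    ((h.sys q).1 : ℝ) = lsvLeft (alphaOf α β p₁ q.2) q.1 := lsv_of_le (not_lt.1 hq)

theorem escape_sys_le {q : Q₀} (hq : q ∉ ΔQ) :
    escape β (h.sys q).1 ≤ escape β q.1 - escapeRate β := by
  rw [h.sys_fst_of_notMem hq]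
  exact escape_lsvLeft_le (h.alphaOf_le _) h.β_pos h.β_lt.le q.1.2.1 (not_lt.1 hq)

theorem exists_iterate_mem (q : Q₀) : ∃ n, h.sys^[n] q ∈ ΔQ := by
  by_contra hcon
  push Not at hcon
  have h1 : ∀ n : ℕ, escape β (h.sys^[n] q).1 ≤ escape β q.1 - n * escapeRate β := by
    intro n
    induction n with
    | zero => simp
    | succ n ih =>
      rw [Function.iterate_succ_apply']
      refine (h.escape_sys_le (hcon n)).trans ?_
      push_cast
      linarith
  obtain ⟨n, hn⟩ := exists_nat_ge (escape β q.1 / escapeRate β)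
  rw [div_le_iff₀ (escapeRate_pos h.β_pos)] at hn
  linarith [h1 n, escape_pos (b := β) (h.sys^[n] q).1.2.1]

open Classical in
/-- The hitting time of the base. -/
def hit (q : Q₀) : ℕ := Nat.find (h.exists_iterate_mem q)

theorem measurable_hit : Measurable h.hit := by
  classical
  exact measurable_find h.exists_iterate_mem fun k =>
    (h.measurable_sys.iterate k) measurableSet_ΔQ

theorem hit_of_mem {q : Q₀} (hq : q ∈ ΔQ) : h.hit q = 0 := by
  classical
  exact (Nat.find_eq_zero _).2 hq

theorem hit_of_notMem {q : Q₀} (hq : q ∉ ΔQ) : h.hit q = h.hit (h.sys q) + 1 := by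
  classical
  exact Nat.find_comp_succ _ _ hq

theorem hit_le_escape (q : Q₀) : escapeRate β * h.hit q ≤ escape β q.1 := by
  induction hn : h.hit q generalizing q with
  | zero => simpa using (escape_pos (b := β) q.1.2.1).le
  | succ n ih =>
    have hq : q ∉ ΔQ := fun hq => by simp [h.hit_of_mem hq] at hn
    rw [h.hit_of_notMem hq] at hn
    have := ih (h.sys q) (by omega)
    have := h.escape_sys_le hq
    push_cast
    linarith

/-- Integration against the noise, split according to its first symbol. -/
theorem integral_noise {F : J₀ → ℝ} (hF : Measurable F) {C : ℝ} (hC : ∀ ξ, |F ξ| ≤ C) :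
    ∫ ξ, F ξ ∂subvol J₀ = ∑ i, wt p₁ i * ∫ ξ, F (h.ι i ξ) ∂subvol J₀ := by
  have h1 : subvol J₀ = ∑ i, (ENNReal.ofReal (wt p₁ i) • subvol J₀).map (h.ι i) := by
    conv_lhs => rw [sum_restrict_noise (p₁ := p₁)]
    simp only [← h.map_ι, withDensity_const]
  have h2 : ∀ i, Integrable (fun ξ => F (h.ι i ξ)) (subvol J₀) := fun i =>
    Integrable.of_bound (hF.comp (h.measurable_ι i)).aestronglyMeasurable C
      (ae_of_all _ fun ξ => hC _)
  conv_lhs => rw [h1]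
  rw [integral_finsetSum_measure]
  · refine Finset.sum_congr rfl fun i _ => ?_
    rw [integral_map (h.measurable_ι i).aemeasurable hF.aestronglyMeasurable,
      integral_smul_measure, ENNReal.toReal_ofReal (h.wt_pos i).le, smul_eq_mul]
  · intro i _
    rw [integrable_map_measure hF.aestronglyMeasurable (h.measurable_ι i).aemeasurable]
    exact (h2 i).smul_measure ENNReal.ofReal_ne_top

/-- Mean of `F` over the noises for which the point has not hit the base up to time `N`. -/
def survive (N : ℕ) (x : I₀) (F : J₀ → ℝ) : ℝ :=
  ∫ ξ, {ξ | N < h.hit (x, ξ)}.indicator F ξ ∂subvol J₀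

theorem measurableSet_survive (N : ℕ) (x : I₀) : MeasurableSet {ξ | N < h.hit (x, ξ)} :=
  measurableSet_lt measurable_const (h.measurable_hit.comp (by fun_prop))

theorem lt_hit_iff (N : ℕ) (q : Q₀) : N + 1 < h.hit q ↔ q ∉ ΔQ ∧ N < h.hit (h.sys q) := by
  by_cases hq : q ∈ ΔQ
  · simp [hq, h.hit_of_mem hq]
  · simp [hq, h.hit_of_notMem hq]

theorem zero_lt_hit_iff (q : Q₀) : 0 < h.hit q ↔ q ∉ ΔQ := by
  by_cases hq : q ∈ ΔQ
  · simp [hq, h.hit_of_mem hq]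
  · simp [hq, h.hit_of_notMem hq]

theorem survive_of_lt (N : ℕ) {x : I₀} (hx : 1 / 2 < (x : ℝ)) (F : J₀ → ℝ) :
    h.survive N x F = 0 := by
  have h1 : ∀ ξ, {ξ | N < h.hit (x, ξ)}.indicator F ξ = 0 := fun ξ =>
    indicator_of_notMem (by
      have : h.hit (x, ξ) = 0 := h.hit_of_mem hx
      simp [this]) _
  simp [survive, h1]

theorem survive_zero {x : I₀} (hx : (x : ℝ) ≤ 1 / 2) (F : J₀ → ℝ) :
    h.survive 0 x F = ∫ ξ, F ξ ∂subvol J₀ := by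
  refine integral_congr_ae (ae_of_all _ fun ξ => ?_)
  exact indicator_of_mem (s := {ξ | 0 < h.hit (x, ξ)})
    ((h.zero_lt_hit_iff _).2 hx.not_gt) _

theorem survive_succ (N : ℕ) {x : I₀} (hx : (x : ℝ) ≤ 1 / 2) {F : J₀ → ℝ} (hF : Measurable F)
    {C : ℝ} (hC : ∀ ξ, |F ξ| ≤ C) : h.survive (N + 1) x F
      = ∑ i, wt p₁ i * h.survive N (h.fib i x) fun ξ => F (h.ι i ξ) := by
  rw [survive, h.integral_noise (C := C) (hF.indicator (h.measurableSet_survive _ _)) fun ξ => ?_]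
  · refine Finset.sum_congr rfl fun i _ => ?_
    congr 1
    refine integral_congr_ae (ae_of_all _ fun ξ => ?_)
    have h1 : N + 1 < h.hit (x, h.ι i ξ) ↔ N < h.hit (h.fib i x, ξ) := by
      rw [h.lt_hit_iff, h.sys_ι]
      exact and_iff_right hx.not_gt
    simp only [indicator, mem_ofPred_eq, h1]
  · by_cases h1 : ξ ∈ {ξ | N + 1 < h.hit (x, ξ)}
    · rw [indicator_of_mem h1]; exact hC ξ
    · rw [indicator_of_notMem h1, abs_zero]; exact (abs_nonneg _).trans (hC ξ)

end IsParam

/-- The elementary inequality behind the polynomial decay of hitting times. -/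
theorem lyapunov_step {p c z z₁ z₂ b : ℝ} (hp : 0 ≤ p) (hp1 : p ≤ 1) (hc : 0 ≤ c) (hcz : c ≤ z)
    (hz : 0 < z) (hz₁ : 0 ≤ z₁) (hz₂ : 0 ≤ z₂) (h1 : z₁ ≤ z - c) (h2 : z₂ ≤ z) (hb : 0 < b)
    (hzb : z ≤ b + c * p / 2) :
    p * (z₁ / b) ^ 2 + (1 - p) * (z₂ / b) ^ 2 ≤ (z / (b + c * p / 2)) ^ 2 := by
  have hcp : 0 ≤ c * p / 2 := by positivity
  have e1 : z₁ ^ 2 ≤ (z - c) ^ 2 := pow_le_pow_left₀ hz₁ h1 2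
  have e2 : z₂ ^ 2 ≤ z ^ 2 := pow_le_pow_left₀ hz₂ h2 2
  have e3 : p * z₁ ^ 2 + (1 - p) * z₂ ^ 2 ≤ z * (z - 2 * (c * p / 2)) := by
    nlinarith [mul_le_mul_of_nonneg_left e1 hp, mul_le_mul_of_nonneg_left e2 (sub_nonneg.2 hp1),
      mul_nonneg (mul_nonneg hp hc) (sub_nonneg.2 hcz)]
  generalize c * p / 2 = ε at *
  have e4 : (z - 2 * ε) * (b + ε) ^ 2 ≤ z * b ^ 2 := by
    nlinarith [mul_nonneg hcp (mul_nonneg hb.le (sub_nonneg.2 hzb)), mul_nonneg hcp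
      (mul_nonneg hcp (sub_nonneg.2 hzb)), mul_nonneg (mul_nonneg hcp hcp) hcp,
      mul_nonneg (mul_nonneg hcp hcp) hb.le]
  have e5 : p * (z₁ / b) ^ 2 + (1 - p) * (z₂ / b) ^ 2
      = (p * z₁ ^ 2 + (1 - p) * z₂ ^ 2) / b ^ 2 := by field_simp
  rw [e5, div_pow, div_le_div_iff₀ (by positivity) (by positivity)]
  calc _ ≤ z * (z - 2 * ε) * (b + ε) ^ 2 := by gcongr
    _ = z * ((z - 2 * ε) * (b + ε) ^ 2) := by ring
    _ ≤ z * (z * b ^ 2) := by gcongr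
    _ = _ := by ring

theorem lintegral_rpow_Ioc_lt_top {r : ℝ} (hr : -1 < r) :
    ∫⁻ x : I₀, ENNReal.ofReal ((x : ℝ) ^ r) ∂subvol I₀ < ⊤ := by
  have h1 : ∫⁻ x : I₀, ENNReal.ofReal ((x : ℝ) ^ r) ∂subvol I₀
      = ∫⁻ x in I₀, ENNReal.ofReal (x ^ r) :=
    lintegral_subtype_comap measurableSet_Ioc fun x : ℝ => ENNReal.ofReal (x ^ r)
  rw [h1]
  have h2 : IntegrableOn (fun x : ℝ => x ^ r) I₀ :=
    (intervalIntegrable_iff_integrableOn_Ioc_of_le zero_le_one).1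
      (intervalIntegral.intervalIntegrable_rpow' hr)
  exact h2.lintegral_lt_top

namespace IsParam

variable {α β p₁ : ℝ} (h : IsParam α β p₁)
include h

theorem survive_one_nonneg (N : ℕ) (x : I₀) : 0 ≤ h.survive N x fun _ => 1 :=
  integral_nonneg fun _ => indicator_nonneg (fun _ _ => zero_le_one) _

theorem survive_one_le_one (N : ℕ) (x : I₀) : (h.survive N x fun _ => 1) ≤ 1 := by
  rw [survive, integral_indicator_const _ (h.measurableSet_survive N x), smul_eq_mul, mul_one]
  exact measureReal_le_one

theorem survive_one_le_sq (N : ℕ) (x : I₀) : (h.survive N x fun _ => 1)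
    ≤ ((escape α x + 1) / (escapeRate α * p₁ / 2 * N + 1)) ^ 2 := by
  have hα := h.α_pos
  have hc := escapeRate_pos hα
  have hc1 : escapeRate α ≤ 1 := by
    have : (0 : ℝ) < 2 ^ α := by positivity
    rw [escapeRate, div_le_one this]; linarith
  have hp := h.p_pos
  induction N generalizing x with
  | zero =>
    refine (h.survive_one_le_one 0 x).trans ?_
    rw [Nat.cast_zero, mul_zero, zero_add, div_one]
    exact one_le_pow₀ (by linarith [escape_pos (b := α) x.2.1])
  | succ N ih =>
    have hU := escape_pos (b := α) x.2.1
    rcases lt_or_ge (1 / 2) (x : ℝ) with hx | hx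
    · rw [h.survive_of_lt _ hx]; positivity
    have hb : 0 < escapeRate α * p₁ / 2 * N + 1 := by positivity
    have heq : escapeRate α * p₁ / 2 * ((N + 1 : ℕ) : ℝ) + 1
        = (escapeRate α * p₁ / 2 * N + 1) + escapeRate α * p₁ / 2 := by push_cast; ring
    rw [heq]
    rcases le_total (escape α x + 1) ((escapeRate α * p₁ / 2 * N + 1) + escapeRate α * p₁ / 2)
      with hle | hle
    · rw [h.survive_succ N hx measurable_const (C := 1) (fun _ => by simp), Fintype.sum_bool]
      have h1 := ih (h.fib true x)
      have h2 := ih (h.fib false x)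
      have e1 : escape α (h.fib true x) ≤ escape α x - escapeRate α := by
        have : (h.fib true x : ℝ) = lsvLeft α x := lsv_of_le hx
        rw [this]
        exact escape_lsvLeft_le le_rfl hα (h.α_le.trans h.β_lt.le) x.2.1 hx
      have e2 : escape α (h.fib false x) ≤ escape α x := by
        have : (h.fib false x : ℝ) = lsvLeft β x := lsv_of_le hx
        rw [this]
        exact escape_anti hα x.2.1 (le_lsvLeft x.2.1.le)
      have u1 := escape_pos (b := α) (h.fib true x).2.1
      have u2 := escape_pos (b := α) (h.fib false x).2.1
      refine le_trans ?_ (lyapunov_step hp.le h.p_lt.le hc.le (z := escape α x + 1)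
        (z₁ := escape α (h.fib true x) + 1) (z₂ := escape α (h.fib false x) + 1)
        (by linarith) (by linarith) (by linarith) (by linarith) (by linarith) (by linarith) hb hle)
      exact add_le_add (mul_le_mul_of_nonneg_left h1 hp.le)
        (mul_le_mul_of_nonneg_left h2 (sub_nonneg.2 h.p_lt.le))
    · refine (h.survive_one_le_one _ x).trans (one_le_pow₀ ?_)
      rwa [one_le_div (by positivity)]

/-- Polynomial decay of hitting times. -/
theorem exists_measure_lt_hit_le {s : ℝ} (hs0 : 0 ≤ s) (hs2 : s ≤ 2) (hs : α * s < 1) :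
    ∃ C : ℝ, 0 ≤ C ∧ ∀ N : ℕ,
      lamQ {q | N < h.hit q} ≤ ENNReal.ofReal (C * ((N : ℝ) + 1) ^ (-s)) := by
  have hα := h.α_pos
  have hc := escapeRate_pos hα
  have hp := h.p_pos
  set ε := escapeRate α * p₁ / 2 with hε
  have hε0 : 0 < ε := by positivity
  have hε1 : ε ≤ 1 := by
    have hc1 : escapeRate α ≤ 1 := by
      have : (0 : ℝ) < 2 ^ α := by positivity
      rw [escapeRate, div_le_one this]; linarith
    nlinarith [h.p_lt]
  have hI := lintegral_rpow_Ioc_lt_top (r := -(α * s)) (by linarith)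
  set I := ∫⁻ x : I₀, ENNReal.ofReal ((x : ℝ) ^ (-(α * s))) ∂subvol I₀
  refine ⟨(3 / ε) ^ s * I.toReal, by positivity, fun N => ?_⟩
  have hm : MeasurableSet {q : Q₀ | N < h.hit q} :=
    measurableSet_lt measurable_const h.measurable_hit
  rw [Measure.prod_apply hm]
  have key : ∀ x : I₀, subvol J₀ (Prod.mk x ⁻¹' {q | N < h.hit q})
      ≤ ENNReal.ofReal ((3 / ε) ^ s * ((N : ℝ) + 1) ^ (-s))
        * ENNReal.ofReal ((x : ℝ) ^ (-(α * s))) := by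
    intro x
    have hx := x.2.1
    have hN : (0 : ℝ) < (N : ℝ) + 1 := by positivity
    have e0 : subvol J₀ (Prod.mk x ⁻¹' {q | N < h.hit q})
        = ENNReal.ofReal (h.survive N x fun _ => 1) := by
      rw [survive, integral_indicator_const _ (h.measurableSet_survive N x), smul_eq_mul, mul_one,
        ofReal_measureReal]
      rfl
    rw [e0, ← ENNReal.ofReal_mul (by positivity)]
    refine ENNReal.ofReal_le_ofReal ?_
    have hUx : escape α x ≤ (x : ℝ) ^ (-α) := by
      rw [escape, Real.rpow_neg hx.le]
      have : (x : ℝ) ^ α ≤ (2 * x) ^ α := by gcongr; linarith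
      gcongr
    have hx1 : 1 ≤ (x : ℝ) ^ (-α) :=
      Real.one_le_rpow_of_pos_of_le_one_of_nonpos hx x.2.2 (by linarith)
    have hU := escape_pos (b := α) hx
    have h1 : (escape α x + 1) / (ε * N + 1)
        ≤ 3 / ε * ((N : ℝ) + 1)⁻¹ * (x : ℝ) ^ (-α) := by
      have : ε * ((N : ℝ) + 1) ≤ ε * N + 1 := by linarith
      calc _ ≤ (3 * (x : ℝ) ^ (-α)) / (ε * ((N : ℝ) + 1)) := by gcongr; linarith
        _ = _ := by field_simp
    have h0 : 0 ≤ (escape α x + 1) / (ε * N + 1) := by positivity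
    have h2 : (h.survive N x fun _ => 1) ≤ ((escape α x + 1) / (ε * N + 1)) ^ s := by
      rcases le_total 1 ((escape α x + 1) / (ε * N + 1)) with h3 | h3
      · exact (h.survive_one_le_one N x).trans (Real.one_le_rpow h3 hs0)
      · refine (h.survive_one_le_sq N x).trans ?_
        rw [← Real.rpow_natCast]
        exact Real.rpow_le_rpow_of_exponent_ge (by positivity) h3 (by exact_mod_cast hs2)
    refine h2.trans ((Real.rpow_le_rpow h0 h1 hs0).trans_eq ?_)
    rw [Real.mul_rpow (by positivity) (by positivity), Real.mul_rpow (by positivity)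
      (by positivity), ← Real.rpow_neg_one, ← Real.rpow_mul hN.le, ← Real.rpow_mul hx.le]
    ring_nf
  refine (lintegral_mono key).trans_eq ?_
  rw [lintegral_const_mul' _ _ ENNReal.ofReal_ne_top]
  calc ENNReal.ofReal ((3 / ε) ^ s * ((N : ℝ) + 1) ^ (-s)) * I
      = ENNReal.ofReal ((3 / ε) ^ s * ((N : ℝ) + 1) ^ (-s)) * ENNReal.ofReal I.toReal := by
        rw [ENNReal.ofReal_toReal hI.ne]
    _ = _ := by
        rw [← ENNReal.ofReal_mul (by positivity)]
        congr 1
        ring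

/-- Integrability of additive functions of the hitting time. -/
theorem lintegral_sum_range_hit_ne_top {s : ℝ} (hs0 : 0 ≤ s) (hs2 : s ≤ 2) (hs : α * s < 1)
    {a : ℕ → ℝ} (ha : ∀ n, 0 ≤ a n) (hsum : Summable fun n : ℕ => a n * ((n : ℝ) + 1) ^ (-s)) :
    ∫⁻ q, ENNReal.ofReal (∑ n ∈ Finset.range (h.hit q), a n) ∂lamQ ≠ ⊤ := by
  obtain ⟨C, hC, hN⟩ := h.exists_measure_lt_hit_le hs0 hs2 hs
  have hm : ∀ N, MeasurableSet {q : Q₀ | N < h.hit q} := fun N =>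
    measurableSet_lt measurable_const h.measurable_hit
  have e1 : ∀ q, ENNReal.ofReal (∑ n ∈ Finset.range (h.hit q), a n)
      = ∑' n, {q | n < h.hit q}.indicator (fun _ => ENNReal.ofReal (a n)) q := by
    intro q
    rw [ENNReal.ofReal_sum_of_nonneg fun n _ => ha n, tsum_eq_sum (s := Finset.range (h.hit q))]
    · refine Finset.sum_congr rfl fun n hn => ?_
      rw [indicator_of_mem (by exact Finset.mem_range.1 hn)]
    · intro n hn
      exact indicator_of_notMem (s := {q | n < h.hit q})
        (fun h' => hn (Finset.mem_range.2 h')) (fun _ => ENNReal.ofReal (a n))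
  simp only [e1]
  rw [lintegral_tsum fun n => (measurable_const.indicator (hm n)).aemeasurable]
  refine ne_top_of_le_ne_top ((hsum.mul_left C).tsum_ofReal_ne_top) (ENNReal.tsum_le_tsum ?_)
  intro n
  rw [lintegral_indicator_const (hm n)]
  refine (mul_le_mul_right (hN n) _).trans_eq ?_
  rw [← ENNReal.ofReal_mul (ha n)]
  congr 1
  ring

theorem lintegral_hit_ne_top : ∫⁻ q, (h.hit q : ENNReal) ∂lamQ ≠ ⊤ := by
  have hα := h.α_pos
  have hα1 : α < 1 := h.α_le.trans_lt h.β_lt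
  set s := min 2 ((1 + α⁻¹) / 2) with hs
  have h1 : 1 < α⁻¹ := (one_lt_inv₀ hα).2 hα1
  have hs1 : 1 < s := lt_min one_lt_two (by linarith)
  have h2 : α * s < 1 := by
    have : α * s ≤ α * ((1 + α⁻¹) / 2) := mul_le_mul_of_nonneg_left (min_le_right _ _) hα.le
    have e : α * ((1 + α⁻¹) / 2) = (α + 1) / 2 := by field_simp
    linarith
  have := h.lintegral_sum_range_hit_ne_top (s := s) (by linarith) (min_le_left _ _) h2
    (a := fun _ => 1) (fun _ => zero_le_one) (by
      simp only [one_mul]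
      have := (summable_nat_add_iff 1).2 (Real.summable_nat_rpow.2 (neg_lt_neg hs1))
      simpa using this)
  simpa using this

end IsParam

/-- Integration against bounded Lipschitz functions determines a bounded function. -/
theorem ae_eq_zero_of_forall_lipschitzWith {X : Type*} [PseudoMetricSpace X] [MeasurableSpace X]
    [BorelSpace X] {μ : Measure X} [IsFiniteMeasure μ] {g : X → ℝ} (hg : Measurable g) {C : ℝ}
    (hC : ∀ x, |g x| ≤ C)
    (h : ∀ (w : X → ℝ) (L : NNReal), LipschitzWith L w → (∀ x, |w x| ≤ 1) →
      ∫ x, w x * g x ∂μ = 0) : ∀ᵐ x ∂μ, g x = 0 := by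
  refine ae_eq_zero_of_forall_setIntegral_isClosed_eq_zero
    (Integrable.of_bound hg.aestronglyMeasurable C (ae_of_all _ hC)) fun F hF => ?_
  have hδ : ∀ n : ℕ, (0 : ℝ) < 1 / (n + 1) := fun n => by positivity
  have hlim := tendsto_pi_nhds.1
    (thickenedIndicator_tendsto_indicator_closure hδ tendsto_one_div_add_atTop_nhds_zero_nat F)
  rw [hF.closure_eq] at hlim
  have h1 : ∀ n x, (thickenedIndicator (hδ n) F x : ℝ) ≤ 1 := fun n x =>
    NNReal.coe_le_one.2 (thickenedIndicator_le_one (hδ n) F x)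
  have h2 : Tendsto (fun n => ∫ x, (thickenedIndicator (hδ n) F x : ℝ) * g x ∂μ) atTop
      (𝓝 (∫ x, F.indicator g x ∂μ)) := by
    refine tendsto_integral_of_dominated_convergence (fun _ => C) (fun n => ?_)
      (integrable_const C) (fun n => ae_of_all _ fun x => ?_) (ae_of_all _ fun x => ?_)
    · exact ((NNReal.continuous_coe.comp (thickenedIndicator (hδ n) F).continuous).measurable.mul
        hg).aestronglyMeasurable
    · rw [Real.norm_eq_abs, abs_mul, NNReal.abs_eq]
      exact (mul_le_of_le_one_left (abs_nonneg _) (h1 n x)).trans (hC x)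
    · have := ((NNReal.continuous_coe.tendsto _).comp (hlim x)).mul_const (g x)
      have e : F.indicator g x = ((F.indicator (fun _ => 1) x : NNReal) : ℝ) * g x := by
        by_cases hx : x ∈ F
        · rw [indicator_of_mem hx, indicator_of_mem hx]; simp
        · rw [indicator_of_notMem hx, indicator_of_notMem hx]; simp
      rw [e]
      exact this
  have h3 : ∀ n, ∫ x, (thickenedIndicator (hδ n) F x : ℝ) * g x ∂μ = 0 := fun n =>
    h _ _ (lipschitzWith_thickenedIndicator (hδ n) F) fun x => by
      rw [NNReal.abs_eq]; exact h1 n x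
  rw [integral_indicator hF.measurableSet] at h2
  exact tendsto_nhds_unique h2 (by simp only [h3]; exact tendsto_const_nhds)

/-- A snowflaked distance on the phase space. -/
def qdist (t : ℝ) (q q' : Q₀) : ℝ :=
  |(q.1 : ℝ) - q'.1| ^ t + |(q.2 : ℝ) - q'.2| ^ t

theorem abs_sub_le_one_of_mem_I₀ (y y' : I₀) : |(y : ℝ) - y'| ≤ 1 := by
  rw [abs_sub_le_iff]
  constructor <;> linarith [y.2.1, y.2.2, y'.2.1, y'.2.2]

theorem abs_sub_le_one_of_mem_J₀ (ξ ξ' : J₀) : |(ξ : ℝ) - ξ'| ≤ 1 := by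
  rw [abs_sub_le_iff]
  constructor <;> linarith [ξ.2.1, ξ.2.2, ξ'.2.1, ξ'.2.2]

theorem qdist_nonneg (t : ℝ) (q q' : Q₀) : 0 ≤ qdist t q q' := by unfold qdist; positivity

theorem qdist_le {t : ℝ} (ht : 0 ≤ t) (q q' : Q₀) : qdist t q q' ≤ 2 := by
  have h1 := Real.rpow_le_one (abs_nonneg _) (abs_sub_le_one_of_mem_I₀ q.1 q'.1) ht
  have h2 := Real.rpow_le_one (abs_nonneg _) (abs_sub_le_one_of_mem_J₀ q.2 q'.2) ht
  unfold qdist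
  linarith

theorem dist_rpow_le_qdist {t : ℝ} (q q' : Q₀) : dist q q' ^ t ≤ qdist t q q' := by
  rw [Prod.dist_eq, Subtype.dist_eq, Subtype.dist_eq, Real.dist_eq, Real.dist_eq, qdist]
  rcases max_choice |(q.1 : ℝ) - q'.1| |(q.2 : ℝ) - q'.2| with h | h <;> rw [h]
  · exact le_add_of_nonneg_right (by positivity)
  · exact le_add_of_nonneg_left (by positivity)

theorem abs_sub_le_qdist {t : ℝ} (ht1 : t ≤ 1) (q q' : Q₀) :
    |(q.1 : ℝ) - q'.1| ≤ qdist t q q' := by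
  refine le_trans ?_ (le_add_of_nonneg_right (by positivity))
  rcases (abs_nonneg ((q.1 : ℝ) - q'.1)).eq_or_lt with h0 | h0
  · rw [← h0]; positivity
  · simpa using Real.rpow_le_rpow_of_exponent_ge h0 (abs_sub_le_one_of_mem_I₀ q.1 q'.1) ht1

theorem dist_le_qdist {t : ℝ} (ht1 : t ≤ 1) (q q' : Q₀) :
    dist q q' ≤ qdist t q q' := by
  refine le_trans ?_ (dist_rpow_le_qdist q q')
  rcases (dist_nonneg (x := q) (y := q')).eq_or_lt with h0 | h0
  · rw [← h0]; positivity
  · have h1 : dist q q' ≤ 1 := by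
      rw [Prod.dist_eq, Subtype.dist_eq, Subtype.dist_eq, Real.dist_eq, Real.dist_eq]
      exact max_le (abs_sub_le_one_of_mem_I₀ q.1 q'.1) (abs_sub_le_one_of_mem_J₀ q.2 q'.2)
    simpa using Real.rpow_le_rpow_of_exponent_ge h0 h1 ht1

/-- The distortion of the left branches. -/
def distort (q q' : Q₀) : ℝ := max 1 (((q'.1 : ℝ) / q.1) ^ 2)

theorem distort_le_exp {q q' : Q₀} (hq : q ∈ ΔQ) :
    distort q q' ≤ Real.exp (4 * |(q.1 : ℝ) - q'.1|) := by
  have hq : 1 / 2 < (q.1 : ℝ) := hq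
  have hy := q.1.2.1
  have hy' := q'.1.2.1
  have h1 : (q'.1 : ℝ) / q.1 ≤ Real.exp (2 * |(q.1 : ℝ) - q'.1|) := by
    refine le_trans ?_ (Real.add_one_le_exp _)
    rw [div_le_iff₀ hy]
    have h3 : (q'.1 : ℝ) - q.1 ≤ |(q.1 : ℝ) - q'.1| := by
      rw [abs_sub_comm]; exact le_abs_self _
    nlinarith [abs_nonneg ((q.1 : ℝ) - q'.1)]
  refine max_le (Real.one_le_exp (by positivity)) ?_
  calc _ ≤ Real.exp (2 * |(q.1 : ℝ) - q'.1|) ^ 2 := by gcongr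
    _ = _ := by rw [← Real.exp_nat_mul]; congr 1; push_cast; ring

theorem distort_le (q q' : Q₀) : distort q q' ≤ ((q.1 : ℝ) ^ 2)⁻¹ := by
  have hy := q.1.2.1
  have hy' := q'.1.2.1
  have h1 : (q.1 : ℝ) ^ 2 ≤ 1 := pow_le_one₀ hy.le q.1.2.2
  have h2 : (q'.1 : ℝ) ^ 2 ≤ 1 := pow_le_one₀ hy'.le q'.1.2.2
  refine max_le ((one_le_inv₀ (by positivity)).2 h1) ?_
  rw [div_pow, div_eq_mul_inv]
  exact mul_le_of_le_one_left (by positivity) h2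

theorem distort_of_le {q q' : Q₀} (hq : q'.1 ≤ q.1) : distort q q' = 1 :=
  max_eq_left (pow_le_one₀ (div_nonneg q'.1.2.1.le q.1.2.1.le)
    ((div_le_one q.1.2.1).2 hq))

theorem distort_of_ge {q q' : Q₀} (hq : q.1 ≤ q'.1) :
    distort q q' = ((q'.1 : ℝ) / q.1) ^ 2 :=
  max_eq_right (one_le_pow₀ ((one_le_div q.1.2.1).2 hq))

namespace IsParam

variable {α β p₁ : ℝ} (h : IsParam α β p₁)
include h

theorem abs_leftInv_sub_le (i : Bool) (y y' : I₀) :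
    |(h.leftInv i y : ℝ) - h.leftInv i y'| ≤ |(y : ℝ) - y'| := by
  wlog hy : y' ≤ y generalizing y y'
  · rw [abs_sub_comm, abs_sub_comm (y : ℝ)]
    exact this y' y (le_of_not_ge hy)
  have h1 : (h.leftInv i y' : ℝ) ≤ h.leftInv i y := h.leftInv_mono i hy
  have h2 : (y' : ℝ) ≤ y := hy
  rw [abs_of_nonneg (sub_nonneg.2 h1), abs_of_nonneg (sub_nonneg.2 h2)]
  have h3 := sub_le_lsvLeft_sub (h.expo_pos i) (h.leftInv i y').2.1.le h1
  rwa [lsvLeft_leftInv, lsvLeft_leftInv] at h3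

theorem abs_ι_sub (i : Bool) (ξ ξ' : J₀) :
    |(h.ι i ξ : ℝ) - h.ι i ξ'| = wt p₁ i * |(ξ : ℝ) - ξ'| := by
  have : (h.ι i ξ : ℝ) - h.ι i ξ' = wt p₁ i * ((ξ : ℝ) - ξ') := by
    simp only [ι]; ring
  rw [this, abs_mul, abs_of_pos (h.wt_pos i)]

theorem distort_branchesA_le (i : Bool) (q q' : Q₀) :
    h.branchesA.a i q * distort (h.branchesA.θ i q) (h.branchesA.θ i q')
      ≤ h.branchesA.a i q' * distort q q' := by
  have hw := h.wt_pos i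
  have hx := (h.leftInv i q.1).2.1
  have hx' := (h.leftInv i q'.1).2.1
  have hd := zero_lt_one.trans_le (one_le_lsvDeriv (h.expo_pos i) hx'.le)
  change (lsvDeriv (expo α β i) (h.leftInv i q.1))⁻¹ * wt p₁ i * _
    ≤ (lsvDeriv (expo α β i) (h.leftInv i q'.1))⁻¹ * wt p₁ i * _
  rcases le_total q'.1 q.1 with hq | hq
  · have h1 := h.leftInv_mono i hq
    rw [distort_of_le hq, distort_of_le (by exact h1), mul_one, mul_one]
    exact mul_le_mul_of_nonneg_right
      (inv_anti₀ hd (lsvDeriv_le (h.expo_pos i) hx'.le (by exact h1))) hw.le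
  · have h1 := h.leftInv_mono i hq
    rw [distort_of_ge hq, distort_of_ge (by exact h1)]
    have h2 := lsvLeft_distortion (h.expo_pos i) ((h.expo_le i).trans h.β_lt.le) hx
      (by exact h1 : (h.leftInv i q.1 : ℝ) ≤ h.leftInv i q'.1)
    rw [lsvLeft_leftInv, lsvLeft_leftInv] at h2
    rw [mul_right_comm, mul_right_comm _ (wt p₁ i)]
    exact mul_le_mul_of_nonneg_right h2 hw.le

theorem distort_branchesB_le (i : Bool) (q q' : Q₀) :
    distort (h.branchesB.θ i q) (h.branchesB.θ i q') ≤ distort q q' := by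
  have hy := q.1.2.1
  have hy' := q'.1.2.1
  refine max_le (le_max_left _ _) ?_
  change (((1 + (q'.1 : ℝ)) / 2) / ((1 + (q.1 : ℝ)) / 2)) ^ 2 ≤ _
  rcases le_total q'.1 q.1 with hq | hq
  · have hq : (q'.1 : ℝ) ≤ q.1 := hq
    refine le_max_of_le_left (pow_le_one₀ (by positivity) ?_)
    rw [div_le_one (by positivity)]
    linarith
  · have hq : (q.1 : ℝ) ≤ q'.1 := hq
    refine le_max_of_le_right ?_
    gcongr ?_ ^ 2
    rw [div_le_div_iff₀ (by positivity) (by positivity)]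
    nlinarith

omit h in
/-- The contraction rate of the inverse branches in the base. -/
def rate (p₁ t : ℝ) : ℝ := max (1 / 2) (max p₁ (1 - p₁)) ^ t

omit h in
theorem rate_nonneg (p₁ t : ℝ) : 0 ≤ rate p₁ t :=
  Real.rpow_nonneg (le_max_of_le_left (by norm_num)) t

theorem rate_lt_one {t : ℝ} (ht : 0 < t) : rate p₁ t < 1 := by
  refine Real.rpow_lt_one (le_max_of_le_left (by norm_num)) ?_ ht
  have := h.p_pos
  have := h.p_lt
  exact max_lt (by norm_num) (max_lt h.p_lt (by linarith))

theorem abs_ι_sub_rpow_le {t : ℝ} (ht : 0 < t) (i : Bool) (ξ ξ' : J₀) :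
    |(h.ι i ξ : ℝ) - h.ι i ξ'| ^ t ≤ rate p₁ t * |(ξ : ℝ) - ξ'| ^ t := by
  rw [h.abs_ι_sub, Real.mul_rpow (h.wt_pos i).le (abs_nonneg _), rate]
  have := (wt_le (p₁ := p₁) i).trans (le_max_right (1 / 2) _)
  have := (h.wt_pos i).le
  gcongr

/-- The skew product as a system with first returns to `ΔQ`. -/
def returnSystem {t : ℝ} (ht : 0 < t) (ht1 : t ≤ 1) : FirstReturnSystem lamQ h.sys ΔQ where
  A := h.branchesA
  B := h.branchesB
  H := h.hit
  d := qdist t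
  c := distort
  M q := ((q.1 : ℝ) ^ 2)⁻¹
  d₀ := 2
  κ := rate p₁ t
  D := 4
  measurable_S := h.measurable_sys
  measurableSet_Δ := measurableSet_ΔQ
  measure_Δ_ne_zero := by
    rw [ΔQ_eq, lamQ, Measure.prod_prod, measure_univ, mul_one,
      comap_subtype_coe_apply measurableSet_Ioc, Subtype.image_preimage_coe,
      inter_eq_self_of_subset_right (Ioc_subset_Ioc_left (by norm_num))]
    norm_num
  measurable_H := h.measurable_hit
  H_of_mem _ hq := h.hit_of_mem hq
  H_of_notMem _ hq := h.hit_of_notMem hq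
  lintegral_H_ne_top := h.lintegral_hit_ne_top
  d_nonneg := qdist_nonneg t
  d_le := qdist_le ht.le
  κ_nonneg := rate_nonneg p₁ t
  κ_lt_one := h.rate_lt_one ht
  D_nonneg := by norm_num
  d_A_le i q q' := by
    refine add_le_add (Real.rpow_le_rpow (abs_nonneg _) (h.abs_leftInv_sub_le i q.1 q'.1) ht.le)
      ((h.abs_ι_sub_rpow_le ht i q.2 q'.2).trans ?_)
    exact mul_le_of_le_one_left (by positivity) (h.rate_lt_one ht).le
  d_B_le i q q' := by
    rw [qdist, qdist, mul_add]
    refine add_le_add ?_ (h.abs_ι_sub_rpow_le ht i q.2 q'.2)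
    change |(1 + (q.1 : ℝ)) / 2 - (1 + q'.1) / 2| ^ t ≤ _
    have : (1 + (q.1 : ℝ)) / 2 - (1 + q'.1) / 2 = 1 / 2 * ((q.1 : ℝ) - q'.1) := by ring
    rw [this, abs_mul, Real.mul_rpow (abs_nonneg _) (abs_nonneg _), rate,
      abs_of_pos (by norm_num : (0 : ℝ) < 1 / 2)]
    gcongr
    exact le_max_left _ _
  one_le_c _ _ := le_max_left _ _
  c_A_le := h.distort_branchesA_le
  c_B_le := h.distort_branchesB_le
  c_le_exp q hq q' _ := (distort_le_exp hq).trans (Real.exp_le_exp.2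
    (mul_le_mul_of_nonneg_left (abs_sub_le_qdist ht1 q q') (by norm_num)))
  c_le_M q q' _ := distort_le q q'
  B_a_const _ _ _ := rfl
  B_a_pos i _ := mul_pos (by norm_num) (h.wt_pos i)

theorem separating_returnSystem {t : ℝ} (ht : 0 < t) (ht1 : t ≤ 1) :
    (h.returnSystem ht ht1).Separating := by
  rintro g hg ⟨C, hC⟩ hw
  refine ae_eq_zero_of_forall_lipschitzWith hg hC fun w L hL hw1 =>
    hw w hL.continuous.measurable ⟨1, hw1⟩ ⟨L, L.coe_nonneg, fun q q' => ?_⟩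
  have h1 := hL.dist_le_mul q q'
  rw [Real.dist_eq] at h1
  have h2 := mul_le_mul_of_nonneg_left (dist_le_qdist ht1 q q') L.coe_nonneg
  change w q ≤ w q' + (L : ℝ) * qdist t q q'
  linarith [le_abs_self (w q - w q')]

end IsParam

/-- Partial sums of `n ^ (-δ)`. -/
theorem sum_rpow_neg_le {δ : ℝ} (hδ0 : 0 < δ) (hδ1 : δ < 1) (n : ℕ) :
    ∑ k ∈ Finset.range n, ((k : ℝ) + 1) ^ (-δ) ≤ (n : ℝ) ^ (1 - δ) / (1 - δ) := by
  have h0 : 0 < 1 - δ := sub_pos.2 hδ1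
  induction n with
  | zero => simp [Real.zero_rpow h0.ne']
  | succ n ih =>
    rw [Finset.sum_range_succ]
    refine (add_le_add_left ih _).trans ?_
    rw [div_add' _ _ _ h0.ne', div_le_div_iff_of_pos_right h0]
    push_cast
    have hm : (0 : ℝ) < (n : ℝ) + 1 := by positivity
    have e : (n : ℝ) = ((n : ℝ) + 1) * (1 + -((n : ℝ) + 1)⁻¹) := by field_simp; ring
    have h1 : (1 + -((n : ℝ) + 1)⁻¹) ^ (1 - δ) ≤ 1 + (1 - δ) * -((n : ℝ) + 1)⁻¹ :=
      rpow_one_add_le_one_add_mul_self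
        (neg_le_neg (inv_le_one_of_one_le₀ (by linarith [n.cast_nonneg (α := ℝ)]))) h0.le
        (by linarith)
    have h2 : (n : ℝ) ^ (1 - δ)
        ≤ ((n : ℝ) + 1) ^ (1 - δ) * (1 + (1 - δ) * -((n : ℝ) + 1)⁻¹) := by
      conv_lhs => rw [e]
      rw [Real.mul_rpow hm.le]
      · gcongr
      · rw [← sub_eq_add_neg, sub_nonneg]
        exact inv_le_one_of_one_le₀ (by linarith [n.cast_nonneg (α := ℝ)])
    have h3 : ((n : ℝ) + 1) ^ (-δ) = ((n : ℝ) + 1) ^ (1 - δ) * ((n : ℝ) + 1)⁻¹ := by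
      rw [← Real.rpow_neg_one, ← Real.rpow_add hm]; congr 1; ring
    rw [h3]
    linarith

namespace IsParam

variable {α β p₁ : ℝ} (h : IsParam α β p₁)
include h

theorem rpow_le_hit {γ : ℝ} (hγ : 0 < γ) {q : Q₀} (hq : 0 < h.hit q) :
    (q.1 : ℝ) ^ γ ≤ escapeRate β ^ (-(γ / β)) * (h.hit q : ℝ) ^ (-(γ / β)) := by
  have hβ := h.β_pos
  have hε := escapeRate_pos hβ
  have hx := q.1.2.1
  have hn : (0 : ℝ) < h.hit q := Nat.cast_pos.2 hq
  have h1 := h.hit_le_escape q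
  rw [escape, le_inv_comm₀ (by positivity) (by positivity)] at h1
  calc (q.1 : ℝ) ^ γ ≤ (2 * (q.1 : ℝ)) ^ γ := by gcongr; linarith
    _ = ((2 * (q.1 : ℝ)) ^ β) ^ (γ / β) := by
        rw [← Real.rpow_mul (by positivity), mul_div_cancel₀ _ hβ.ne']
    _ ≤ ((escapeRate β * h.hit q)⁻¹) ^ (γ / β) := by gcongr
    _ = _ := by
        rw [Real.inv_rpow (by positivity), ← Real.rpow_neg (by positivity),
          Real.mul_rpow hε.le hn.le]

/-- Observables vanishing fast enough at the fixed point have square integrable excursion sums. -/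
theorem lintegral_sq_W_ne_top_of_le_rpow {t : ℝ} (ht : 0 < t) (ht1 : t ≤ 1) (hα : 1 / 2 ≤ α)
    {γ C : ℝ} (hγ : β / α * (α - 1 / 2) < γ) (hγβ : γ < β) {r : Q₀ → ℝ}
    (hr : ∀ q, |r q| ≤ C * (q.1 : ℝ) ^ γ) :
    ∫⁻ q, ENNReal.ofReal ((h.returnSystem ht ht1).W r q ^ 2) ∂lamQ ≠ ⊤ := by
  have hα0 := h.α_pos
  have hβ := h.β_pos
  have hε := escapeRate_pos hβ
  have hγ0 : 0 < γ := lt_of_le_of_lt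
    (mul_nonneg (div_nonneg hβ.le hα0.le) (sub_nonneg.2 hα)) hγ
  have hC : 0 ≤ C := by
    let q : Q₀ := (⟨1, by norm_num⟩, ⟨0, by norm_num⟩)
    have h1 : |r q| ≤ C * (1 : ℝ) ^ γ := hr q
    rw [Real.one_rpow, mul_one] at h1
    exact (abs_nonneg _).trans h1
  set δ := γ / β with hδ
  have hδ0 : 0 < δ := div_pos hγ0 hβ
  have hδ1 : δ < 1 := (div_lt_one hβ).2 hγβ
  have hδα : 2 - 2 * δ < α⁻¹ := by
    have : α⁻¹ * (α - 1 / 2) < δ := by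
      rw [hδ, lt_div_iff₀ hβ]
      calc _ = β / α * (α - 1 / 2) := by ring
        _ < _ := hγ
    have e : α⁻¹ * (α - 1 / 2) = 1 - α⁻¹ / 2 := by field_simp
    linarith
  set s := (2 - 2 * δ + min 2 α⁻¹) / 2 with hs
  have hmin : 2 - 2 * δ < min 2 α⁻¹ := lt_min (by linarith) hδα
  have hs2 : s ≤ 2 := by linarith [min_le_left 2 α⁻¹]
  have hs0 : 2 - 2 * δ < s := by linarith
  have hsα : α * s < 1 := by
    have : s < α⁻¹ := by linarith [min_le_right 2 α⁻¹]
    calc α * s < α * α⁻¹ := by gcongr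
      _ = 1 := mul_inv_cancel₀ hα0.ne'
  let G : ℕ → ℝ := fun n => ∑ k ∈ Finset.range n, ((k : ℝ) + 1) ^ (-δ)
  have hG0 : ∀ n, 0 ≤ G n := fun n => Finset.sum_nonneg fun k _ => by positivity
  have hGs : ∀ n, G (n + 1) = G n + ((n : ℝ) + 1) ^ (-δ) := fun n => Finset.sum_range_succ _ _
  have hGm : ∀ n, G n ≤ G (n + 1) := fun n => by
    rw [hGs]; exact le_add_of_nonneg_right (by positivity)
  let a : ℕ → ℝ := fun n => G (n + 1) ^ 2 - G n ^ 2
  have ha : ∀ n, 0 ≤ a n := fun n => sub_nonneg.2 (pow_le_pow_left₀ (hG0 n) (hGm n) 2)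
  have hab : ∀ n : ℕ, a n ≤ 2 / (1 - δ) * ((n : ℝ) + 1) ^ (1 - 2 * δ) := by
    intro n
    have hm : (0 : ℝ) < (n : ℝ) + 1 := by positivity
    have h1 := sum_rpow_neg_le hδ0 hδ1 (n + 1)
    push_cast at h1
    have h2 : a n ≤ ((n : ℝ) + 1) ^ (-δ) * (2 * G (n + 1)) := by
      have : a n = (G (n + 1) - G n) * (G (n + 1) + G n) := by ring
      rw [this]
      have h3 : G (n + 1) - G n = ((n : ℝ) + 1) ^ (-δ) := by rw [hGs]; ring
      rw [h3]
      have := hGm n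
      gcongr
      linarith
    refine h2.trans ?_
    calc _ ≤ ((n : ℝ) + 1) ^ (-δ) * (2 * (((n : ℝ) + 1) ^ (1 - δ) / (1 - δ))) := by gcongr
      _ = 2 / (1 - δ) * (((n : ℝ) + 1) ^ (-δ) * ((n : ℝ) + 1) ^ (1 - δ)) := by ring
      _ = _ := by rw [← Real.rpow_add hm]; ring_nf
  have hsum : Summable fun n : ℕ => a n * ((n : ℝ) + 1) ^ (-s) := by
    have h1 : Summable fun n : ℕ => ((n : ℝ) + 1) ^ (1 - 2 * δ - s) := by
      have := (summable_nat_add_iff 1).2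
        (Real.summable_nat_rpow (p := 1 - 2 * δ - s).2 (by linarith))
      simpa using this
    refine Summable.of_nonneg_of_le (fun n => mul_nonneg (ha n) (by positivity)) (fun n => ?_)
      (h1.mul_left (2 / (1 - δ)))
    have hm : (0 : ℝ) < (n : ℝ) + 1 := by positivity
    calc _ ≤ 2 / (1 - δ) * ((n : ℝ) + 1) ^ (1 - 2 * δ) * ((n : ℝ) + 1) ^ (-s) := by
          gcongr; exact hab n
      _ = _ := by rw [mul_assoc, ← Real.rpow_add hm, ← sub_eq_add_neg]
  have hatop := h.lintegral_sum_range_hit_ne_top (by linarith : 0 ≤ s) hs2 hsα ha hsum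
  set c₀ := C * escapeRate β ^ (-δ)
  have hc₀ : 0 ≤ c₀ := by positivity
  have hW : ∀ n q, h.hit q = n → |(h.returnSystem ht ht1).W r q| ≤ c₀ * G n := by
    intro n
    induction n with
    | zero =>
      intro q hq
      have : (h.returnSystem ht ht1).W r q = birkhoffSum h.sys r (h.hit q) q := rfl
      rw [this, hq, birkhoffSum_zero, abs_zero]
      exact mul_nonneg hc₀ (hG0 0)
    | succ n ih =>
      intro q hq
      have hqn : q ∉ ΔQ := (h.zero_lt_hit_iff q).1 (by omega)
      have hq' := h.hit_of_notMem hqn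
      rw [FirstReturnSystem.W_of_notMem _ r hqn, hGs, mul_add, add_comm]
      refine (abs_add_le _ _).trans (add_le_add (ih _ (by omega)) ((hr q).trans ?_))
      have h1 := h.rpow_le_hit hγ0 (q := q) (by omega)
      rw [hq] at h1
      push_cast at h1
      rw [mul_assoc]
      exact mul_le_mul_of_nonneg_left h1 hC
  have hle : ∀ q, ENNReal.ofReal ((h.returnSystem ht ht1).W r q ^ 2)
      ≤ ENNReal.ofReal (c₀ ^ 2) * ENNReal.ofReal (∑ n ∈ Finset.range (h.hit q), a n) := by
    intro q
    rw [← ENNReal.ofReal_mul (by positivity)]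
    refine ENNReal.ofReal_le_ofReal ?_
    have : ∑ n ∈ Finset.range (h.hit q), a n = G (h.hit q) ^ 2 := by
      rw [Finset.sum_range_sub fun n => G n ^ 2]
      simp [G]
    rw [this, ← mul_pow, ← sq_abs]
    exact pow_le_pow_left₀ (abs_nonneg _) (hW _ q rfl) 2
  refine ne_top_of_le_ne_top ?_ (lintegral_mono hle)
  rw [lintegral_const_mul' _ _ ENNReal.ofReal_ne_top]
  exact ENNReal.mul_ne_top ENNReal.ofReal_ne_top hatop

end IsParam

namespace IsParam

variable {α β p₁ : ℝ} (h : IsParam α β p₁)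
include h

omit h in
theorem integrable_noise {F : J₀ → ℝ} (hF : Measurable F) {C : ℝ} (hC : ∀ ξ, |F ξ| ≤ C) :
    Integrable F (subvol J₀) :=
  Integrable.of_bound hF.aestronglyMeasurable C (ae_of_all _ hC)

theorem survive_add (N : ℕ) (x : I₀) {F G : J₀ → ℝ} (hF : Integrable F (subvol J₀))
    (hG : Integrable G (subvol J₀)) :
    h.survive N x (fun ξ => F ξ + G ξ) = h.survive N x F + h.survive N x G := by
  have hm := h.measurableSet_survive N x
  rw [survive, survive, survive, ← integral_add (hF.indicator hm) (hG.indicator hm)]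
  congr 1
  funext ξ
  simp only [indicator]
  split_ifs <;> simp

theorem survive_le (N : ℕ) (x : I₀) {F : J₀ → ℝ} (hF : Measurable F) {C : ℝ}
    (hC : ∀ ξ, |F ξ| ≤ C) : h.survive N x F ≤ C * h.survive N x fun _ => 1 := by
  have hm := h.measurableSet_survive N x
  rw [survive, survive, ← integral_const_mul]
  refine integral_mono ((integrable_noise hF hC).indicator hm)
    (((integrable_const 1).indicator hm).const_mul C) fun ξ => ?_
  simp only [indicator]
  split_ifs
  · rw [mul_one]; exact (le_abs_self _).trans (hC ξ)
  · simp

omit h in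
/-- Measurable functions of the noise which are Hölder continuous. -/
structure Holder (t l : ℝ) (θ : J₀ → ℝ) : Prop where
  measurable : Measurable θ
  le : ∀ ξ ξ', |θ ξ - θ ξ'| ≤ l * |(ξ : ℝ) - ξ'| ^ t

omit h in
theorem Holder.exists_abs_le {t l : ℝ} (ht : 0 ≤ t) (hl : 0 ≤ l) {θ : J₀ → ℝ}
    (hθ : Holder t l θ) : ∃ C, ∀ ξ, |θ ξ| ≤ C := by
  refine ⟨|θ ⟨0, by norm_num⟩| + l, fun ξ => ?_⟩
  have h1 := hθ.le ξ ⟨0, by norm_num⟩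
  have h2 : |(ξ : ℝ) - (⟨0, by norm_num⟩ : J₀)| ^ t ≤ 1 :=
    Real.rpow_le_one (abs_nonneg _) (abs_sub_le_one_of_mem_J₀ _ _) ht
  have h3 := abs_add_le (θ ξ - θ ⟨0, by norm_num⟩) (θ ⟨0, by norm_num⟩)
  rw [sub_add_cancel] at h3
  nlinarith

theorem Holder.comp_ι {t l : ℝ} (ht : 0 < t) (hl : 0 ≤ l) {θ : J₀ → ℝ} (hθ : Holder t l θ)
    (i : Bool) : Holder t (l * rate p₁ t) fun ξ => θ (h.ι i ξ) :=
  ⟨hθ.measurable.comp (h.measurable_ι i), fun ξ ξ' => (hθ.le _ _).trans (by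
    rw [mul_assoc]; exact mul_le_mul_of_nonneg_left (h.abs_ι_sub_rpow_le ht i ξ ξ') hl)⟩

theorem measurable_iterate_shift (N : ℕ) : Measurable h.shift^[N] := h.measurable_shift.iterate N

theorem iterate_shift_ι (N : ℕ) (i : Bool) (ξ : J₀) :
    h.shift^[N + 1] (h.ι i ξ) = h.shift^[N] ξ := by
  rw [Function.iterate_succ_apply, h.shift_ι]

theorem survive_one_succ (N : ℕ) {x : I₀} (hx : (x : ℝ) ≤ 1 / 2) :
    (h.survive (N + 1) x fun _ => 1)
      = ∑ i, wt p₁ i * h.survive N (h.fib i x) fun _ => 1 :=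
  h.survive_succ N hx measurable_const (C := 1) fun _ => by simp

/-- Decay of correlations of the noise along surviving orbits. -/
theorem abs_survive_mul_comp_le {t : ℝ} (ht : 0 < t) {ψ : J₀ → ℝ} (hψ : Measurable ψ) {F : ℝ}
    (hF : ∀ ξ, |ψ ξ| ≤ F) (hψ0 : ∫ ξ, ψ ξ ∂subvol J₀ = 0) (N : ℕ) :
    ∀ (x : I₀) {l : ℝ} (_ : 0 ≤ l) {θ : J₀ → ℝ} (_ : Holder t l θ),
      |h.survive N x fun ξ => θ ξ * ψ (h.shift^[N] ξ)|
        ≤ l * rate p₁ t ^ N * F * h.survive N x fun _ => 1 := by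
  have hr := rate_nonneg p₁ t
  induction N with
  | zero =>
    intro x l hl θ hθ
    rcases lt_or_ge (1 / 2 : ℝ) x with hx | hx
    · rw [h.survive_of_lt _ hx, h.survive_of_lt _ hx]; simp
    obtain ⟨C, hC⟩ := hθ.exists_abs_le ht.le hl
    rw [h.survive_zero hx, h.survive_zero hx, integral_const, probReal_univ, one_smul, mul_one,
      pow_zero, mul_one]
    let ξ₀ : J₀ := ⟨0, by norm_num⟩
    have e : ∫ ξ, θ ξ * ψ (h.shift^[0] ξ) ∂subvol J₀
        = ∫ ξ, (θ ξ - θ ξ₀) * ψ ξ ∂subvol J₀ := by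
      simp only [Function.iterate_zero, id_eq, sub_mul]
      rw [integral_sub, integral_const_mul, hψ0, mul_zero, sub_zero]
      · exact integrable_noise (hθ.measurable.mul hψ) (C := C * F) fun ξ => by
          rw [abs_mul]
          exact mul_le_mul (hC ξ) (hF ξ) (abs_nonneg _) ((abs_nonneg _).trans (hC ξ))
      · exact (integrable_noise hψ hF).const_mul _
    rw [e]
    have h1 : ∀ ξ, ‖(θ ξ - θ ξ₀) * ψ ξ‖ ≤ l * F := fun ξ => by
      rw [Real.norm_eq_abs, abs_mul]
      refine mul_le_mul ((hθ.le _ _).trans (mul_le_of_le_one_right hl ?_)) (hF ξ) (abs_nonneg _) hl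
      exact Real.rpow_le_one (abs_nonneg _) (abs_sub_le_one_of_mem_J₀ _ _) ht.le
    have h2 := norm_integral_le_of_norm_le_const (μ := subvol J₀) (ae_of_all _ h1)
    rwa [probReal_univ, mul_one, Real.norm_eq_abs] at h2
  | succ N ih =>
    intro x l hl θ hθ
    rcases lt_or_ge (1 / 2 : ℝ) x with hx | hx
    · rw [h.survive_of_lt _ hx, h.survive_of_lt _ hx]; simp
    obtain ⟨C, hC⟩ := hθ.exists_abs_le ht.le hl
    rw [h.survive_succ N hx (C := C * F) (F := fun ξ => θ ξ * ψ (h.shift^[N + 1] ξ))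
      (hθ.measurable.mul (hψ.comp (h.measurable_iterate_shift (N + 1)))) fun ξ => by
        rw [abs_mul]
        exact mul_le_mul (hC ξ) (hF _) (abs_nonneg _) ((abs_nonneg _).trans (hC ξ)),
      h.survive_one_succ N hx, Finset.mul_sum]
    refine (Finset.abs_sum_le_sum_abs _ _).trans (Finset.sum_le_sum fun i _ => ?_)
    rw [abs_mul, abs_of_pos (h.wt_pos i)]
    simp only [iterate_shift_ι]
    refine (mul_le_mul_of_nonneg_left (ih (h.fib i x) (mul_nonneg hl hr)
      (Holder.comp_ι h ht hl hθ i)) (h.wt_pos i).le).trans_eq ?_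
    ring

theorem abs_birkhoffSum_shift_le {ψ : J₀ → ℝ} {F : ℝ} (hF : ∀ ξ, |ψ ξ| ≤ F) (N : ℕ) (ξ : J₀) :
    |birkhoffSum h.shift ψ N ξ| ≤ N * F := by
  refine (Finset.abs_sum_le_sum_abs _ _).trans
    ((Finset.sum_le_card_nsmul _ _ F fun k _ => hF _).trans_eq ?_)
  rw [Finset.card_range, nsmul_eq_mul]

theorem measurable_birkhoffSum_shift {ψ : J₀ → ℝ} (hψ : Measurable ψ) (N : ℕ) :
    Measurable (birkhoffSum h.shift ψ N) := measurable_birkhoffSum h.measurable_shift hψ N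

theorem abs_survive_birkhoffSum_mul_le {t l : ℝ} (ht : 0 < t) (hl : 0 ≤ l) {ψ : J₀ → ℝ}
    (hψ : Holder t l ψ) {F : ℝ} (hF : ∀ ξ, |ψ ξ| ≤ F) (hψ0 : ∫ ξ, ψ ξ ∂subvol J₀ = 0) (N : ℕ) :
    ∀ x : I₀, |h.survive N x fun ξ => birkhoffSum h.shift ψ N ξ * ψ (h.shift^[N] ξ)|
      ≤ (∑ k ∈ Finset.range N, rate p₁ t ^ (k + 1)) * (l * F) * h.survive N x fun _ => 1 := by
  have hr := rate_nonneg p₁ t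
  have hFψ : ∀ (N : ℕ) (ξ : J₀) (a b : ℝ) (A : ℝ), |a| ≤ A → |b| ≤ F → |a * b| ≤ A * F :=
    fun N ξ a b A ha hb => by
      rw [abs_mul]; exact mul_le_mul ha hb (abs_nonneg _) ((abs_nonneg _).trans ha)
  induction N with
  | zero =>
    intro x
    simp [survive]
  | succ N ih =>
    intro x
    rcases lt_or_ge (1 / 2 : ℝ) x with hx | hx
    · rw [h.survive_of_lt _ hx, h.survive_of_lt _ hx]; simp
    have hm := hψ.measurable.comp (h.measurable_iterate_shift N)
    rw [h.survive_succ N hx (C := ((N + 1 : ℕ) : ℝ) * F * F)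
      (F := fun ξ => birkhoffSum h.shift ψ (N + 1) ξ * ψ (h.shift^[N + 1] ξ))
      ((h.measurable_birkhoffSum_shift hψ.measurable (N + 1)).mul
        (hψ.measurable.comp (h.measurable_iterate_shift (N + 1)))) fun ξ =>
        hFψ N ξ _ _ _ (h.abs_birkhoffSum_shift_le hF (N + 1) ξ) (hF _),
      h.survive_one_succ N hx, Finset.mul_sum]
    refine (Finset.abs_sum_le_sum_abs _ _).trans (Finset.sum_le_sum fun i _ => ?_)
    rw [abs_mul, abs_of_pos (h.wt_pos i)]
    simp only [iterate_shift_ι, birkhoffSum_succ', h.shift_ι, add_mul]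
    rw [h.survive_add]
    · have h1 := h.abs_survive_mul_comp_le ht hψ.measurable hF hψ0 N (h.fib i x)
        (mul_nonneg hl hr) (Holder.comp_ι h ht hl hψ i)
      have h2 := (abs_add_le _ _).trans (add_le_add h1 (ih (h.fib i x)))
      refine (mul_le_mul_of_nonneg_left h2 (h.wt_pos i).le).trans_eq ?_
      rw [Finset.sum_range_succ]
      ring
    · exact integrable_noise ((hψ.measurable.comp (h.measurable_ι i)).mul hm) (C := F * F)
        fun ξ => hFψ N ξ _ _ _ (hF _) (hF _)
    · exact integrable_noise ((h.measurable_birkhoffSum_shift hψ.measurable N).mul hm)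
        (C := N * F * F) fun ξ => hFψ N ξ _ _ _ (h.abs_birkhoffSum_shift_le hF N ξ) (hF _)

theorem integral_sq_birkhoffSum_min_le {t l : ℝ} (ht : 0 < t) (hl : 0 ≤ l) {ψ : J₀ → ℝ}
    (hψ : Holder t l ψ) {F : ℝ} (hF : ∀ ξ, |ψ ξ| ≤ F) (hψ0 : ∫ ξ, ψ ξ ∂subvol J₀ = 0)
    (x : I₀) (N : ℕ) :
    ∫ ξ, birkhoffSum h.shift ψ (min (h.hit (x, ξ)) N) ξ ^ 2 ∂subvol J₀
      ≤ (2 * ((1 - rate p₁ t)⁻¹ * (l * F)) + F ^ 2)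
        * ∫ ξ, ((min (h.hit (x, ξ)) N : ℕ) : ℝ) ∂subvol J₀ := by
  have hr := rate_nonneg p₁ t
  have hr1 := h.rate_lt_one ht
  have hF0 : 0 ≤ F := (abs_nonneg _).trans (hF ⟨0, by norm_num⟩)
  have hH : Measurable fun ξ : J₀ => h.hit (x, ξ) := h.measurable_hit.comp (by fun_prop)
  have hmH : ∀ N, Measurable fun ξ : J₀ => min (h.hit (x, ξ)) N := fun N =>
    hH.min measurable_const
  have hmW : ∀ N, Measurable fun ξ : J₀ => birkhoffSum h.shift ψ (min (h.hit (x, ξ)) N) ξ := by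
    intro N
    have h1 : Measurable fun p : J₀ × ℕ => birkhoffSum h.shift ψ p.2 p.1 :=
      measurable_from_prod_countable_left fun n =>
        h.measurable_birkhoffSum_shift hψ.measurable n
    exact h1.comp (measurable_id.prodMk (hmH N))
  have hiW : ∀ N, Integrable
      (fun ξ : J₀ => birkhoffSum h.shift ψ (min (h.hit (x, ξ)) N) ξ ^ 2) (subvol J₀) := fun N =>
    integrable_noise ((hmW N).pow_const 2) (C := (N * F) ^ 2) fun ξ => by
      rw [abs_pow]
      refine pow_le_pow_left₀ (abs_nonneg _) ((h.abs_birkhoffSum_shift_le hF _ ξ).trans ?_) 2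
      gcongr
      exact min_le_right _ _
  have hiH : ∀ N, Integrable (fun ξ : J₀ => ((min (h.hit (x, ξ)) N : ℕ) : ℝ)) (subvol J₀) :=
    fun N => integrable_noise (measurable_from_top.comp (hmH N)) (C := N) fun ξ => by
      rw [Nat.abs_cast]
      exact_mod_cast min_le_right _ _
  induction N with
  | zero => simp
  | succ N ih =>
    set s := {ξ : J₀ | N < h.hit (x, ξ)} with hs
    have hms : MeasurableSet s := h.measurableSet_survive N x
    have e1 : ∀ ξ, birkhoffSum h.shift ψ (min (h.hit (x, ξ)) (N + 1)) ξ ^ 2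
        = birkhoffSum h.shift ψ (min (h.hit (x, ξ)) N) ξ ^ 2
          + s.indicator (fun ξ => 2 * (birkhoffSum h.shift ψ N ξ * ψ (h.shift^[N] ξ))
            + ψ (h.shift^[N] ξ) ^ 2) ξ := by
      intro ξ
      by_cases hξ : ξ ∈ s
      · have h1 : N < h.hit (x, ξ) := hξ
        rw [indicator_of_mem hξ, min_eq_right (Nat.succ_le_of_lt h1), min_eq_right h1.le,
          birkhoffSum_succ]
        ring
      · have h1 : h.hit (x, ξ) ≤ N := not_lt.1 hξ
        rw [indicator_of_notMem hξ, min_eq_left h1, min_eq_left (h1.trans N.le_succ), add_zero]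
    have e2 : ∀ ξ, ((min (h.hit (x, ξ)) (N + 1) : ℕ) : ℝ)
        = ((min (h.hit (x, ξ)) N : ℕ) : ℝ) + s.indicator (fun _ => 1) ξ := by
      intro ξ
      by_cases hξ : ξ ∈ s
      · have h1 : N < h.hit (x, ξ) := hξ
        rw [indicator_of_mem hξ, min_eq_right (Nat.succ_le_of_lt h1), min_eq_right h1.le]
        push_cast; rfl
      · have h1 : h.hit (x, ξ) ≤ N := not_lt.1 hξ
        rw [indicator_of_notMem hξ, min_eq_left h1, min_eq_left (h1.trans N.le_succ), add_zero]
    have hm := hψ.measurable.comp (h.measurable_iterate_shift N)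
    have hiQ : Integrable (fun ξ => 2 * (birkhoffSum h.shift ψ N ξ * ψ (h.shift^[N] ξ)))
        (subvol J₀) := by
      refine Integrable.const_mul (integrable_noise
        (F := fun ξ => birkhoffSum h.shift ψ N ξ * ψ (h.shift^[N] ξ))
        ((h.measurable_birkhoffSum_shift hψ.measurable N).mul hm) (C := N * F * F) fun ξ => ?_) 2
      rw [abs_mul]
      exact mul_le_mul (h.abs_birkhoffSum_shift_le hF N ξ) (hF _) (abs_nonneg _) (by positivity)
    have hψ2 : ∀ ξ, |ψ (h.shift^[N] ξ) ^ 2| ≤ F ^ 2 := fun ξ => by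
      rw [abs_pow]; exact pow_le_pow_left₀ (abs_nonneg _) (hF _) 2
    have hi2 : Integrable (fun ξ => ψ (h.shift^[N] ξ) ^ 2) (subvol J₀) :=
      integrable_noise (hm.pow_const 2) hψ2
    have hnn : 0 ≤ h.survive N x fun _ => 1 := h.survive_one_nonneg N x
    have h3 : (h.survive N x fun ξ => 2 * (birkhoffSum h.shift ψ N ξ * ψ (h.shift^[N] ξ))
        + ψ (h.shift^[N] ξ) ^ 2)
        ≤ (2 * ((1 - rate p₁ t)⁻¹ * (l * F)) + F ^ 2) * h.survive N x fun _ => 1 := by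
      rw [h.survive_add N x hiQ hi2, add_mul]
      refine add_le_add ?_ (h.survive_le N x (hm.pow_const 2) hψ2)
      have h4 := (le_abs_self _).trans (h.abs_survive_birkhoffSum_mul_le ht hl hψ hF hψ0 N x)
      have h5 : ∑ k ∈ Finset.range N, rate p₁ t ^ (k + 1) ≤ (1 - rate p₁ t)⁻¹ := by
        refine (Finset.sum_le_sum fun k _ => ?_).trans
          ((summable_geometric_of_lt_one hr hr1).sum_le_tsum (Finset.range N)
            (fun k _ => pow_nonneg hr k)) |>.trans_eq (tsum_geometric_of_lt_one hr hr1)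
        exact pow_le_pow_of_le_one hr hr1.le k.le_succ
      have h6 : (h.survive N x fun ξ => 2 * (birkhoffSum h.shift ψ N ξ * ψ (h.shift^[N] ξ)))
          = 2 * h.survive N x fun ξ => birkhoffSum h.shift ψ N ξ * ψ (h.shift^[N] ξ) := by
        rw [survive, survive, ← integral_const_mul]
        congr 1
        funext ξ
        simp only [indicator]
        split_ifs <;> simp
      rw [h6, mul_assoc]
      refine mul_le_mul_of_nonneg_left (h4.trans ?_) zero_le_two
      gcongr
    simp only [e1, e2]
    rw [integral_add (hiW N) (by exact (hiQ.add hi2).indicator hms),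
      integral_add (hiH N) ((integrable_const 1).indicator hms), mul_add]
    exact add_le_add ih h3

/-- Centred observables of the noise have square integrable excursion sums. -/
theorem lintegral_sq_W_ne_top_of_noise {t l : ℝ} (ht : 0 < t) (ht1 : t ≤ 1) (hl : 0 ≤ l)
    {ψ : J₀ → ℝ} (hψ : Holder t l ψ) (hψ0 : ∫ ξ, ψ ξ ∂subvol J₀ = 0) :
    ∫⁻ q, ENNReal.ofReal ((h.returnSystem ht ht1).W (fun q => ψ q.2) q ^ 2) ∂lamQ ≠ ⊤ := by
  obtain ⟨F, hF⟩ := hψ.exists_abs_le ht.le hl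
  set C := 2 * ((1 - rate p₁ t)⁻¹ * (l * F)) + F ^ 2
  let V : ℕ → Q₀ → ℝ := fun N q => birkhoffSum h.shift ψ (min (h.hit q) N) q.2
  have hmV : ∀ N, Measurable (V N) := by
    intro N
    have h1 : Measurable fun p : J₀ × ℕ => birkhoffSum h.shift ψ p.2 p.1 :=
      measurable_from_prod_countable_left fun n =>
        h.measurable_birkhoffSum_shift hψ.measurable n
    exact h1.comp (measurable_snd.prodMk (h.measurable_hit.min measurable_const))
  have hWV : ∀ q, (h.returnSystem ht ht1).W (fun q => ψ q.2) q = V (h.hit q) q := by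
    intro q
    change birkhoffSum h.sys (fun q => ψ q.2) (h.hit q) q
      = birkhoffSum h.shift ψ (min (h.hit q) (h.hit q)) q.2
    rw [min_self, birkhoffSum, birkhoffSum]
    refine Finset.sum_congr rfl fun k _ => ?_
    have : Function.Semiconj (Prod.snd : Q₀ → J₀) h.sys h.shift := fun _ => rfl
    exact congrArg ψ (this.iterate_right k q)
  have hlim : ∀ q, ENNReal.ofReal ((h.returnSystem ht ht1).W (fun q => ψ q.2) q ^ 2)
      = liminf (fun N => ENNReal.ofReal (V N q ^ 2)) atTop := by
    intro q
    rw [hWV]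
    refine (Tendsto.liminf_eq ?_).symm
    refine tendsto_const_nhds.congr' ?_
    filter_upwards [eventually_ge_atTop (h.hit q)] with N hN
    simp only [V]
    rw [min_self, min_eq_left hN]
  have hbound : ∀ N, ∫⁻ q, ENNReal.ofReal (V N q ^ 2) ∂lamQ
      ≤ ENNReal.ofReal C * ∫⁻ q, (h.hit q : ENNReal) ∂lamQ := by
    intro N
    rw [← lintegral_const_mul' _ _ ENNReal.ofReal_ne_top, lamQ,
      lintegral_prod _ ((hmV N).pow_const 2).ennreal_ofReal.aemeasurable,
      lintegral_prod _ (Measurable.aemeasurable (by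
        exact (measurable_from_top.comp h.measurable_hit).const_mul _))]
    refine lintegral_mono fun x => ?_
    have hm1 : Measurable fun ξ : J₀ => min (h.hit (x, ξ)) N :=
      (h.measurable_hit.comp (by fun_prop)).min measurable_const
    have hF0 : 0 ≤ F := (abs_nonneg _).trans (hF ⟨0, by norm_num⟩)
    have hC : 0 ≤ C := by
      have := sub_pos.2 (h.rate_lt_one ht)
      positivity
    rw [← ofReal_integral_eq_lintegral_ofReal]
    · refine (ENNReal.ofReal_le_ofReal
        (h.integral_sq_birkhoffSum_min_le ht hl hψ hF hψ0 x N)).trans ?_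
      rw [ENNReal.ofReal_mul hC, ofReal_integral_eq_lintegral_ofReal,
        lintegral_const_mul' _ _ ENNReal.ofReal_ne_top]
      · refine mul_le_mul_right (lintegral_mono fun ξ => ?_) _
        rw [ENNReal.ofReal_natCast]
        exact Nat.cast_le.2 (min_le_left _ _)
      · refine integrable_noise (measurable_from_top.comp hm1) (C := N) fun ξ => ?_
        rw [Nat.abs_cast]
        exact_mod_cast min_le_right _ _
      · exact ae_of_all _ fun ξ => Nat.cast_nonneg _
    · refine integrable_noise (((hmV N).comp (by fun_prop : Measurable (Prod.mk x))).pow_const 2)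
        (C := (N * F) ^ 2) fun ξ => ?_
      rw [abs_pow]
      refine pow_le_pow_left₀ (abs_nonneg _) ((h.abs_birkhoffSum_shift_le hF _ ξ).trans ?_) 2
      gcongr
      exact min_le_right _ _
    · exact ae_of_all _ fun ξ => sq_nonneg _
  simp only [hlim]
  refine ne_top_of_le_ne_top (ENNReal.mul_ne_top (ENNReal.ofReal_ne_top (r := C))
    h.lintegral_hit_ne_top) ((lintegral_liminf_le (f := fun N q => ENNReal.ofReal (V N q ^ 2))
      fun N => ((hmV N).pow_const 2).ennreal_ofReal).trans ?_)
  exact (liminf_le_liminf (Eventually.of_forall hbound)).trans_eq (liminf_const _)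

theorem integrable_sq_W {t : ℝ} (ht : 0 < t) (ht1 : t ≤ 1) (hα : 1 / 2 ≤ α) {γ C l : ℝ}
    (hγ : β / α * (α - 1 / 2) < γ) (hl : 0 ≤ l) {ψ : J₀ → ℝ} (hψ : Holder t l ψ)
    (hψ0 : ∫ ξ, ψ ξ ∂subvol J₀ = 0) {f : Q₀ → ℝ} (hf : Measurable f)
    (hr : ∀ q, |f q - ψ q.2| ≤ C * (q.1 : ℝ) ^ γ) :
    Integrable (fun q => (h.returnSystem ht ht1).W f q ^ 2) lamQ := by
  have hα0 := h.α_pos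
  have hβ := h.β_pos
  have hthr : β / α * (α - 1 / 2) < β := by
    rw [div_mul_eq_mul_div, div_lt_iff₀ hα0]
    nlinarith
  have hC : 0 ≤ C := by
    let q : Q₀ := (⟨1, by norm_num⟩, ⟨0, by norm_num⟩)
    have h1 : |f q - ψ q.2| ≤ C * (1 : ℝ) ^ γ := hr q
    rw [Real.one_rpow, mul_one] at h1
    exact (abs_nonneg _).trans h1
  have h1 := h.lintegral_sq_W_ne_top_of_noise ht ht1 hl hψ hψ0
  have h2 := h.lintegral_sq_W_ne_top_of_le_rpow ht ht1 hα
    (γ := min γ ((β / α * (α - 1 / 2) + β) / 2)) (C := C) (r := fun q => f q - ψ q.2)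
    (lt_min hγ (by linarith)) ((min_le_right _ _).trans_lt (by linarith)) fun q => (hr q).trans
      (mul_le_mul_of_nonneg_left (Real.rpow_le_rpow_of_exponent_ge q.1.2.1 q.1.2.2
        (min_le_left _ _)) hC)
  have hW : ∀ q, (h.returnSystem ht ht1).W f q = (h.returnSystem ht ht1).W (fun q => ψ q.2) q
      + (h.returnSystem ht ht1).W (fun q => f q - ψ q.2) q := by
    intro q
    simp only [FirstReturnSystem.W, birkhoffSum]
    rw [← Finset.sum_add_distrib]
    exact Finset.sum_congr rfl fun k _ => (add_sub_cancel _ _).symm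
  have hm1 : Measurable ((h.returnSystem ht ht1).W fun q => ψ q.2) :=
    (h.returnSystem ht ht1).measurable_W (hψ.measurable.comp measurable_snd)
  refine ⟨(((h.returnSystem ht ht1).measurable_W hf).pow_const 2).aestronglyMeasurable, ?_⟩
  rw [hasFiniteIntegral_iff_ofReal (ae_of_all _ fun q => sq_nonneg _)]
  refine lt_of_le_of_lt (lintegral_mono fun q => ?_ : _ ≤ ∫⁻ q,
    (2 * ENNReal.ofReal ((h.returnSystem ht ht1).W (fun q => ψ q.2) q ^ 2)
      + 2 * ENNReal.ofReal ((h.returnSystem ht ht1).W (fun q => f q - ψ q.2) q ^ 2)) ∂lamQ) ?_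
  · have h2 : (2 : ENNReal) = ENNReal.ofReal 2 := by simp
    rw [h2, ← ENNReal.ofReal_mul zero_le_two, ← ENNReal.ofReal_mul zero_le_two,
      ← ENNReal.ofReal_add (by positivity) (by positivity), hW]
    refine ENNReal.ofReal_le_ofReal ?_
    linarith [add_sq_le (a := (h.returnSystem ht ht1).W (fun q => ψ q.2) q)
      (b := (h.returnSystem ht ht1).W (fun q => f q - ψ q.2) q)]
  · rw [lintegral_add_left ((hm1.pow_const 2).ennreal_ofReal.const_mul 2),
      lintegral_const_mul' _ _ ENNReal.ofNat_ne_top, lintegral_const_mul' _ _ ENNReal.ofNat_ne_top]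
    exact ENNReal.add_lt_top.2 ⟨ENNReal.mul_lt_top ENNReal.ofNat_lt_top h1.lt_top,
      ENNReal.mul_lt_top ENNReal.ofNat_lt_top h2.lt_top⟩

end IsParam

theorem continuous_of_abs_sub_le_dist_rpow {X : Type*} [PseudoMetricSpace X] {g : X → ℝ}
    {C t : ℝ} (ht : 0 < t) (hg : ∀ x y, |g x - g y| ≤ C * dist x y ^ t) : Continuous g := by
  refine continuous_iff_continuousAt.2 fun y => tendsto_iff_dist_tendsto_zero.2 ?_
  refine squeeze_zero (fun _ => dist_nonneg) (fun x => hg x y) ?_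
  have h1 : Tendsto (fun x => dist x y) (𝓝 y) (𝓝 0) := tendsto_iff_dist_tendsto_zero.1 tendsto_id
  have h2 := (h1.rpow_const (Or.inr ht.le)).const_mul C
  rwa [Real.zero_rpow ht.ne', mul_zero] at h2

/-- The inclusion of the phase space in the plane. -/
def incl : Q₀ → ℝ × ℝ := Prod.map Subtype.val Subtype.val

theorem measurableEmbedding_incl : MeasurableEmbedding incl :=
  (MeasurableEmbedding.subtype_coe measurableSet_Ioc).prodMap
    (MeasurableEmbedding.subtype_coe measurableSet_Ico)

theorem range_incl : range incl = I₀ ×ˢ J₀ := by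
  rw [incl, range_prodMap, Subtype.range_coe, Subtype.range_coe]

theorem map_incl_lamQ : lamQ.map incl = (volume : Measure (ℝ × ℝ)).restrict (I₀ ×ˢ J₀) := by
  rw [lamQ, incl, ← Measure.map_prod_map _ _ measurable_subtype_coe measurable_subtype_coe,
    subvol, subvol, map_comap_subtype_coe measurableSet_Ioc,
    map_comap_subtype_coe measurableSet_Ico, Measure.prod_restrict, Measure.volume_eq_prod]

theorem ae_mem_range_incl {ν : Measure (ℝ × ℝ)} (hac : ν ≪ (volume : Measure (ℝ × ℝ)))
    (hsupp : ν ((Icc (0 : ℝ) 1 ×ˢ Icc (0 : ℝ) 1)ᶜ) = 0) : ∀ᵐ p ∂ν, p ∈ range incl := by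
  have h1 : ∀ᵐ p ∂ν, p ∈ Icc (0 : ℝ) 1 ×ˢ Icc (0 : ℝ) 1 := hsupp
  have h2 : ∀ᵐ p : ℝ × ℝ, p.1 ≠ 0 :=
    Measure.quasiMeasurePreserving_fst.ae (Measure.ae_ne volume 0)
  have h3 : ∀ᵐ p : ℝ × ℝ, p.2 ≠ 1 :=
    Measure.quasiMeasurePreserving_snd.ae (Measure.ae_ne volume 1)
  filter_upwards [h1, hac.ae_le h2, hac.ae_le h3] with p hp hp1 hp2
  rw [range_incl]
  exact ⟨⟨hp.1.1.lt_of_ne' hp1, hp.1.2⟩, hp.2.1, hp.2.2.lt_of_ne hp2⟩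

namespace IsParam

variable {α β p₁ : ℝ} (h : IsParam α β p₁)
include h

theorem semiconj_incl : Function.Semiconj incl h.sys (skewLSV α β p₁) := fun _ => rfl

theorem birkhoff_incl (f : ℝ × ℝ → ℝ) (n : ℕ) (q : Q₀) :
    birkhoff α β p₁ f n (incl q) = birkhoffSum h.sys (f ∘ incl) n q :=
  Finset.sum_congr rfl fun k _ => congrArg f (h.semiconj_incl.iterate_right k q).symm

end IsParam

/-- Theorem 3.2 (2): CLT for `1/2 ≤ α < 1` when `c = ∫ f(0,ω) dω = 0`
and `f` is sufficiently regular at the fixed point. -/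
theorem clt_large_alpha_c_zero (α β p₁ : ℝ) (hα : 1 / 2 ≤ α) (hαβ : α < β) (hβ : β < 1)
    (hp₁ : 0 < p₁) (hp₁' : p₁ < 1)
    (ν : Measure (ℝ × ℝ)) (hprob : IsProbabilityMeasure ν)
    (hac : ν ≪ (volume : Measure (ℝ × ℝ)))
    (hsupp : ν ((Icc (0 : ℝ) 1 ×ˢ Icc (0 : ℝ) 1)ᶜ) = 0)
    (hinv : ∀ A : Set (ℝ × ℝ), MeasurableSet A → ν (skewLSV α β p₁ ⁻¹' A) = ν A)
    (f : ℝ × ℝ → ℝ)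
    (hf : ∃ C t : ℝ, 0 < t ∧ t ≤ 1 ∧
      ∀ p ∈ Icc (0 : ℝ) 1 ×ˢ Icc (0 : ℝ) 1, ∀ q ∈ Icc (0 : ℝ) 1 ×ˢ Icc (0 : ℝ) 1,
        |f p - f q| ≤ C * dist p q ^ t)
    (hf0 : (∫ p, f p ∂ν) = 0)
    (hc : (∫ ω in Icc (0 : ℝ) 1, f (0, ω)) = 0)
    (γ Cf : ℝ) (hγ : β / α * (α - 1 / 2) < γ)
    (hreg : ∀ x ∈ Icc (0 : ℝ) 1, ∀ ω ∈ Icc (0 : ℝ) 1, |f (x, ω) - f (0, ω)| ≤ Cf * x ^ γ) :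
    ∃ σ2 : NNReal, ∀ g : BoundedContinuousFunction ℝ ℝ,
      Tendsto (fun n : ℕ => ∫ p, g (birkhoff α β p₁ f n p / Real.sqrt n) ∂ν) atTop
        (𝓝 (∫ x, g x ∂(ProbabilityTheory.gaussianReal 0 σ2))) := by
  have h : IsParam α β p₁ := ⟨by linarith, hαβ.le, hβ, hp₁, hp₁'⟩
  obtain ⟨C, t, ht, ht1, hf⟩ := hf
  have hj := measurableEmbedding_incl
  have hrange := ae_mem_range_incl hac hsupp
  have hmap : (ν.comap incl).map incl = ν := by
    rw [hj.map_comap, Measure.restrict_eq_self_of_ae_mem hrange]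
  have hprob' : IsProbabilityMeasure (ν.comap incl) := by
    constructor
    have h1 := congrArg (fun m => m univ) hmap
    simp only [hj.map_apply, preimage_univ, measure_univ] at h1
    exact h1
  have hskew : ν.map (skewLSV α β p₁) = ν := by
    ext A hA
    rw [Measure.map_apply IsParam.measurable_skewLSV hA, hinv A hA]
  have hpres : MeasurePreserving h.sys (ν.comap incl) (ν.comap incl) := by
    refine ⟨h.measurable_sys, ?_⟩
    rw [← hj.comap_map ((ν.comap incl).map h.sys), Measure.map_map hj.measurable h.measurable_sys,
      h.semiconj_incl.comp_eq, ← Measure.map_map IsParam.measurable_skewLSV hj.measurable,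
      hmap, hskew]
  have hac' : ν.comap incl ≪ lamQ := by
    refine Measure.AbsolutelyContinuous.mk fun s hs hs0 => ?_
    rw [hj.comap_apply]
    refine hac ?_
    have h1 : (lamQ.map incl) (incl '' s) = 0 := by
      rw [hj.map_apply, preimage_image_eq _ hj.injective, hs0]
    rwa [map_incl_lamQ, Measure.restrict_apply (hj.measurableSet_image.2 hs),
      inter_eq_self_of_subset_left (by rw [← range_incl]; exact image_subset_range _ _)] at h1
  have hmem : ∀ q : Q₀, incl q ∈ Icc (0 : ℝ) 1 ×ˢ Icc (0 : ℝ) 1 := fun q =>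
    ⟨Ioc_subset_Icc_self q.1.2, Ico_subset_Icc_self q.2.2⟩
  have hmem0 : ∀ ξ : J₀, ((0 : ℝ), (ξ : ℝ)) ∈ Icc (0 : ℝ) 1 ×ˢ Icc (0 : ℝ) 1 := fun ξ =>
    ⟨by norm_num, Ico_subset_Icc_self ξ.2⟩
  have hfq : ∀ q q' : Q₀, |(f ∘ incl) q - (f ∘ incl) q'| ≤ max C 0 * dist q q' ^ t := fun q q' =>
    (hf _ (hmem q) _ (hmem q')).trans
      (mul_le_mul_of_nonneg_right (le_max_left _ _) (by positivity))
  have hfm : Measurable (f ∘ incl) := (continuous_of_abs_sub_le_dist_rpow ht hfq).measurable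
  have hfd : ∀ q q' : Q₀, |(f ∘ incl) q - (f ∘ incl) q'| ≤ max C 0 * qdist t q q' := fun q q' =>
    (hfq q q').trans (mul_le_mul_of_nonneg_left (dist_rpow_le_qdist q q') (le_max_right _ _))
  have hψd : ∀ ξ ξ' : J₀, |f (0, ξ) - f (0, ξ')| ≤ max C 0 * dist ξ ξ' ^ t := fun ξ ξ' => by
    have h1 := hf _ (hmem0 ξ) _ (hmem0 ξ')
    rw [Prod.dist_eq, dist_self, max_eq_right dist_nonneg] at h1
    exact h1.trans (mul_le_mul_of_nonneg_right (le_max_left _ _) (by positivity))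
  have hψ : IsParam.Holder t (max C 0) fun ξ : J₀ => f (0, ξ) :=
    ⟨(continuous_of_abs_sub_le_dist_rpow ht hψd).measurable, hψd⟩
  have hψ0 : ∫ ξ : J₀, f (0, (ξ : ℝ)) ∂subvol J₀ = 0 :=
    (integral_subtype_comap (μ := volume) measurableSet_Ico fun ω => f (0, ω)).trans
      (integral_Icc_eq_integral_Ico.symm.trans hc)
  have hW := h.integrable_sq_W ht ht1 hα hγ (le_max_right C 0) hψ hψ0 hfm (C := Cf)
    fun q => hreg _ (hmem q).1 _ (hmem q).2
  let q₀ : Q₀ := (⟨1, by norm_num⟩, ⟨0, by norm_num⟩)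
  obtain ⟨σ2, hσ⟩ := (h.returnSystem ht ht1).clt (h.separating_returnSystem ht ht1) hpres hac' hfm
    (F := |f (incl q₀)| + max C 0 * 2) (l := max C 0)
    (fun q => by
      have h1 := (hfd q q₀).trans
        (mul_le_mul_of_nonneg_left (qdist_le ht.le q q₀) (le_max_right C 0))
      have h2 := abs_sub_abs_le_abs_sub ((f ∘ incl) q) (f (incl q₀))
      exact sub_le_iff_le_add'.1 (h2.trans h1))
    (le_max_right _ _)
    (fun q q' => sub_le_iff_le_add'.1 ((le_abs_self _).trans (hfd q q')))
    (by
      have h1 := hj.integral_map (μ := ν.comap incl) f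
      rw [hmap, hf0] at h1
      exact h1.symm) hW
  refine ⟨σ2, fun g => (hσ g).congr fun n => ?_⟩
  conv_rhs => rw [← hmap, hj.integral_map]
  simp only [h.birkhoff_incl]
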